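/- For every pair of positive integers r and t, there is a polynomial f such that every graph G containing no induced subdivision of the complete bipartite graph K_{r,t} satisfies χ(G) ≤ f(ω(G)), where χ(G) is the chromatic number and ω(G) is the clique number of G. -/

import Mathlib

open SimpleGraph

/-- `G` contains a copy of `H` as a (not necessarily induced) subgraph. -/
def HasSubgraphCopy {V W : Type} (G : SimpleGraph V) (H : SimpleGraph W) : Prop :=
  ∃ f : H →g G, Function.Injective f

/-- `G` contains an induced copy of `H`. -/
def HasInducedCopy {V W : Type} (G : SimpleGraph V) (H : SimpleGraph W) : Prop :=
  ∃ s : Set V, Nonempty ((G.induce s) ≃g H)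

/-- The graph obtained from `G` by subdividing the edge `ab` once (`none` is the new vertex). -/
def edgeSubdiv {V : Type} (G : SimpleGraph V) (a b : V) : SimpleGraph (Option V) :=
  SimpleGraph.fromRel (fun x y =>
    (∃ x' y' : V, x = some x' ∧ y = some y' ∧ G.Adj x' y' ∧
      ¬((x' = a ∧ y' = b) ∨ (x' = b ∧ y' = a))) ∨
    (x = none ∧ (y = some a ∨ y = some b)))

/-- `IsSubdivision H S` : `S` is obtained from `H` by a finite sequence of single edge
subdivisions (edges of `H` get replaced by possibly longer paths). -/
inductive IsSubdivision : {V : Type} → SimpleGraph V → {W : Type} → SimpleGraph W → Prop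
  | refl {V : Type} (G : SimpleGraph V) : IsSubdivision G G
  | step {V W : Type} (G : SimpleGraph V) (H : SimpleGraph W) (a b : W) :
      IsSubdivision G H → H.Adj a b → IsSubdivision G (edgeSubdiv H a b)

/-- `G` contains an induced subdivision of `H`, i.e. some induced subgraph of `G` is
isomorphic to a subdivision of `H`. -/
def HasInducedSubdivision {V W : Type} (G : SimpleGraph V) (H : SimpleGraph W) : Prop :=
  ∃ (U : Type) (S : SimpleGraph U), IsSubdivision H S ∧ HasInducedCopy G S

/-- The average degree `2e(G)/|V(G)|` of a finite graph. -/
noncomputable def avgDeg {V : Type} (G : SimpleGraph V) [Fintype V] : ℝ :=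
  2 * G.edgeSet.ncard / Fintype.card V


section SubdivMachinery

/-- `Γ` (supported on `s`) is a realisation of a subdivision of `H` on the vertex set `s`. -/
def Rl {V W : Type} (H : SimpleGraph W) (s : Set V) (Γ : SimpleGraph V) : Prop :=
  ∃ (U : Type) (S : SimpleGraph U), IsSubdivision H S ∧ ∃ g : U → V, Function.Injective g ∧
    Set.range g = s ∧ (∀ u v, S.Adj u v ↔ Γ.Adj (g u) (g v)) ∧ ∀ x y, Γ.Adj x y → x ∈ s

lemma Rl_base {V W : Type} (H : SimpleGraph W) (f : W → V) (hf : Function.Injective f) :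
    Rl H (Set.range f) (H.map f) := by
  refine ⟨W, H, IsSubdivision.refl H, f, hf, rfl, ?_, ?_⟩
  · intro u v
    exact (SimpleGraph.map_adj_apply (f := ⟨f, hf⟩)).symm
  · intro x y h
    have h' : (H.map (⟨f, hf⟩ : W ↪ V)).Adj x y := h
    rw [SimpleGraph.map_adj] at h'
    obtain ⟨u, v, _, rfl, rfl⟩ := h'
    exact ⟨u, rfl⟩

/-- Subdividing the edge `xy` of `Γ` with the vertex `w`. -/
def sb {V : Type} (Γ : SimpleGraph V) (x y w : V) : SimpleGraph V :=
  SimpleGraph.fromRel (fun u v => (Γ.Adj u v ∧ s(u, v) ≠ s(x, y)) ∨ (u = w ∧ (v = x ∨ v = y)))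

lemma sb_adj {V : Type} (Γ : SimpleGraph V) (x y w : V) (hx : w ≠ x) (hy : w ≠ y) (u v : V) :
    (sb Γ x y w).Adj u v ↔ (Γ.Adj u v ∧ s(u, v) ≠ s(x, y)) ∨ (u = w ∧ (v = x ∨ v = y)) ∨
      (v = w ∧ (u = x ∨ u = y)) := by
  unfold sb
  rw [SimpleGraph.fromRel_adj]
  constructor
  · rintro ⟨h, (h1 | h1) | (h1 | h1)⟩
    · exact Or.inl h1
    · exact Or.inr (Or.inl h1)
    · exact Or.inl ⟨h1.1.symm, by rw [Sym2.eq_swap]; exact h1.2⟩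
    · exact Or.inr (Or.inr h1)
  · rintro (h | h | h)
    · exact ⟨h.1.ne, Or.inl (Or.inl h)⟩
    · refine ⟨?_, Or.inl (Or.inr h)⟩
      rintro rfl
      rcases h with ⟨rfl, h | h⟩ <;> contradiction
    · refine ⟨?_, Or.inr (Or.inr h)⟩
      rintro rfl
      rcases h with ⟨rfl, h | h⟩ <;> contradiction

lemma Rl_step {V W : Type} {H : SimpleGraph W} {s : Set V} {Γ : SimpleGraph V}
    (h : Rl H s Γ) {x y w : V} (hxy : Γ.Adj x y) (hw : w ∉ s) :
    Rl H (insert w s) (sb Γ x y w) := by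
  obtain ⟨U, S, hS, g, hg, hr, hadj, hsup⟩ := h
  have hxs : x ∈ s := hsup _ _ hxy
  have hys : y ∈ s := hsup _ _ hxy.symm
  have hwx : w ≠ x := fun h => hw (h ▸ hxs)
  have hwy : w ≠ y := fun h => hw (h ▸ hys)
  obtain ⟨a, rfl⟩ : x ∈ Set.range g := hr ▸ hxs
  obtain ⟨b, rfl⟩ : y ∈ Set.range g := hr ▸ hys
  have hgw : ∀ u, g u ≠ w := fun u hu => hw (hu ▸ hr ▸ ⟨u, rfl⟩)
  refine ⟨Option U, edgeSubdiv S a b, IsSubdivision.step H S a b hS ((hadj a b).2 hxy),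
    fun o => o.elim w g, ?_, ?_, ?_, ?_⟩
  · intro o1 o2
    rcases o1 with _ | u <;> rcases o2 with _ | v
    · simp
    · intro h; exact absurd h.symm (hgw v)
    · intro h; exact absurd h (hgw u)
    · intro h; exact congrArg some (hg h)
  · ext z
    simp only [Set.mem_range, Set.mem_insert_iff, ← hr]
    constructor
    · rintro ⟨_ | u, rfl⟩
      · left; rfl
      · right; exact ⟨u, rfl⟩
    · rintro (rfl | ⟨u, rfl⟩)
      · exact ⟨none, rfl⟩
      · exact ⟨some u, rfl⟩
  · intro o1 o2
    rw [sb_adj _ _ _ _ hwx hwy]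
    unfold edgeSubdiv
    rw [SimpleGraph.fromRel_adj]
    rcases o1 with _ | u <;> rcases o2 with _ | v
    · simp only [ne_eq, not_true_eq_false, false_and, Option.elim, false_iff]
      rintro (h | h | h)
      · exact h.1.ne rfl
      · rcases h with ⟨_, h | h⟩ <;> exact hgw _ h.symm
      · rcases h with ⟨_, h | h⟩ <;> exact hgw _ h.symm
    · have h1 : ¬ Γ.Adj w (g v) := fun h => hw (hsup _ _ h)
      have h2 := hgw v
      simp [h1, h2, hg.eq_iff]
    · have h1 : ¬ Γ.Adj (g u) w := fun h => hw (hsup _ _ h.symm)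
      have h2 := hgw u
      simp [h1, h2, hg.eq_iff]
    · have h1 := hgw u
      have h2 := hgw v
      simp only [Option.elim, h1, h2, false_and, or_false, ← hadj, ne_eq, Sym2.eq_iff, hg.eq_iff]
      constructor
      · rintro ⟨hne, h | h⟩
        · simp at h; exact ⟨h.1, by tauto⟩
        · simp at h; exact ⟨h.1.symm, by tauto⟩
      · rintro ⟨h3, h4⟩
        refine ⟨by simpa using h3.ne, Or.inl (Or.inl ⟨u, v, rfl, rfl, h3, by tauto⟩)⟩
  · intro u v h
    rw [sb_adj _ _ _ _ hwx hwy] at h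
    rcases h with h | h | h
    · exact Or.inr (hsup _ _ h.1)
    · exact Or.inl h.1
    · rcases h.2 with h | h <;> rw [h]
      · exact Or.inr hxs
      · exact Or.inr hys

lemma Rl_supp {V W : Type} {H : SimpleGraph W} {s : Set V} {Γ : SimpleGraph V}
    (h : Rl H s Γ) {x y : V} (hxy : Γ.Adj x y) : x ∈ s := by
  obtain ⟨U, S, hS, g, hg, hr, hadj, hsup⟩ := h
  exact hsup _ _ hxy

lemma Rl_path {V W : Type} {H : SimpleGraph W} {F : SimpleGraph V} {x y : V} (p : F.Walk x y) :
    p.IsPath → ∀ (s : Set V) (Γ : SimpleGraph V), Rl H s Γ → Γ.Adj x y →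
    (∀ z ∈ p.support, z ≠ x → z ≠ y → z ∉ s) →
    ∃ (s' : Set V) (Γ' : SimpleGraph V), Rl H s' Γ' ∧ s ⊆ s' ∧ s' ⊆ s ∪ {z | z ∈ p.support} ∧
      (∀ u v, Γ'.Adj u v → (Γ.Adj u v ∧ s(u, v) ≠ s(x, y)) ∨ F.Adj u v) ∧
      (∀ u v, Γ.Adj u v → s(u, v) ≠ s(x, y) → Γ'.Adj u v) := by
  induction p with
  | nil => intro _ s Γ _ h; exact absurd rfl h.ne
  | @cons x w y h q ih =>
    intro hp s Γ hR hxy hz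
    rw [SimpleGraph.Walk.cons_isPath_iff] at hp
    by_cases hwy : w = y
    · subst hwy
      refine ⟨s, Γ, hR, subset_rfl, Set.subset_union_left, ?_, fun u v h _ => h⟩
      intro u v huv
      by_cases he : s(u, v) = s(x, w)
      · right
        rw [Sym2.eq_iff] at he
        rcases he with ⟨rfl, rfl⟩ | ⟨rfl, rfl⟩
        · exact h
        · exact h.symm
      · exact Or.inl ⟨huv, he⟩
    · have hws : w ∉ s := hz w (by simp) h.ne.symm hwy
      have hwx : w ≠ x := h.ne.symm
      have h1 := Rl_step hR hxy hws
      have hadj := sb_adj Γ x y w hwx hwy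
      obtain ⟨s', Γ', hR', hs1, hs2, ha, hb⟩ := ih hp.1 _ _ h1
        ((hadj _ _).2 (Or.inr (Or.inl ⟨rfl, Or.inr rfl⟩))) (by
          intro z hz1 hz2 hz3 hz4
          have hzx : z ≠ x := fun h => hp.2 (h ▸ hz1)
          rcases hz4 with hz4 | hz4
          · exact hz2 hz4
          · exact hz z (by simp [hz1]) hzx hz3 hz4)
      refine ⟨s', Γ', hR', (Set.subset_insert _ _).trans hs1, ?_, ?_, ?_⟩
      · intro z hz5
        rcases hs2 hz5 with (rfl | h5) | h5
        · right; simp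
        · left; exact h5
        · right; exact List.mem_cons_of_mem _ h5
      · intro u v huv
        rcases ha u v huv with ⟨h6, h7⟩ | h6
        · rw [hadj] at h6
          rcases h6 with h6 | ⟨rfl, rfl | rfl⟩ | ⟨rfl, rfl | rfl⟩
          · exact Or.inl h6
          · exact Or.inr h.symm
          · exact absurd rfl h7
          · exact Or.inr h
          · exact absurd Sym2.eq_swap h7
        · exact Or.inr h6
      · intro u v huv hne
        apply hb u v ((hadj _ _).2 (Or.inl ⟨huv, hne⟩))
        intro he
        rw [Sym2.eq_iff] at he
        rcases he with ⟨rfl, rfl⟩ | ⟨rfl, rfl⟩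
        · exact hws (Rl_supp hR huv)
        · exact hws (Rl_supp hR huv.symm)

lemma aux_logic (A t P Q e C D : Prop) (h1 : P → ¬ e) (h2 : Q → ¬ e) :
    ((A ∧ ¬ t ∨ P ∨ Q) ∧ ¬ e) ∨ C ∨ D ↔ (A ∧ ¬ e ∧ ¬ t) ∨ (C ∨ P) ∨ (D ∨ Q) := by
  tauto

lemma Rl_full {V W : Type} {H : SimpleGraph W} {s : Set V} {Γ : SimpleGraph V}
    (hR : Rl H s Γ) (w : Sym2 V → V) (hw : ∀ e ∈ Γ.edgeSet, w e ∉ s)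
    (hinj : Set.InjOn w Γ.edgeSet) (T : Finset (Sym2 V)) :
    (∀ e ∈ T, e ∈ Γ.edgeSet) → ∃ Γ' : SimpleGraph V, Rl H (s ∪ w '' (T : Set (Sym2 V))) Γ' ∧
      ∀ u v, Γ'.Adj u v ↔ (Γ.Adj u v ∧ s(u, v) ∉ T) ∨ (∃ e ∈ T, u = w e ∧ v ∈ e) ∨
        (∃ e ∈ T, v = w e ∧ u ∈ e) := by
  classical
  induction T using Finset.induction_on with
  | empty => intro _; exact ⟨Γ, by simpa using hR, by simp⟩
  | @insert e T heT ih =>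
    intro hT
    obtain ⟨Γ', hR', hadj⟩ := ih (fun e he => hT e (Finset.mem_insert_of_mem he))
    have he := hT e (Finset.mem_insert_self _ _)
    induction e using Sym2.ind with
    | _ x y =>
    have hxy : Γ.Adj x y := he
    have hws : w s(x, y) ∉ s ∪ w '' (T : Set (Sym2 V)) := by
      rintro (h | ⟨e', he', h⟩)
      · exact hw _ he h
      · have := hinj (hT e' (Finset.mem_insert_of_mem he')) he h
        exact heT (this ▸ he')
    have hs := Rl_step hR' ((hadj x y).2 (Or.inl ⟨hxy, heT⟩)) hws
    have hwx : w s(x, y) ≠ x := fun h => hw _ he (by rw [h]; exact Rl_supp hR hxy)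
    have hwy : w s(x, y) ≠ y := fun h => hw _ he (by rw [h]; exact Rl_supp hR hxy.symm)
    refine ⟨sb Γ' x y (w s(x, y)), ?_, ?_⟩
    · convert hs using 1
      ext z; simp only [Finset.coe_insert, Set.image_insert_eq, Set.mem_union, Set.mem_insert_iff]; tauto
    · intro u v
      rw [sb_adj _ _ _ _ hwx hwy, hadj]
      simp only [Finset.mem_insert, not_or, exists_eq_or_imp, Sym2.mem_iff]
      have key1 : ∀ u v, (∃ e ∈ T, u = w e ∧ v ∈ e) → s(u, v) ≠ s(x, y) := by
        rintro u v ⟨e', he', rfl, hv⟩ heq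
        have hm : w e' ∈ s(x, y) := heq ▸ Sym2.mem_mk_left _ _
        rw [Sym2.mem_iff] at hm
        have := hw e' (hT e' (Finset.mem_insert_of_mem he'))
        rcases hm with hm | hm
        · exact this (hm ▸ Rl_supp hR hxy)
        · exact this (hm ▸ Rl_supp hR hxy.symm)
      have key2 : (∃ e ∈ T, v = w e ∧ u ∈ e) → s(u, v) ≠ s(x, y) := by
        intro h; rw [Sym2.eq_swap]; exact key1 _ _ h
      exact aux_logic _ _ _ _ _ _ _ (key1 u v) key2

lemma finish_subdiv {V W : Type} [Fintype V] {H : SimpleGraph W} {G : SimpleGraph V} {s : Set V}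
    {Γ : SimpleGraph V} (hR : Rl H s Γ) (w : Sym2 V → V)
    (hs : ∀ u ∈ s, ∀ v ∈ s, ¬ G.Adj u v)
    (hw : ∀ e ∈ Γ.edgeSet, w e ∉ s ∧ ∀ u ∈ s, (G.Adj (w e) u ↔ u ∈ e))
    (hww : ∀ e ∈ Γ.edgeSet, ∀ e' ∈ Γ.edgeSet, ¬ G.Adj (w e) (w e')) :
    HasInducedSubdivision G H := by
  classical
  have hes : ∀ e ∈ Γ.edgeSet, ∀ u ∈ e, u ∈ s := by
    intro e he u hu
    induction e using Sym2.ind with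
    | _ x y =>
    have hxy : Γ.Adj x y := he
    rw [Sym2.mem_iff] at hu
    rcases hu with rfl | rfl
    · exact Rl_supp hR hxy
    · exact Rl_supp hR hxy.symm
  have hinj : Set.InjOn w Γ.edgeSet := by
    intro e he e' he' h
    apply Sym2.ext
    intro u
    constructor
    · intro hu
      have hus := hes e he u hu
      rw [← (hw e' he').2 u hus, ← h, (hw e he).2 u hus]; exact hu
    · intro hu
      have hus := hes e' he' u hu
      rw [← (hw e he).2 u hus, h, (hw e' he').2 u hus]; exact hu
  obtain ⟨Γ', ⟨U, S, hS, g, hg, hr, hadj, hsup⟩, hΓ⟩ :=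
    Rl_full hR w (fun e he => (hw e he).1) hinj Γ.edgeFinset (by simp)
  refine ⟨U, S, hS, Set.range g, ⟨?_⟩⟩
  refine SimpleGraph.Iso.symm ⟨Equiv.ofInjective g hg, ?_⟩
  intro a b
  simp only [SimpleGraph.comap_adj, Function.Embedding.subtype_apply, Equiv.ofInjective_apply]
  rw [hadj, hΓ]
  have hga : g a ∈ s ∪ w '' (Γ.edgeFinset : Set (Sym2 V)) := hr ▸ ⟨a, rfl⟩
  have hgb : g b ∈ s ∪ w '' (Γ.edgeFinset : Set (Sym2 V)) := hr ▸ ⟨b, rfl⟩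
  generalize g a = u at *
  generalize g b = v at *
  simp only [SimpleGraph.coe_edgeFinset] at hga hgb
  have hno : ¬ (Γ.Adj u v ∧ s(u, v) ∉ Γ.edgeFinset) := by
    simp
  rw [or_iff_right hno]
  simp only [SimpleGraph.mem_edgeFinset]
  constructor
  · intro h
    rcases hga with ha | ⟨e, he, rfl⟩ <;> rcases hgb with hb | ⟨e', he', rfl⟩
    · exact absurd h (hs u ha v hb)
    · right; exact ⟨e', he', rfl, ((hw e' he').2 u ha).1 h.symm⟩
    · left; exact ⟨e, he, rfl, ((hw e he).2 v hb).1 h⟩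
    · exact absurd h (hww e he e' he')
  · rintro (⟨e, he, rfl, h⟩ | ⟨e, he, rfl, h⟩)
    · exact ((hw e he).2 _ (hes e he _ h)).2 h
    · exact (((hw e he).2 _ (hes e he _ h)).2 h).symm

end SubdivMachinery

section EdgeCount
open scoped Classical

noncomputable def nb {V : Type} (G : SimpleGraph V) (A : Finset V) (v : V) : Finset V :=
  A.filter (fun u => G.Adj v u)

noncomputable def ec {V : Type} (G : SimpleGraph V) (A B : Finset V) : ℕ :=
  ∑ b ∈ B, (nb G A b).card

lemma mem_nb {V : Type} {G : SimpleGraph V} {A : Finset V} {v u : V} :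
    u ∈ nb G A v ↔ u ∈ A ∧ G.Adj v u := by simp [nb]

lemma nb_subset {V : Type} {G : SimpleGraph V} {A : Finset V} {v : V} : nb G A v ⊆ A :=
  Finset.filter_subset _ _

lemma nb_mono {V : Type} {G : SimpleGraph V} {A B : Finset V} (h : A ⊆ B) (v : V) :
    nb G A v ⊆ nb G B v := Finset.filter_subset_filter _ h

lemma ec_comm {V : Type} (G : SimpleGraph V) (A B : Finset V) : ec G A B = ec G B A := by
  unfold ec nb
  simp only [Finset.card_filter]
  rw [Finset.sum_comm]
  simp only [SimpleGraph.adj_comm]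

lemma ec_mono {V : Type} (G : SimpleGraph V) {A B A' B' : Finset V} (h : A ⊆ A') (h' : B ⊆ B') :
    ec G A B ≤ ec G A' B' := by
  unfold ec
  calc ∑ b ∈ B, (nb G A b).card ≤ ∑ b ∈ B, (nb G A' b).card :=
        Finset.sum_le_sum (fun b _ => Finset.card_le_card (nb_mono h b))
    _ ≤ _ := Finset.sum_le_sum_of_subset h'

lemma ec_insert {V : Type} (G : SimpleGraph V) {R : Finset V} {v : V} (hv : v ∉ R) :
    ec G (insert v R) (insert v R) = ec G R R + 2 * (nb G R v).card := by
  have h1 : ec G (insert v R) (insert v R) = ec G (insert v R) R + (nb G R v).card := by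
    unfold ec
    rw [Finset.sum_insert hv, add_comm]
    congr 2
    ext u; simp only [mem_nb, Finset.mem_insert]
    constructor
    · rintro ⟨rfl | h, h2⟩
      · exact absurd rfl h2.ne
      · exact ⟨h, h2⟩
    · rintro ⟨h, h2⟩; exact ⟨Or.inr h, h2⟩
  rw [h1, ec_comm G (insert v R) R]
  have h2 : ec G R (insert v R) = (nb G R v).card + ec G R R := by
    unfold ec; rw [Finset.sum_insert hv]
  omega

lemma ec_le_sq {V : Type} (G : SimpleGraph V) (S : Finset V) : ec G S S ≤ S.card * S.card := by
  unfold ec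
  calc _ ≤ ∑ b ∈ S, S.card := Finset.sum_le_sum (fun b _ => Finset.card_le_card nb_subset)
    _ = _ := by simp

/-- average degree of every subset is at most `d` -/
def Sparse {V : Type} (G : SimpleGraph V) (d : ℕ) : Prop :=
  ∀ S : Finset V, ec G S S ≤ d * S.card

lemma Sparse.two {V : Type} {G : SimpleGraph V} {d : ℕ} (h : Sparse G d) (A B : Finset V) :
    ec G A B ≤ d * (A.card + B.card) :=
  calc ec G A B ≤ ec G (A ∪ B) (A ∪ B) :=
        ec_mono G Finset.subset_union_left Finset.subset_union_right
    _ ≤ d * (A ∪ B).card := h _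
    _ ≤ _ := Nat.mul_le_mul_left _ (Finset.card_union_le _ _)

lemma Sparse.min {V : Type} {G : SimpleGraph V} {d : ℕ} (h : Sparse G d) (S : Finset V)
    (hS : S.Nonempty) : ∃ v ∈ S, (nb G S v).card ≤ d := by
  by_contra! hc
  have h1 : ∑ v ∈ S, d < ∑ v ∈ S, (nb G S v).card := Finset.sum_lt_sum_of_nonempty hS hc
  have := h S
  unfold ec at this
  simp at h1
  rw [mul_comm] at h1
  omega

lemma Sparse.order {V : Type} {G : SimpleGraph V} {d : ℕ} (h : Sparse G d) (S : Finset V) :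
    ∃ o : V → ℕ, ∀ v ∈ S, ((nb G S v).filter (fun u => o u ≤ o v)).card ≤ d := by
  induction S using Finset.strongInduction with
  | _ S ih =>
  rcases S.eq_empty_or_nonempty with rfl | hS
  · exact ⟨fun _ => 0, by simp⟩
  obtain ⟨v, hv, hd⟩ := h.min S hS
  obtain ⟨o, ho⟩ := ih _ (Finset.erase_ssubset hv)
  have hlt : ∀ u ∈ S, o u < (S.sup o) + 1 := fun u hu =>
    Nat.lt_succ_of_le (Finset.le_sup (f := o) hu)
  refine ⟨Function.update o v (S.sup o + 1), ?_⟩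
  intro x hx
  by_cases hxv : x = v
  · subst hxv
    exact (Finset.card_le_card (Finset.filter_subset _ _)).trans hd
  · refine le_trans (Finset.card_le_card ?_) (ho x (Finset.mem_erase.2 ⟨hxv, hx⟩))
    intro u hu
    simp only [Finset.mem_filter, mem_nb, Finset.mem_erase] at hu ⊢
    have huv : u ≠ v := by
      rintro rfl
      have := hlt x hx
      simp [hxv] at hu
      omega
    simp [hxv, huv] at hu
    exact ⟨⟨⟨huv, hu.1.1⟩, hu.1.2⟩, hu.2⟩

lemma Sparse.color {V : Type} {G : SimpleGraph V} {d : ℕ} (h : Sparse G d) (S : Finset V) :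
    ∃ c : V → Fin (d + 1), ∀ u ∈ S, ∀ v ∈ S, G.Adj u v → c u ≠ c v := by
  induction S using Finset.strongInduction with
  | _ S ih =>
  rcases S.eq_empty_or_nonempty with rfl | hS
  · exact ⟨fun _ => 0, by simp⟩
  obtain ⟨v, hv, hd⟩ := h.min S hS
  obtain ⟨c, hc⟩ := ih _ (Finset.erase_ssubset hv)
  obtain ⟨k, hk⟩ : ∃ k : Fin (d + 1), k ∉ (nb G S v).image c := by
    by_contra! hcon
    have h1 : (Finset.univ : Finset (Fin (d + 1))) ⊆ (nb G S v).image c := fun x _ => hcon x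
    have h2 := Finset.card_le_card h1
    have h3 : ((nb G S v).image c).card ≤ (nb G S v).card := Finset.card_image_le
    simp at h2
    omega
  have hk' : ∀ u ∈ S, G.Adj v u → c u ≠ k := by
    intro u hu hvu he
    exact hk (Finset.mem_image.2 ⟨u, mem_nb.2 ⟨hu, hvu⟩, he⟩)
  refine ⟨Function.update c v k, ?_⟩
  intro x hx y hy hxy
  by_cases hxv : x = v
  · subst hxv
    have hyx : y ≠ x := hxy.ne.symm
    simp [hyx]
    exact fun h => hk' y hy hxy h.symm
  · by_cases hyv : y = v
    · subst hyv
      simp [hxv]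
      exact hk' x hx hxy.symm
    · simp [hxv, hyv]
      exact hc x (Finset.mem_erase.2 ⟨hxv, hx⟩) y (Finset.mem_erase.2 ⟨hyv, hy⟩) hxy

lemma Sparse.indep {V : Type} {G : SimpleGraph V} {d : ℕ} (h : Sparse G d) (S : Finset V) :
    ∃ I ⊆ S, (∀ u ∈ I, ∀ v ∈ I, ¬ G.Adj u v) ∧ S.card ≤ (d + 1) * I.card := by
  obtain ⟨c, hc⟩ := h.color S
  obtain ⟨k, -, hk⟩ := Finset.exists_max_image (Finset.univ : Finset (Fin (d + 1)))
    (fun k => (S.filter (fun u => c u = k)).card) ⟨0, Finset.mem_univ _⟩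
  refine ⟨S.filter (fun u => c u = k), Finset.filter_subset _ _, ?_, ?_⟩
  · intro u hu v hv huv
    simp only [Finset.mem_filter] at hu hv
    exact hc u hu.1 v hv.1 huv (hu.2.trans hv.2.symm)
  · rw [Finset.card_eq_sum_card_fiberwise (f := c) (t := Finset.univ) (by intro x _; simp)]
    calc _ ≤ ∑ b : Fin (d + 1), (S.filter (fun u => c u = k)).card :=
          Finset.sum_le_sum (fun b hb => hk b hb)
      _ = _ := by simp

end EdgeCount

section Mader
open scoped Classical

/-- neighbourhood of `U` in `S` -/
noncomputable def NS {V : Type} (F : SimpleGraph V) (S U : Finset V) : Finset V :=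
  (S \ U).filter (fun v => ∃ u ∈ U, F.Adj u v)

def Cn {V : Type} (F : SimpleGraph V) (U : Finset V) : Prop :=
  ∀ u ∈ U, ∀ v ∈ U, ∃ p : F.Walk u v, ∀ z ∈ p.support, z ∈ U

lemma Cn_insert {V : Type} {F : SimpleGraph V} {U : Finset V} (h : Cn F U) {u v : V}
    (hu : u ∈ U) (huv : F.Adj u v) : Cn F (insert v U) := by
  have key : ∀ x ∈ U, ∃ p : F.Walk x v, ∀ z ∈ p.support, z ∈ insert v U := by
    intro x hx
    obtain ⟨p, hp⟩ := h x hx u hu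
    refine ⟨p.concat huv, ?_⟩
    intro z hz
    rw [SimpleGraph.Walk.support_concat] at hz
    simp at hz
    rcases hz with hz | hz
    · exact Finset.mem_insert_of_mem (hp z hz)
    · simp [hz]
  intro x hx y hy
  rw [Finset.mem_insert] at hx hy
  rcases hx with rfl | hx <;> rcases hy with rfl | hy
  · exact ⟨SimpleGraph.Walk.nil, by simp⟩
  · obtain ⟨p, hp⟩ := key y hy
    exact ⟨p.reverse, by simpa using hp⟩
  · exact key x hx
  · obtain ⟨p, hp⟩ := h x hx y hy
    exact ⟨p, fun z hz => Finset.mem_insert_of_mem (hp z hz)⟩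

/-- the structural half of the inductive step in the topological minor theorem -/
lemma mader_struct {V : Type} (F : SimpleGraph V) (c : ℕ) (S : Finset V) (hS : S.Nonempty)
    (hc : (2 * c + 2) * S.card ≤ ec F S S) :
    ∃ U N : Finset V, U ⊆ S ∧ N ⊆ S ∧ Disjoint U N ∧ N.Nonempty ∧ Cn F U ∧
      (∀ v ∈ N, ∃ u ∈ U, F.Adj u v) ∧ c * N.card ≤ ec F N N := by
  induction S using Finset.strongInduction with
  | _ S ih =>
  by_cases hmin : ∃ R, R ⊂ S ∧ R.Nonempty ∧ (2 * c + 2) * R.card ≤ ec F R R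
  · obtain ⟨R, hR, hRn, hRc⟩ := hmin
    obtain ⟨U, N, h1, h2, h3⟩ := ih R hR hRn hRc
    exact ⟨U, N, h1.trans hR.subset, h2.trans hR.subset, h3⟩
  push Not at hmin
  let P : Finset (Finset V) := S.powerset.filter (fun U => U.Nonempty ∧ Cn F U ∧
    (2 * c + 2) * ((S \ U).card + 1) ≤ ec F (S \ U) (S \ U) + 2 * (NS F S U).card)
  have hP : P.Nonempty := by
    obtain ⟨v, hv⟩ := hS
    refine ⟨{v}, ?_⟩
    simp only [P, Finset.mem_filter, Finset.mem_powerset, Finset.singleton_subset_iff]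
    refine ⟨hv, by simp, ?_, ?_⟩
    · intro x hx y hy
      simp at hx hy
      subst hx; subst hy
      exact ⟨SimpleGraph.Walk.nil, by simp⟩
    · have hSi : S = insert v (S \ {v}) := by
        ext z; by_cases hz : z = v <;> simp [hz, hv]
      have hvn : v ∉ S \ {v} := by simp
      have h1 := ec_insert F hvn
      have h2 := Finset.card_insert_of_notMem hvn
      rw [← hSi] at h1 h2
      have h3 : NS F S {v} = nb F (S \ {v}) v := by
        ext z; simp [NS, nb]
      rw [h3, ← h1, ← h2]
      exact hc
  obtain ⟨U, hU, hmax⟩ := Finset.exists_max_image P Finset.card hP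
  simp only [P, Finset.mem_filter, Finset.mem_powerset] at hU
  obtain ⟨hUS, hUn, hUc, hUe⟩ := hU
  have hdisj : Disjoint U (NS F S U) := by
    rw [Finset.disjoint_left]
    intro x hx hx2
    simp [NS] at hx2
    exact hx2.1.2 hx
  refine ⟨U, NS F S U, hUS, ?_, hdisj, ?_, hUc, ?_, ?_⟩
  · exact (Finset.filter_subset _ _).trans Finset.sdiff_subset
  · by_contra hne
    rw [Finset.not_nonempty_iff_eq_empty] at hne
    rw [hne] at hUe
    rcases (S \ U).eq_empty_or_nonempty with he | he
    · rw [he] at hUe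
      simp [ec] at hUe
    · have := hmin (S \ U) (by
        refine Finset.ssubset_iff_subset_ne.2 ⟨Finset.sdiff_subset, ?_⟩
        intro heq
        obtain ⟨u, hu⟩ := hUn
        have := hUS hu
        rw [← heq] at this
        simp at this
        exact this.2 hu) he
      simp at hUe
      nlinarith
  · intro v hv
    simp [NS] at hv
    exact hv.2
  · unfold ec
    rw [mul_comm, ← smul_eq_mul]
    apply Finset.card_nsmul_le_sum
    intro v hv
    have hv' := hv
    simp only [NS, Finset.mem_filter, Finset.mem_sdiff] at hv'
    obtain ⟨⟨hvS, hvU⟩, u, hu, huv⟩ := hv'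
    set R := (S \ U).erase v with hRdef
    have hvR : v ∉ R := by simp [R]
    have hSU : S \ U = insert v R := by
      rw [hRdef, Finset.insert_erase]; simp [hvS, hvU]
    have hSU2 : S \ (insert v U) = R := by
      ext z; simp [R]; tauto
    have hnot : ¬ ((2 * c + 2) * ((S \ insert v U).card + 1) ≤
        ec F (S \ insert v U) (S \ insert v U) + 2 * (NS F S (insert v U)).card) := by
      intro hcon
      have hmem : insert v U ∈ P := by
        simp only [P, Finset.mem_filter, Finset.mem_powerset]
        refine ⟨Finset.insert_subset hvS hUS, by simp, Cn_insert hUc hu huv, hcon⟩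
      have := hmax _ hmem
      rw [Finset.card_insert_of_notMem hvU] at this
      omega
    rw [hSU2] at hnot
    have h1 := ec_insert F hvR
    rw [← hSU] at h1
    have h2 := Finset.card_insert_of_notMem hvR
    rw [← hSU] at h2
    have h3 : NS F S (insert v U) = (NS F S U).erase v ∪ (nb F R v) := by
      ext z
      simp only [NS, Finset.mem_filter, hSU2, Finset.mem_union, Finset.mem_erase, mem_nb, hSU,
        Finset.mem_insert]
      by_cases hz : z = v
      · subst hz; simp [hvR]
      · simp only [hz, false_or, exists_eq_or_imp, not_false_eq_true, true_and, ne_eq, Finset.mem_insert]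
        rw [and_or_left, or_comm]
    have h4 : (NS F S U).erase v ∩ nb F R v = nb F (NS F S U) v := by
      ext z
      simp only [NS, Finset.mem_filter, Finset.mem_inter, Finset.mem_erase, mem_nb, hSU,
        Finset.mem_insert]
      by_cases hz : z = v
      · subst hz; simp
      · simp [hz]; tauto
    have h5 := Finset.card_union_add_card_inter ((NS F S U).erase v) (nb F R v)
    rw [← h3, h4, Finset.card_erase_of_mem hv] at h5
    have h6 : 0 < (NS F S U).card := Finset.card_pos.2 ⟨v, hv⟩
    rw [h2] at hUe
    rw [h1] at hUe
    have h7 : (2 * c + 2) * (R.card + 1 + 1) = (2 * c + 2) * (R.card + 1) + (2 * c + 2) := by ring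
    omega

lemma mader_aux {W : Type} [Fintype W] (H : SimpleGraph W) (T : Finset (Sym2 W)) :
    (∀ e ∈ T, e ∈ H.edgeSet) →
    ∃ c : ℕ, ∀ (V : Type) (F : SimpleGraph V) (S : Finset V), S.Nonempty →
      c * S.card ≤ ec F S S → ∃ (f : W → V) (s : Set V) (Γ : SimpleGraph V),
        Function.Injective f ∧ s ⊆ S ∧ Rl H s Γ ∧
        (∀ u v, Γ.Adj u v → F.Adj u v ∨ ∃ e ∈ H.edgeSet, e ∉ T ∧ s(u, v) = e.map f) ∧
        (∀ a b, H.Adj a b → s(a, b) ∉ T → Γ.Adj (f a) (f b)) := by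
  induction T using Finset.induction_on with
  | empty =>
    intro _
    refine ⟨Fintype.card W, ?_⟩
    intro V F S hS hc
    have h1 := hc.trans (ec_le_sq F S)
    have h2 : Fintype.card W ≤ S.card := Nat.le_of_mul_le_mul_right h1 (Finset.card_pos.2 hS)
    obtain ⟨g⟩ : Nonempty (W ↪ S) := by
      apply Function.Embedding.nonempty_of_card_le; simpa using h2
    have hf : Function.Injective (fun w => (g w : V)) := fun a b h => g.injective (Subtype.ext h)
    refine ⟨fun w => g w, Set.range (fun w => (g w : V)), H.map (fun w => (g w : V)), hf, ?_,
      Rl_base H _ hf, ?_, ?_⟩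
    · rintro _ ⟨w, rfl⟩; exact (g w).2
    · intro u v h
      right
      have h' : (H.map (⟨_, hf⟩ : W ↪ V)).Adj u v := h
      rw [SimpleGraph.map_adj] at h'
      obtain ⟨a, b, hab, rfl, rfl⟩ := h'
      exact ⟨s(a, b), hab, by simp, by simp⟩
    · intro a b hab _
      exact (SimpleGraph.map_adj_apply (f := ⟨_, hf⟩)).2 hab
  | @insert e0 T heT ih =>
    intro hT
    obtain ⟨c, hc⟩ := ih (fun e he => hT e (Finset.mem_insert_of_mem he))
    refine ⟨2 * c + 2, ?_⟩
    intro V F S hS hcS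
    obtain ⟨U, N, hUS, hNS, hdis, hNn, hUc, hUN, hNe⟩ := mader_struct F c S hS hcS
    obtain ⟨f, s, Γ, hf, hs, hR, hΓ, hΓ2⟩ := hc V F N hNn hNe
    have he0 := hT e0 (Finset.mem_insert_self _ _)
    induction e0 using Sym2.ind with
    | _ a b =>
    have hab : H.Adj a b := he0
    have hfab := hΓ2 a b hab heT
    obtain ⟨u, hu, hua⟩ := hUN (f a) (hs (Rl_supp hR hfab))
    obtain ⟨u', hu', hub⟩ := hUN (f b) (hs (Rl_supp hR hfab.symm))
    obtain ⟨p, hp⟩ := hUc u hu u' hu'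
    let q : F.Walk (f a) (f b) := SimpleGraph.Walk.cons hua.symm (p.concat hub)
    have hq : ∀ z ∈ q.support, z = f a ∨ z = f b ∨ z ∈ U := by
      intro z hz
      simp only [q, SimpleGraph.Walk.support_cons, SimpleGraph.Walk.support_concat] at hz
      simp at hz
      rcases hz with h | h | h
      · exact Or.inl h
      · exact Or.inr (Or.inr (hp z h))
      · exact Or.inr (Or.inl h)
    have hq' : ∀ z ∈ (q.bypass).support, z = f a ∨ z = f b ∨ z ∈ U := fun z hz =>
      hq z (SimpleGraph.Walk.support_bypass_subset_support q hz)
    obtain ⟨s', Γ', hR', hss, hs', ha, hb⟩ := Rl_path q.bypass (SimpleGraph.Walk.bypass_isPath q)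
      s Γ hR hfab (by
        intro z hz hz1 hz2 hz3
        rcases hq' z hz with h | h | h
        · exact hz1 h
        · exact hz2 h
        · exact Finset.disjoint_left.1 hdis h (hs hz3))
    refine ⟨f, s', Γ', hf, ?_, hR', ?_, ?_⟩
    · intro z hz
      rcases hs' hz with h | h
      · exact hNS (hs h)
      · rcases hq' z h with h | h | h
        · rw [h]; exact hNS (hs (Rl_supp hR hfab))
        · rw [h]; exact hNS (hs (Rl_supp hR hfab.symm))
        · exact hUS h
    · intro x y hxy
      rcases ha x y hxy with ⟨h1, h2⟩ | h1
      · rcases hΓ x y h1 with h3 | ⟨e, he, heT', hee⟩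
        · exact Or.inl h3
        · refine Or.inr ⟨e, he, ?_, hee⟩
          rw [Finset.mem_insert, not_or]
          refine ⟨?_, heT'⟩
          rintro rfl
          exact h2 (by rw [hee]; simp)
      · exact Or.inl h1
    · intro a' b' hab' hn
      rw [Finset.mem_insert, not_or] at hn
      apply hb _ _ (hΓ2 a' b' hab' hn.2)
      intro he
      apply hn.1
      have : Sym2.map f s(a', b') = Sym2.map f s(a, b) := by simpa using he
      exact Sym2.map.injective hf this

lemma mader {W : Type} [Fintype W] (H : SimpleGraph W) :
    ∃ c : ℕ, ∀ (V : Type) (F : SimpleGraph V) (S : Finset V), S.Nonempty →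
      c * S.card ≤ ec F S S → ∃ (s : Set V) (Γ : SimpleGraph V), s ⊆ S ∧ Rl H s Γ ∧
        (∀ u v, Γ.Adj u v → F.Adj u v) := by
  obtain ⟨c, hc⟩ := mader_aux H H.edgeFinset (by simp)
  refine ⟨c, fun V F S hS h => ?_⟩
  obtain ⟨f, s, Γ, -, hs, hR, hΓ, -⟩ := hc V F S hS h
  refine ⟨s, Γ, hs, hR, fun u v huv => ?_⟩
  rcases hΓ u v huv with h | ⟨e, he, he', -⟩
  · exact h
  · simp at he'; exact absurd he he'

/-- finishing lemma: a bipartite cherry structure of large density -/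
lemma finishF {W : Type} [Fintype W] (H : SimpleGraph W) :
    ∃ K : ℕ, ∀ (V : Type) [Fintype V] (G : SimpleGraph V) (A B : Finset V),
      (∀ u ∈ A, ∀ v ∈ A, ¬ G.Adj u v) → (∀ u ∈ B, ∀ v ∈ B, ¬ G.Adj u v) →
      (∀ b ∈ B, (nb G A b).card = 2) → (∀ b ∈ B, ∀ b' ∈ B, nb G A b = nb G A b' → b = b') →
      B.Nonempty → K * A.card ≤ B.card → HasInducedSubdivision G H := by
  obtain ⟨c, hc⟩ := mader H
  refine ⟨c, ?_⟩
  intro V _ G A B hA hB h2 hinj hBn hK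
  let F : SimpleGraph V := SimpleGraph.fromRel (fun x y => ∃ b ∈ B, nb G A b = {x, y})
  have hF : ∀ x y, F.Adj x y ↔ x ≠ y ∧ ∃ b ∈ B, nb G A b = {x, y} := by
    intro x y
    simp only [F, SimpleGraph.fromRel_adj]
    constructor
    · rintro ⟨h, ⟨b, hb, h1⟩ | ⟨b, hb, h1⟩⟩
      · exact ⟨h, b, hb, h1⟩
      · exact ⟨h, b, hb, by rw [h1, Finset.pair_comm]⟩
    · rintro ⟨h, h1⟩; exact ⟨h, Or.inl h1⟩
  have hpair : ∀ b, ∃ xy : V × V, b ∈ B → xy.1 ≠ xy.2 ∧ nb G A b = {xy.1, xy.2} := by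
    intro b
    by_cases hb : b ∈ B
    · obtain ⟨x, y, hxy, h⟩ := Finset.card_eq_two.1 (h2 b hb)
      exact ⟨(x, y), fun _ => ⟨hxy, h⟩⟩
    · exact ⟨(b, b), fun h => absurd h hb⟩
  choose π hπ using hpair
  have hπA : ∀ b ∈ B, (π b).1 ∈ A ∧ (π b).2 ∈ A := by
    intro b hb
    have h := (hπ b hb).2
    constructor
    · apply @nb_subset V G A b; rw [h]; simp
    · apply @nb_subset V G A b; rw [h]; simp
  have hAn : A.Nonempty := by
    obtain ⟨b, hb⟩ := hBn
    exact ⟨_, (hπA b hb).1⟩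
  have hcard : B.card ≤ ec F A A := by
    have : ec F A A = (A.sigma (fun x => nb F A x)).card := by
      rw [Finset.card_sigma]; rfl
    rw [this]
    apply Finset.card_le_card_of_injOn (fun b => (⟨(π b).1, (π b).2⟩ : Σ _ : V, V))
    · intro b hb
      have hb' : b ∈ B := hb
      simp only [Finset.coe_sigma, Set.mem_sigma_iff, Finset.mem_coe, mem_nb]
      exact ⟨(hπA b hb').1, (hπA b hb').2, (hF _ _).2 ⟨(hπ b hb').1, b, hb', (hπ b hb').2⟩⟩
    · intro b hb b' hb' h
      simp at h
      apply hinj b hb b' hb'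
      rw [(hπ b hb).2, (hπ b' hb').2, h.1, h.2]
  obtain ⟨s, Γ, hs, hR, hΓ⟩ := hc V F A hAn (hK.trans hcard)
  have hw : ∀ e : Sym2 V, ∃ w : V, e ∈ Γ.edgeSet → w ∈ B ∧ ∀ u, u ∈ nb G A w ↔ u ∈ e := by
    intro e
    by_cases he : e ∈ Γ.edgeSet
    · induction e using Sym2.ind with
      | _ x y =>
      obtain ⟨-, b, hb, h⟩ := (hF _ _).1 (hΓ x y he)
      refine ⟨b, fun _ => ⟨hb, fun u => ?_⟩⟩
      rw [h]; simp
    · obtain ⟨b, hb⟩ := hBn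
      exact ⟨b, fun h => absurd h he⟩
  choose w hw using hw
  apply finish_subdiv hR w
  · intro u hu v hv
    exact hA u (hs hu) v (hs hv)
  · intro e he
    refine ⟨?_, ?_⟩
    · intro hcon
      have h1 := h2 _ (hw e he).1
      have : (nb G A (w e)) = ∅ := by
        ext z; simp only [mem_nb]
        simp
        intro hz
        exact hA _ (hs hcon) z hz
      rw [this] at h1
      simp at h1
    · intro u hu
      rw [← (hw e he).2 u, mem_nb]
      exact ⟨fun h => ⟨hs hu, h⟩, fun h => h.2⟩
  · intro e he e' he'
    exact hB _ (hw e he).1 _ (hw e' he').1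

end Mader

section LemE
open scoped Classical

def NoBip {V : Type} (G : SimpleGraph V) (s : ℕ) : Prop :=
  ∀ X Y : Finset V, s ≤ X.card → s ≤ Y.card → ∃ x ∈ X, ∃ y ∈ Y, ¬ G.Adj x y

def Ram {V : Type} (G : SimpleGraph V) (s N : ℕ) : Prop :=
  ∀ X : Finset V, s ≤ X.card → ∃ U ⊆ X, U.card = N ∧ ∀ x ∈ U, ∀ y ∈ U, ¬ G.Adj x y

/-- vertices adjacent to almost all of `W` -/
noncomputable def badv {V : Type} [Fintype V] (G : SimpleGraph V) (s : ℕ) (W : Finset V) :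
    Finset V :=
  Finset.univ.filter (fun v => 2 * s * (W \ nb G W v).card < W.card)

lemma badv_card {V : Type} [Fintype V] {G : SimpleGraph V} {s : ℕ} (hb : NoBip G s)
    (W : Finset V) (hW : 2 * s ≤ W.card) : (badv G s W).card ≤ s := by
  by_contra! hcon
  obtain ⟨Z, hZ, hZc⟩ := Finset.exists_subset_card_eq hcon.le
  let Y := W.filter (fun w => ∀ v ∈ Z, G.Adj v w)
  have h1 : W \ Y ⊆ Z.biUnion (fun v => W \ nb G W v) := by
    intro w hw
    simp only [Y, Finset.mem_sdiff, Finset.mem_filter, not_and, not_forall] at hw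
    obtain ⟨v, hv, hn⟩ := hw.2 hw.1
    rw [Finset.mem_biUnion]
    exact ⟨v, hv, by rw [Finset.mem_sdiff, mem_nb]; exact ⟨hw.1, fun h => hn h.2⟩⟩
  have h2 : 2 * s * (W \ Y).card ≤ s * W.card := by
    calc 2 * s * (W \ Y).card ≤ 2 * s * ∑ v ∈ Z, (W \ nb G W v).card :=
          Nat.mul_le_mul_left _ ((Finset.card_le_card h1).trans Finset.card_biUnion_le)
      _ = ∑ v ∈ Z, 2 * s * (W \ nb G W v).card := by rw [Finset.mul_sum]
      _ ≤ ∑ v ∈ Z, W.card := by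
          apply Finset.sum_le_sum
          intro v hv
          have := hZ hv
          simp only [badv, Finset.mem_filter] at this
          exact this.2.le
      _ = s * W.card := by simp [hZc]
  have hY : Y ⊆ W := Finset.filter_subset _ _
  have h3 := Finset.card_sdiff_add_card_eq_card hY
  rcases Nat.eq_zero_or_pos s with h0 | h0
  · subst h0
    obtain ⟨v, hv⟩ := Finset.card_pos.1 hcon
    obtain ⟨x, hx, -⟩ := hb ∅ ∅ (by simp) (by simp)
    simp at hx
  have h4 : 2 * (W \ Y).card ≤ W.card := by
    have : s * (2 * (W \ Y).card) ≤ s * W.card := by rw [← mul_assoc, mul_comm s 2]; exact h2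
    exact Nat.le_of_mul_le_mul_left this h0
  obtain ⟨x, hx, y, hy, hn⟩ := hb Z Y hZc.ge (by omega)
  simp only [Y, Finset.mem_filter] at hy
  exact hn (hy.2 x hx)

lemma greedyW {V ι : Type} [Fintype V] [Nonempty V] {G : SimpleGraph V} {s : ℕ} (hb : NoBip G s)
    (hs : 0 < s) (E : Finset ι) : ∀ (Wf : ι → Finset V),
    (∀ e ∈ E, (2 * s) ^ E.card * (2 * s * (E.card + 1)) ≤ (Wf e).card) →
    ∃ w : ι → V, (∀ e ∈ E, w e ∈ Wf e) ∧ ∀ e ∈ E, ∀ e' ∈ E, ¬ G.Adj (w e) (w e') := by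
  induction E using Finset.induction_on with
  | empty =>
    intro Wf _
    exact ⟨fun _ => Classical.arbitrary V, by simp, by simp⟩
  | @insert e0 E he0 ih =>
    intro Wf hW
    rw [Finset.card_insert_of_notMem he0] at hW
    have hpow : 1 ≤ (2 * s) ^ E.card := Nat.one_le_pow _ _ (by omega)
    have hW2 : ∀ e ∈ insert e0 E, 2 * s * (E.card + 2) ≤ (Wf e).card := by
      intro e he
      have := hW e he
      have h2 : 1 ≤ (2 * s) ^ (E.card + 1) := Nat.one_le_pow _ _ (by omega)
      nlinarith
    have hcard : (E.biUnion (fun e => badv G s (Wf e))).card ≤ E.card * s := by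
      refine Finset.card_biUnion_le.trans ?_
      calc _ ≤ ∑ e ∈ E, s := by
            apply Finset.sum_le_sum
            intro e he
            apply badv_card hb
            have := hW2 e (Finset.mem_insert_of_mem he)
            nlinarith
        _ = _ := by simp
    obtain ⟨v, hv, hvn⟩ : ∃ v ∈ Wf e0, v ∉ E.biUnion (fun e => badv G s (Wf e)) := by
      by_contra! hcon
      have h1 := Finset.card_le_card (show Wf e0 ⊆ _ from hcon)
      have := hW2 e0 (Finset.mem_insert_self _ _)
      nlinarith
    obtain ⟨w, hw1, hw2⟩ := ih (fun e => Wf e \ nb G (Wf e) v) (by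
      intro e he
      have h1 := hW e (Finset.mem_insert_of_mem he)
      have h2 : (Wf e).card ≤ 2 * s * (Wf e \ nb G (Wf e) v).card := by
        by_contra! hcon
        exact hvn (Finset.mem_biUnion.2 ⟨e, he, by simp [badv, hcon]⟩)
      have h3 := h1.trans h2
      rw [pow_succ] at h3
      have h4 : 2 * s * ((2 * s) ^ E.card * (2 * s * (E.card + 1 + 1))) ≤
          2 * s * (Wf e \ nb G (Wf e) v).card := by
        refine le_trans (le_of_eq ?_) h3; ring
      have h5 := Nat.le_of_mul_le_mul_left h4 (by omega)
      refine le_trans ?_ h5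
      gcongr
      omega)
    have hne : ∀ e ∈ E, e ≠ e0 := fun e he h => he0 (h ▸ he)
    have hnadj : ∀ e ∈ E, ¬ G.Adj v (w e) := by
      intro e he h
      have := hw1 e he
      rw [Finset.mem_sdiff, mem_nb] at this
      exact this.2 ⟨this.1, h⟩
    refine ⟨Function.update w e0 v, ?_, ?_⟩
    · intro e he
      rcases Finset.mem_insert.1 he with rfl | he
      · simpa using hv
      · rw [Function.update_of_ne (hne e he)]
        exact (Finset.mem_sdiff.1 (hw1 e he)).1
    · intro e he e' he'
      rcases Finset.mem_insert.1 he with h1 | h1 <;> rcases Finset.mem_insert.1 he' with h2 | h2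
      · rw [h1, h2]; simp
      · rw [h1, Function.update_of_ne (hne e' h2)]; simpa using hnadj e' h2
      · rw [h2, Function.update_of_ne (hne e h1)]
        simpa [SimpleGraph.adj_comm] using hnadj e h1
      · rw [Function.update_of_ne (hne e h1), Function.update_of_ne (hne e' h2)]
        exact hw2 e h1 e' h2

lemma count_bad {V ι : Type} [Fintype ι] [DecidableEq ι] (X : Finset V) (j : ι) (k : ℕ)
    (Bd : (ι → V) → Finset V) (hB : ∀ φ v, Bd (Function.update φ j v) = Bd φ)
    (hc : ∀ φ, (Bd φ).card ≤ k) :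
    ((Fintype.piFinset (fun _ : ι => X)).filter (fun φ => φ j ∈ Bd φ)).card * X.card ≤
      k * (Fintype.piFinset (fun _ : ι => X)).card := by
  set Φ := Fintype.piFinset (fun _ : ι => X) with hΦ
  rw [← Finset.card_product]
  have h1 : (Φ.sigma (fun φ => Bd φ)).card ≤ k * Φ.card := by
    rw [Finset.card_sigma, mul_comm]
    calc _ ≤ ∑ φ ∈ Φ, k := Finset.sum_le_sum (fun φ _ => hc φ)
      _ = _ := by simp
  refine le_trans ?_ h1
  apply Finset.card_le_card_of_injOn
    (fun p : (ι → V) × V => (⟨Function.update p.1 j p.2, p.1 j⟩ : Σ _ : (ι → V), V))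
  · rintro ⟨φ, v⟩ h
    simp only [Finset.coe_product, Set.mem_prod, Finset.mem_coe, Finset.mem_filter] at h
    simp only [Finset.coe_sigma, Set.mem_sigma_iff, Finset.mem_coe]
    refine ⟨?_, ?_⟩
    · rw [hΦ, Fintype.mem_piFinset] at h ⊢
      intro i
      by_cases hi : i = j
      · subst hi; simpa using h.2
      · simpa [hi] using h.1.1 i
    · rw [hB]; exact h.1.2
  · rintro ⟨φ, v⟩ h ⟨φ', v'⟩ h' he
    simp only [Sigma.mk.injEq, heq_eq_eq] at he
    obtain ⟨he1, he2⟩ := he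
    have hv : v = v' := by
      have := congrFun he1 j
      simpa using this
    refine Prod.ext ?_ hv
    funext i
    by_cases hi : i = j
    · subst hi; exact he2
    · have := congrFun he1 i
      simpa [hi] using this

lemma card_small_subsets {ι : Type} [Fintype ι] (N : ℕ) (h2 : 2 ≤ Fintype.card ι) :
    ((Finset.univ : Finset (Finset ι)).filter (fun J => J.card < N)).card ≤
      (Fintype.card ι) ^ N := by
  have h1 : ((Finset.univ : Finset (Finset ι)).filter (fun J => J.card < N)) ⊆
      (Finset.range N).biUnion (fun k => Finset.powersetCard k (Finset.univ : Finset ι)) := by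
    intro J hJ
    simp only [Finset.mem_filter] at hJ
    rw [Finset.mem_biUnion]
    exact ⟨J.card, by simpa using hJ.2, by simp⟩
  refine (Finset.card_le_card h1).trans (Finset.card_biUnion_le.trans ?_)
  calc _ ≤ ∑ k ∈ Finset.range N, (Fintype.card ι) ^ k := by
        apply Finset.sum_le_sum
        intro k _
        rw [Finset.card_powersetCard, Finset.card_univ]
        exact Nat.choose_le_pow _ _
    _ ≤ _ := (Nat.geomSum_lt h2 (by simp)).le

/-- common neighbours -/
noncomputable def Wc {V : Type} [Fintype V] (G : SimpleGraph V) (a b : V) : Finset V :=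
  nb G Finset.univ a ∩ nb G Finset.univ b

noncomputable def Wr {V : Type} [Fintype V] {ι : Type} (G : SimpleGraph V) (φ : ι → V)
    (i l : ι) (J : Finset ι) : Finset V :=
  (Wc G (φ i) (φ l)).filter (fun w => ∀ j ∈ J, ¬ G.Adj (φ j) w)

lemma Wr_insert {V : Type} [Fintype V] {ι : Type} [DecidableEq ι] (G : SimpleGraph V) (φ : ι → V)
    (i l j : ι) (J : Finset ι) :
    Wr G φ i l (insert j J) = Wr G φ i l J \ nb G (Wr G φ i l J) (φ j) := by
  ext w
  simp only [Wr, Finset.mem_filter, Finset.mem_sdiff, mem_nb, Finset.mem_insert]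
  constructor
  · rintro ⟨h1, h2⟩
    exact ⟨⟨h1, fun k hk => h2 k (Or.inr hk)⟩, fun h => h2 j (Or.inl rfl) h.2⟩
  · rintro ⟨h1, h2⟩
    refine ⟨h1.1, ?_⟩
    rintro k (rfl | hk)
    · exact fun h => h2 ⟨h1, h⟩
    · exact h1.2 k hk

lemma Wr_update {V : Type} [Fintype V] {ι : Type} [DecidableEq ι] (G : SimpleGraph V) (φ : ι → V)
    (i l j : ι) (J : Finset ι) (hi : i ≠ j) (hl : l ≠ j) (hJ : j ∉ J) (v : V) :
    Wr G (Function.update φ j v) i l J = Wr G φ i l J := by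
  unfold Wr
  rw [Function.update_of_ne hi, Function.update_of_ne hl]
  apply Finset.filter_congr
  intro w _
  refine forall₂_congr ?_
  intro k hk
  rw [Function.update_of_ne (by rintro rfl; exact hJ hk)]

lemma exists_good {V : Type} [Fintype V] {G : SimpleGraph V} {s N : ℕ} (hb : NoBip G s)
    (hs : 3 ≤ s) (X : Finset V) (hX : s ^ (N + 5) ≤ X.card) :
    ∃ φ : Fin s → V, (∀ i, φ i ∈ X) ∧ Function.Injective φ ∧
      ∀ (i l j : Fin s) (J : Finset (Fin s)), i ≠ j → l ≠ j → j ∉ J → J.card < N →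
        2 * s ≤ (Wr G φ i l J).card →
        (Wr G φ i l J).card ≤ 2 * s * (Wr G φ i l (insert j J)).card := by
  set Φ := Fintype.piFinset (fun _ : Fin s => X) with hΦ
  have hXpos : 0 < X.card := lt_of_lt_of_le (by positivity) hX
  have hΦpos : 0 < Φ.card := by
    rw [hΦ, Fintype.card_piFinset]; exact Finset.prod_pos (fun _ _ => hXpos)
  -- collisions
  let Bd1 : Fin s × Fin s → (Fin s → V) → Finset V := fun p φ => if p.1 = p.2 then ∅ else {φ p.1}
  let Bd2 : (Fin s × Fin s × Fin s) × Finset (Fin s) → (Fin s → V) → Finset V := fun p φ =>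
    if p.1.1 ≠ p.1.2.2 ∧ p.1.2.1 ≠ p.1.2.2 ∧ p.1.2.2 ∉ p.2 ∧
      2 * s ≤ (Wr G φ p.1.1 p.1.2.1 p.2).card then
      badv G s (Wr G φ p.1.1 p.1.2.1 p.2) else ∅
  have c1 : ∀ p : Fin s × Fin s,
      (Φ.filter (fun φ => φ p.2 ∈ Bd1 p φ)).card * X.card ≤ s * Φ.card := by
    intro p
    refine count_bad X p.2 s (Bd1 p) ?_ ?_
    · intro φ v
      simp only [Bd1]
      split_ifs with h
      · rfl
      · rw [Function.update_of_ne h]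
    · intro φ
      simp only [Bd1]
      split_ifs
      · simp
      · simp; omega
  have c2 : ∀ p : (Fin s × Fin s × Fin s) × Finset (Fin s),
      (Φ.filter (fun φ => φ p.1.2.2 ∈ Bd2 p φ)).card * X.card ≤ s * Φ.card := by
    intro p
    refine count_bad X p.1.2.2 s (Bd2 p) ?_ ?_
    · intro φ v
      simp only [Bd2]
      by_cases h : p.1.1 ≠ p.1.2.2 ∧ p.1.2.1 ≠ p.1.2.2 ∧ p.1.2.2 ∉ p.2
      · rw [Wr_update G φ _ _ _ _ h.1 h.2.1 h.2.2]
      · rw [if_neg (by tauto), if_neg (by tauto)]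
    · intro φ
      simp only [Bd2]
      split_ifs with h
      · exact badv_card hb _ h.2.2.2
      · simp
  let I2 : Finset ((Fin s × Fin s × Fin s) × Finset (Fin s)) :=
    Finset.univ ×ˢ (Finset.univ.filter (fun J => J.card < N))
  have hI2 : I2.card ≤ s ^ 3 * s ^ N := by
    simp only [I2, Finset.card_product]
    apply Nat.mul_le_mul
    · simp; apply le_of_eq; ring
    · have := card_small_subsets (ι := Fin s) N (by simp; omega)
      simpa using this
  by_contra hcon
  have hcov : Φ ⊆ (Finset.univ.biUnion (fun p => Φ.filter (fun φ => φ p.2 ∈ Bd1 p φ))) ∪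
      (I2.biUnion (fun p => Φ.filter (fun φ => φ p.1.2.2 ∈ Bd2 p φ))) := by
    intro φ hφ
    by_contra hn
    rw [Finset.mem_union, not_or] at hn
    obtain ⟨hn1, hn2⟩ := hn
    simp only [Finset.mem_biUnion, not_exists, not_and, Finset.mem_filter, Finset.mem_univ,
      true_and] at hn1 hn2
    apply hcon
    refine ⟨φ, fun i => (Fintype.mem_piFinset.1 hφ) i, ?_, ?_⟩
    · intro i j hij
      by_contra hne
      apply hn1 (i, j) hφ
      simp [Bd1, hne, hij]
    · intro i l j J hi hl hj hJ hc
      by_contra! hlt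
      apply hn2 ((i, l, j), J) (by simp [I2, hJ]) hφ
      simp only [Bd2]
      rw [if_pos ⟨hi, hl, hj, hc⟩]
      simp only [badv, Finset.mem_filter, Finset.mem_univ, true_and]
      rw [← Wr_insert]; exact hlt
  have h1 := Finset.card_le_card hcov
  have h2 : Φ.card ≤ (∑ p : Fin s × Fin s, (Φ.filter (fun φ => φ p.2 ∈ Bd1 p φ)).card) +
      ∑ p ∈ I2, (Φ.filter (fun φ => φ p.1.2.2 ∈ Bd2 p φ)).card :=
    h1.trans ((Finset.card_union_le _ _).trans
      (Nat.add_le_add Finset.card_biUnion_le Finset.card_biUnion_le))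
  have h3 : Φ.card * X.card ≤ (s ^ 2 + s ^ 3 * s ^ N) * (s * Φ.card) := by
    calc Φ.card * X.card ≤ ((∑ p : Fin s × Fin s, (Φ.filter (fun φ => φ p.2 ∈ Bd1 p φ)).card) +
      ∑ p ∈ I2, (Φ.filter (fun φ => φ p.1.2.2 ∈ Bd2 p φ)).card) * X.card :=
          Nat.mul_le_mul_right _ h2
      _ = (∑ p : Fin s × Fin s, (Φ.filter (fun φ => φ p.2 ∈ Bd1 p φ)).card * X.card) +
      ∑ p ∈ I2, (Φ.filter (fun φ => φ p.1.2.2 ∈ Bd2 p φ)).card * X.card := by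
          rw [add_mul, Finset.sum_mul, Finset.sum_mul]
      _ ≤ (∑ p : Fin s × Fin s, s * Φ.card) + ∑ p ∈ I2, s * Φ.card :=
          Nat.add_le_add (Finset.sum_le_sum (fun p _ => c1 p)) (Finset.sum_le_sum (fun p _ => c2 p))
      _ = s ^ 2 * (s * Φ.card) + I2.card * (s * Φ.card) := by
          rw [Finset.sum_const, Finset.sum_const, Finset.card_univ, Fintype.card_prod,
            Fintype.card_fin, smul_eq_mul, smul_eq_mul, sq]
      _ ≤ s ^ 2 * (s * Φ.card) + (s ^ 3 * s ^ N) * (s * Φ.card) := by gcongr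
      _ = _ := by ring
  have h4 : X.card ≤ (s ^ 2 + s ^ 3 * s ^ N) * s := by
    have : X.card * Φ.card ≤ ((s ^ 2 + s ^ 3 * s ^ N) * s) * Φ.card := by
      calc _ = Φ.card * X.card := mul_comm _ _
        _ ≤ _ := h3
        _ = _ := by ring
    exact Nat.le_of_mul_le_mul_right this hΦpos
  have h5 : (s ^ 2 + s ^ 3 * s ^ N) * s < s ^ (N + 5) := by
    have e1 : s ^ (N + 5) = s * (s ^ 4 * s ^ N) := by ring
    have e2 : (s ^ 2 + s ^ 3 * s ^ N) * s = s ^ 3 + s ^ 4 * s ^ N := by ring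
    have e3 : s ^ 3 ≤ s ^ 4 * s ^ N := by
      calc s ^ 3 ≤ s ^ (4 + N) := Nat.pow_le_pow_right (by omega) (by omega)
        _ = _ := by ring
    have e4 : 0 < s ^ 4 * s ^ N := by positivity
    rw [e1, e2]
    nlinarith
  omega

lemma lemE {V W : Type} [Fintype V] [Fintype W] (H : SimpleGraph W) {G : SimpleGraph V}
    {s N T : ℕ} (hN : Fintype.card W = N) (hb : NoBip G s) (hR : Ram G s N) (hs : 3 ≤ s)
    (X : Finset V) (hX : s ^ (N + 5) ≤ X.card)
    (hT : (2 * s) ^ (N + N ^ 2) * (2 * s * (N ^ 2 + 1)) ≤ T)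
    (hXT : ∀ a ∈ X, ∀ b ∈ X, a ≠ b → ¬ G.Adj a b → T ≤ (Wc G a b).card) :
    HasInducedSubdivision G H := by
  have hne : Nonempty V := by
    obtain ⟨x, -⟩ := Finset.card_pos.1 (lt_of_lt_of_le (by positivity) hX)
    exact ⟨x⟩
  obtain ⟨φ, hφX, hφi, hφ⟩ := exists_good (N := N) hb hs X hX
  obtain ⟨U, hU, hUc, hUi⟩ := hR (Finset.univ.image φ) (by
    rw [Finset.card_image_of_injective _ hφi]; simp)
  let U' : Finset (Fin s) := Finset.univ.filter (fun i => φ i ∈ U)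
  have hUU : U'.image φ = U := by
    ext u
    simp only [U', Finset.mem_image, Finset.mem_filter, Finset.mem_univ, true_and]
    constructor
    · rintro ⟨i, h, rfl⟩; exact h
    · intro h
      obtain ⟨i, -, rfl⟩ := Finset.mem_image.1 (hU h)
      exact ⟨i, h, rfl⟩
  have hU'c : U'.card = N := by
    rw [← hUc, ← hUU, Finset.card_image_of_injective _ hφi]
  have hpos : 0 < 2 * s := by omega
  have key : ∀ i ∈ U', ∀ l ∈ U', i ≠ l → ∀ J : Finset (Fin s), J ⊆ (U'.erase i).erase l →
      T ≤ (2 * s) ^ J.card * (Wr G φ i l J).card := by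
    intro i hi l hl hil J
    induction J using Finset.induction_on with
    | empty =>
      intro _
      have h1 : Wr G φ i l ∅ = Wc G (φ i) (φ l) := by simp [Wr]
      rw [h1]
      simp only [Finset.card_empty, pow_zero, one_mul]
      apply hXT _ (hφX i) _ (hφX l) (fun h => hil (hφi h))
      apply hUi
      · exact (Finset.mem_filter.1 hi).2
      · exact (Finset.mem_filter.1 hl).2
    | @insert j J hj ih =>
      intro hJ
      have hJ' : J ⊆ (U'.erase i).erase l := fun x hx => hJ (Finset.mem_insert_of_mem hx)
      have hjm := hJ (Finset.mem_insert_self _ _)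
      simp only [Finset.mem_erase] at hjm
      have h1 := ih hJ'
      have hcJ : J.card < N := by
        have h2 := Finset.card_le_card hJ
        rw [Finset.card_insert_of_notMem hj] at h2
        have h3 := Finset.card_le_card ((Finset.erase_subset l (U'.erase i)).trans
          (Finset.erase_subset i U'))
        omega
      have hbig : 2 * s ≤ (Wr G φ i l J).card := by
        have h5 : (2 * s) ^ J.card * (2 * s) ≤ (2 * s) ^ J.card * (Wr G φ i l J).card := by
          refine le_trans ?_ (hT.trans h1)
          apply Nat.mul_le_mul
          · exact Nat.pow_le_pow_right hpos (by omega)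
          · nlinarith [Nat.zero_le (N ^ 2)]
        exact Nat.le_of_mul_le_mul_left h5 (by positivity)
      have h6 := hφ i l j J hjm.2.1.symm hjm.1.symm hj hcJ hbig
      rw [Finset.card_insert_of_notMem hj, pow_succ, mul_assoc]
      exact h1.trans (Nat.mul_le_mul_left _ h6)
  -- branch vertices
  obtain ⟨σ⟩ : Nonempty (W ≃ U') := Fintype.card_eq.1 (by simp [hN, hU'c])
  let f : W → V := fun a => φ (σ a)
  have hf : Function.Injective f := fun a b h => σ.injective (Subtype.ext (hφi h))
  have hfU : ∀ a, f a ∈ U := fun a => (Finset.mem_filter.1 (σ a).2).2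
  have hUf : ∀ u ∈ U, ∃ a, f a = u := by
    intro u hu
    rw [← hUU, Finset.mem_image] at hu
    obtain ⟨i, hi, rfl⟩ := hu
    exact ⟨σ.symm ⟨i, hi⟩, by simp [f]⟩
  let E : Finset (Sym2 V) := (Finset.univ.filter (fun p : W × W => H.Adj p.1 p.2)).image
    (fun p => s(f p.1, f p.2))
  have hEc : E.card ≤ N ^ 2 := by
    refine Finset.card_image_le.trans ((Finset.card_le_card (Finset.filter_subset _ _)).trans ?_)
    simp [hN, sq]
  let Wf : Sym2 V → Finset V := fun e => Finset.univ.filter (fun w => ∀ u ∈ U, (G.Adj w u ↔ u ∈ e))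
  obtain ⟨w, hw1, hw2⟩ := greedyW hb (by omega) E Wf (by
    intro e he
    obtain ⟨⟨a, b⟩, hab, rfl⟩ := Finset.mem_image.1 he
    have hab : H.Adj a b := (Finset.mem_filter.1 hab).2
    have hne : (σ a : Fin s) ≠ σ b := fun h => hab.ne (σ.injective (Subtype.ext h))
    have h1 := key (σ a) (σ a).2 (σ b) (σ b).2 hne _ subset_rfl
    have hsub : Wr G φ (σ a) (σ b) ((U'.erase (σ a)).erase (σ b)) ⊆ Wf s(f a, f b) := by
      intro w hw
      simp only [Wr, Wc, Finset.mem_filter, Finset.mem_inter, mem_nb, Finset.mem_univ, true_and,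
        Finset.mem_erase] at hw
      simp only [Wf, Finset.mem_filter, Finset.mem_univ, true_and]
      intro u hu
      rw [← hUU, Finset.mem_image] at hu
      obtain ⟨i, hi, rfl⟩ := hu
      rw [Sym2.mem_iff]
      constructor
      · intro hadj
        by_contra hcon
        rw [not_or] at hcon
        refine hw.2 i ⟨?_, ?_, hi⟩ hadj.symm
        · rintro rfl; exact hcon.2 rfl
        · rintro rfl; exact hcon.1 rfl
      · rintro (h | h)
        · rw [h]; exact hw.1.1.symm
        · rw [h]; exact hw.1.2.symm
    have h2 := Finset.card_le_card hsub
    have hJc : ((U'.erase (σ a)).erase (σ b)).card ≤ N := by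
      rw [← hU'c]
      exact Finset.card_le_card ((Finset.erase_subset _ _).trans (Finset.erase_subset _ _))
    have h3 : (2 * s) ^ N * ((2 * s) ^ (N ^ 2) * (2 * s * (N ^ 2 + 1))) ≤
        (2 * s) ^ N * (Wf s(f a, f b)).card := by
      calc _ = (2 * s) ^ (N + N ^ 2) * (2 * s * (N ^ 2 + 1)) := by ring
        _ ≤ T := hT
        _ ≤ _ := h1
        _ ≤ _ := Nat.mul_le_mul (Nat.pow_le_pow_right hpos hJc) h2
    have h4 := Nat.le_of_mul_le_mul_left h3 (by positivity)
    refine le_trans ?_ h4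
    apply Nat.mul_le_mul
    · exact Nat.pow_le_pow_right hpos hEc
    · exact Nat.mul_le_mul_left _ (by omega))
  have hEdge : ∀ e ∈ (H.map f).edgeSet, e ∈ E := by
    intro e he
    induction e using Sym2.ind with
    | _ x y =>
    have h' : (H.map (⟨f, hf⟩ : W ↪ V)).Adj x y := he
    rw [SimpleGraph.map_adj] at h'
    obtain ⟨a, b, hab, rfl, rfl⟩ := h'
    exact Finset.mem_image.2 ⟨(a, b), by simpa using hab, rfl⟩
  have hrange : ∀ u ∈ Set.range f, u ∈ U := by
    rintro _ ⟨a, rfl⟩; exact hfU a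
  apply finish_subdiv (Rl_base H f hf) w
  · intro u hu v hv
    exact hUi u (hrange u hu) v (hrange v hv)
  · intro e he
    have heE := hEdge e he
    have hwe := (Finset.mem_filter.1 (hw1 e heE)).2
    refine ⟨?_, fun u hu => hwe u (hrange u hu)⟩
    intro hcon
    obtain ⟨⟨a, b⟩, -, rfl⟩ := Finset.mem_image.1 heE
    have := (hwe (f a) (hfU a)).2 (Sym2.mem_mk_left _ _)
    exact hUi _ (hrange _ hcon) _ (hfU a) this
  · intro e he e' he'
    exact hw2 e (hEdge e he) e' (hEdge e' he')

end LemE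

section Samp
open scoped Classical

/-- product weight of a set -/
noncomputable def pw {α : Type} (p : α → ℝ) (I : Finset α) : ℝ := ∏ i ∈ I, p i

lemma pw_nonneg {α : Type} {p : α → ℝ} (h0 : ∀ i, 0 ≤ p i) (I : Finset α) : 0 ≤ pw p I :=
  Finset.prod_nonneg (fun i _ => h0 i)

noncomputable def mu {α : Type} [Fintype α] (p : α → ℝ) (S : Finset α) : ℝ :=
  (∏ i ∈ S, p i) * ∏ i ∈ Finset.univ \ S, (1 - p i)

lemma mu_nonneg {α : Type} [Fintype α] {p : α → ℝ} (h0 : ∀ i, 0 ≤ p i) (h1 : ∀ i, p i ≤ 1)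
    (S : Finset α) : 0 ≤ mu p S :=
  mul_nonneg (Finset.prod_nonneg (fun i _ => h0 i))
    (Finset.prod_nonneg (fun i _ => sub_nonneg.2 (h1 i)))

lemma mu_sup {α : Type} [Fintype α] (p : α → ℝ) (I : Finset α) :
    ∑ S : Finset α, mu p S * (if I ⊆ S then 1 else 0) = pw p I := by
  have h := Finset.prod_add p (fun i => if i ∈ I then 0 else 1 - p i) (Finset.univ : Finset α)
  have h1 : ∏ i : α, (p i + (if i ∈ I then 0 else 1 - p i)) = pw p I := by
    unfold pw
    rw [← Finset.prod_subset (Finset.subset_univ I)]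
    · apply Finset.prod_congr rfl
      intro i hi; simp [hi]
    · intro i _ hi; simp [hi]
  rw [h1] at h
  rw [h, Finset.powerset_univ]
  apply Finset.sum_congr rfl
  intro S _
  unfold mu
  by_cases hS : I ⊆ S
  · rw [if_pos hS, mul_one]
    congr 1
    apply Finset.prod_congr rfl
    intro i hi
    rw [if_neg]
    intro h; exact (Finset.mem_sdiff.1 hi).2 (hS h)
  · rw [if_neg hS, mul_zero]
    obtain ⟨i, hi, hiS⟩ := Finset.not_subset.1 hS
    symm
    apply mul_eq_zero_of_right
    apply Finset.prod_eq_zero (i := i) (by simp [hiS])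
    simp [hi]

lemma mu_one {α : Type} [Fintype α] (p : α → ℝ) : ∑ S : Finset α, mu p S = 1 := by
  have := mu_sup p ∅
  simpa [pw] using this

lemma samp2 {α κ : Type} [Fintype α] [DecidableEq α] (p : α → ℝ) (h0 : ∀ i, 0 ≤ p i) (h1 : ∀ i, p i ≤ 1)
    (Ch : Finset κ) (R : κ → Finset α) (Ob : κ → Finset (Finset α)) (cost : α → ℝ) :
    ∃ S : Finset α,
      ∑ k ∈ Ch, (pw p (R k) - ∑ F ∈ Ob k, pw p (R k ∪ F)) - ∑ i, cost i * p i ≤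
      ((Ch.filter (fun k => R k ⊆ S ∧ ∀ F ∈ Ob k, ¬ F ⊆ S)).card : ℝ) - ∑ i ∈ S, cost i := by
  by_contra! hcon
  set L := ∑ k ∈ Ch, (pw p (R k) - ∑ F ∈ Ob k, pw p (R k ∪ F)) - ∑ i, cost i * p i with hL
  let ind : Finset α → Finset α → ℝ := fun I S => if I ⊆ S then 1 else 0
  let f : Finset α → ℝ := fun S => ∑ k ∈ Ch, (ind (R k) S - ∑ F ∈ Ob k, ind (R k ∪ F) S) -
    ∑ i, cost i * ind {i} S
  have hf : ∀ S, f S < L := by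
    intro S
    refine lt_of_le_of_lt ?_ (hcon S)
    simp only [f]
    apply sub_le_sub
    · rw [Finset.card_filter, Nat.cast_sum]
      apply Finset.sum_le_sum
      intro k _
      have hnn : 0 ≤ ∑ F ∈ Ob k, ind (R k ∪ F) S :=
        Finset.sum_nonneg (fun F _ => by simp only [ind]; split_ifs <;> norm_num)
      by_cases hR : R k ⊆ S
      · by_cases hO : ∀ F ∈ Ob k, ¬ F ⊆ S
        · rw [if_pos ⟨hR, hO⟩]
          simp only [ind, if_pos hR] at hnn ⊢
          push_cast; linarith
        · rw [if_neg (by tauto)]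
          push Not at hO
          obtain ⟨F, hF, hFS⟩ := hO
          have h2 : ind (R k ∪ F) S ≤ ∑ F ∈ Ob k, ind (R k ∪ F) S :=
            Finset.single_le_sum (f := fun F => ind (R k ∪ F) S)
              (fun F _ => by simp only [ind]; split_ifs <;> norm_num) hF
          have h3 : ind (R k ∪ F) S = 1 := by
            simp only [ind]; rw [if_pos (Finset.union_subset hR hFS)]
          have h4 : ind (R k) S = 1 := by simp only [ind]; rw [if_pos hR]
          push_cast; linarith
      · rw [if_neg (by tauto)]
        have h4 : ind (R k) S = 0 := by simp only [ind]; rw [if_neg hR]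
        push_cast; linarith
    · apply le_of_eq
      simp only [ind, Finset.singleton_subset_iff, mul_ite, mul_one, mul_zero]
      rw [← Finset.sum_filter]
      congr 1; ext; simp
  have hsum : ∑ S : Finset α, mu p S * f S = L := by
    have e : ∀ I, ∑ S : Finset α, mu p S * ind I S = pw p I := by
      intro I; rw [← mu_sup p I]
      apply Finset.sum_congr rfl
      intro S _
      simp only [ind]; congr
    simp only [f, mul_sub, Finset.mul_sum, Finset.sum_sub_distrib]
    rw [Finset.sum_comm, hL]
    congr 1
    · rw [Finset.sum_sub_distrib]
      congr 1
      · exact Finset.sum_congr rfl (fun k _ => e _)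
      · rw [Finset.sum_comm]
        apply Finset.sum_congr rfl
        intro k _
        rw [Finset.sum_comm]
        exact Finset.sum_congr rfl (fun k _ => e _)
    · rw [Finset.sum_comm]
      apply Finset.sum_congr rfl
      intro i _
      rw [show p i = pw p {i} by simp [pw], ← e, Finset.mul_sum]
      apply Finset.sum_congr rfl
      intro S _; ring
  have hlt : ∑ S : Finset α, mu p S * f S < ∑ S : Finset α, mu p S * L := by
    obtain ⟨S0, -, hS0⟩ : ∃ S ∈ (Finset.univ : Finset (Finset α)), 0 < mu p S := by
      by_contra! hc
      have := Finset.sum_nonpos hc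
      rw [mu_one] at this; linarith
    apply Finset.sum_lt_sum
    · intro S _
      exact mul_le_mul_of_nonneg_left (hf S).le (mu_nonneg h0 h1 S)
    · exact ⟨S0, Finset.mem_univ _, mul_lt_mul_of_pos_left (hf S0) hS0⟩
  rw [hsum, ← Finset.sum_mul, mu_one, one_mul] at hlt
  exact lt_irrefl _ hlt

/-- the property of the constant `K` provided by `finishF` -/
def FK {W : Type} (H : SimpleGraph W) (K : ℕ) : Prop :=
  ∀ (V : Type) [Fintype V] (G : SimpleGraph V) (A B : Finset V),
      (∀ u ∈ A, ∀ v ∈ A, ¬ G.Adj u v) → (∀ u ∈ B, ∀ v ∈ B, ¬ G.Adj u v) →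
      (∀ b ∈ B, (nb G A b).card = 2) → (∀ b ∈ B, ∀ b' ∈ B, nb G A b = nb G A b' → b = b') →
      B.Nonempty → K * A.card ≤ B.card → HasInducedSubdivision G H

lemma cherryFinish {V W : Type} [Fintype V] {H : SimpleGraph W} {K : ℕ} (hK : FK H K)
    (G : SimpleGraph V) (A B : Finset V) (o : V → ℕ)
    (hB : ∀ u ∈ B, ∀ v ∈ B, ¬ G.Adj u v)
    (h2 : ∀ b ∈ B, (nb G A b).card = 2)
    (ho : ∀ b ∈ B, ∀ a ∈ nb G A b, ∀ u ∈ A, G.Adj a u → ¬ o u ≤ o a)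
    (hinj : ∀ b ∈ B, ∀ b' ∈ B, nb G A b = nb G A b' → b = b')
    (hne : B.Nonempty) (hc : K * A.card ≤ B.card) : HasInducedSubdivision G H := by
  let A2 := A.filter (fun a => ∀ u ∈ A, G.Adj a u → ¬ o u ≤ o a)
  have hA2 : A2 ⊆ A := Finset.filter_subset _ _
  have hnb : ∀ b ∈ B, nb G A2 b = nb G A b := by
    intro b hb
    apply Finset.Subset.antisymm (nb_mono hA2 b)
    intro a ha
    have := mem_nb.1 ha
    exact mem_nb.2 ⟨Finset.mem_filter.2 ⟨this.1, ho b hb a ha⟩, this.2⟩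
  apply hK V G A2 B
  · intro u hu v hv huv
    have hu' := Finset.mem_filter.1 hu
    have hv' := Finset.mem_filter.1 hv
    have := hu'.2 v hv'.1 huv
    have := hv'.2 u hu'.1 huv.symm
    omega
  · exact hB
  · intro b hb; rw [hnb b hb]; exact h2 b hb
  · intro b hb b' hb' h
    rw [hnb b hb, hnb b' hb'] at h
    exact hinj b hb b' hb' h
  · exact hne
  · exact (Nat.mul_le_mul_left _ (Finset.card_le_card hA2)).trans hc

end Samp

section Imb
open scoped Classical

structure Env {V W : Type} [Fintype V] [Fintype W] (H : SimpleGraph W) (G : SimpleGraph V)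
    (s N T K d : ℕ) : Prop where
  hN : Fintype.card W = N
  hb : NoBip G s
  hR : Ram G s N
  hs : 3 ≤ s
  hT : (2 * s) ^ (N + N ^ 2) * (2 * s * (N ^ 2 + 1)) ≤ T
  hK : FK H K
  hsp : Sparse G d
  hno : ¬ HasInducedSubdivision G H

lemma Env.light {V W : Type} [Fintype V] [Fintype W] {H : SimpleGraph W} {G : SimpleGraph V}
    {s N T K d : ℕ} (h : Env H G s N T K d) (X : Finset V) (hX : s ^ (N + 5) ≤ X.card) :
    ∃ a b, a ∈ X ∧ b ∈ X ∧ a ≠ b ∧ ¬ G.Adj a b ∧ (Wc G a b).card < T := by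
  by_contra! hcon
  exact h.hno (lemE H h.hN h.hb h.hR h.hs X hX h.hT
    (fun a ha b hb hab hn => hcon a b ha hb hab hn))

noncomputable def outn {V : Type} [Fintype V] (G : SimpleGraph V) (o : V → ℕ) (v : V) : Finset V :=
  (nb G Finset.univ v).filter (fun u => o u ≤ o v)

lemma mem_outn {V : Type} [Fintype V] {G : SimpleGraph V} {o : V → ℕ} {v u : V} :
    u ∈ outn G o v ↔ G.Adj v u ∧ o u ≤ o v := by
  simp [outn, mem_nb]

lemma exists_section {α β : Type} [Nonempty α] [DecidableEq β] (f : α → β) (S : Finset α) :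
    ∃ S' ⊆ S, Set.InjOn f S' ∧ S'.card = (S.image f).card := by
  have : ∀ e ∈ S.image f, ∃ a ∈ S, f a = e := fun e he => by simpa using he
  choose! g hg1 hg2 using this
  refine ⟨(S.image f).image g, ?_, ?_, ?_⟩
  · intro a ha
    obtain ⟨e, he, rfl⟩ := Finset.mem_image.1 ha
    exact hg1 e he
  · intro a ha a' ha' h
    obtain ⟨e, he, rfl⟩ := Finset.mem_image.1 ha
    obtain ⟨e', he', rfl⟩ := Finset.mem_image.1 ha'
    rw [hg2 e he, hg2 e' he'] at h
    rw [h]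
  · apply Finset.card_image_of_injOn
    intro e he e' he' h
    rw [← hg2 e he, ← hg2 e' he', h]

lemma imbal {V W : Type} [Fintype V] [Fintype W] {H : SimpleGraph W} {G : SimpleGraph V}
    {s N T K d : ℕ} (h : Env H G s N T K d) (hd : 100 ≤ d) (hTd : T ≤ d) (hKd : K ≤ d)
    (A B : Finset V) (hX : ∀ b ∈ B, s ^ (N + 5) ≤ (nb G A b).card)
    (hc : d ^ 6 * A.card ≤ B.card) : B = ∅ := by
  by_contra hBne
  obtain ⟨b0, hb0⟩ := Finset.nonempty_iff_ne_empty.2 hBne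
  have hApos : 0 < A.card := by
    have h1 := hX b0 hb0
    have h2 : 0 < s ^ (N + 5) := pow_pos (by have := h.hs; omega) _
    have h3 := Finset.card_le_card (nb_subset (G := G) (A := A) (v := b0))
    omega
  have hl : ∀ b ∈ B, ∃ a a', a ∈ nb G A b ∧ a' ∈ nb G A b ∧ a ≠ a' ∧ ¬ G.Adj a a' ∧
      (Wc G a a').card < T := fun b hb => h.light _ (hX b hb)
  choose! x y hx hy hxy hadj hWT using hl
  have hAB : A.card ≤ B.card := by
    refine le_trans ?_ hc
    have : 1 ≤ d ^ 6 := Nat.one_le_pow _ _ (by omega)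
    nlinarith
  -- small degrees
  let B1 := B.filter (fun b => (nb G A b).card ≤ 4 * d)
  have hB1 : B.card ≤ 2 * B1.card := by
    have e1 : 4 * d * (B \ B1).card ≤ d * (A.card + B.card) := by
      refine le_trans ?_ (h.hsp.two A B)
      calc 4 * d * (B \ B1).card = ∑ b ∈ B \ B1, 4 * d := by simp [mul_comm]
        _ ≤ ∑ b ∈ B \ B1, (nb G A b).card := by
            apply Finset.sum_le_sum
            intro b hb
            simp only [B1, Finset.mem_sdiff, Finset.mem_filter, not_and, not_le] at hb
            exact (hb.2 hb.1).le
        _ ≤ ec G A B := Finset.sum_le_sum_of_subset Finset.sdiff_subset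
    have e2 : (B \ B1).card + B1.card = B.card :=
      Finset.card_sdiff_add_card_eq_card (Finset.filter_subset _ _)
    have e3 : d * (4 * (B \ B1).card) ≤ d * (2 * B.card) := by
      calc _ = 4 * d * (B \ B1).card := by ring
        _ ≤ _ := e1
        _ ≤ _ := Nat.mul_le_mul_left _ (by omega)
    have := Nat.le_of_mul_le_mul_left e3 (by omega)
    omega
  obtain ⟨B2, hB21, hB2i, hB2c⟩ := h.hsp.indep B1
  let pr : V → Sym2 V := fun b => s(x b, y b)
  have hB2B : B2 ⊆ B := hB21.trans (Finset.filter_subset _ _)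
  have him : B2.card ≤ T * (B2.image pr).card := by
    apply Finset.card_le_mul_card_image
    intro e he
    obtain ⟨b1, hb1, rfl⟩ := Finset.mem_image.1 he
    refine le_trans (Finset.card_le_card ?_) (hWT b1 (hB2B hb1)).le
    intro b hb
    rw [Finset.mem_filter] at hb
    have hbB := hB2B hb.1
    have h1 := (mem_nb.1 (hx b hbB)).2
    have h2 := (mem_nb.1 (hy b hbB)).2
    have h3 := Sym2.eq_iff.1 hb.2
    simp only [Wc, Finset.mem_inter, mem_nb, Finset.mem_univ, true_and]
    rcases h3 with ⟨e1, e2⟩ | ⟨e1, e2⟩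
    · rw [← e1, ← e2]; exact ⟨h1.symm, h2.symm⟩
    · rw [← e1, ← e2]; exact ⟨h2.symm, h1.symm⟩
  have : Nonempty V := ⟨b0⟩
  obtain ⟨B3, hB32, hB3i, hB3c⟩ := exists_section pr B2
  have hB3B := hB32.trans hB2B
  have hbig : 24 * d * K * A.card < B3.card := by
    by_contra! hcon
    have e1 : B.card ≤ 2 * ((d + 1) * (T * B3.card)) := by
      rw [hB3c]
      refine hB1.trans (Nat.mul_le_mul_left _ (hB2c.trans (Nat.mul_le_mul_left _ him)))
    have e2 : 2 * ((d + 1) * (T * B3.card)) ≤ 2 * ((d + 1) * (d * (24 * d * d * A.card))) := by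
      gcongr
      exact hcon.trans (by gcongr)
    have e3 : 2 * ((d + 1) * (d * (24 * d * d * A.card))) < d ^ 6 * A.card := by
      have : 2 * ((d + 1) * (d * (24 * d * d * A.card))) = (48 * (d + 1) * d ^ 3) * A.card := by
        ring
      rw [this]
      apply Nat.mul_lt_mul_of_pos_right _ hApos
      have e4 : 48 * (d + 1) < d ^ 3 := by
        have : 100 * 100 * d ≤ d ^ 3 := by
          calc 100 * 100 * d ≤ d * d * d := by gcongr
            _ = d ^ 3 := by ring
        omega
      calc 48 * (d + 1) * d ^ 3 < d ^ 3 * d ^ 3 :=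
            Nat.mul_lt_mul_of_pos_right e4 (by positivity)
        _ = d ^ 6 := by ring
    omega
  obtain ⟨o, ho⟩ := h.hsp.order Finset.univ
  have hout : ∀ v, (outn G o v).card ≤ d := fun v => ho v (Finset.mem_univ v)
  -- sampling
  let p : V → ℝ := fun _ => 1 / (12 * d)
  have hdR : (100 : ℝ) ≤ d := by exact_mod_cast hd
  have hp0 : ∀ i, 0 ≤ p i := fun i => by simp only [p]; positivity
  have hp1 : ∀ i, p i ≤ 1 := fun i => by
    simp only [p]; rw [div_le_one (by positivity)]; linarith
  let Q : V → Finset V := fun b =>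
    (nb G A b ∪ (outn G o (x b) ∪ outn G o (y b))) \ {x b, y b}
  obtain ⟨S, hS⟩ := samp2 p hp0 hp1 B3 (fun b => {x b, y b})
    (fun b => (Q b).image (fun u => {u})) (fun i => if i ∈ A then (K : ℝ) else 0)
  have hQc : ∀ b ∈ B3, (Q b).card ≤ 6 * d := by
    intro b hb
    have e1 : (nb G A b).card ≤ 4 * d := (Finset.mem_filter.1 (hB21 (hB32 hb))).2
    have e2 := Finset.card_union_le (nb G A b) (outn G o (x b) ∪ outn G o (y b))
    have e3 := Finset.card_union_le (outn G o (x b)) (outn G o (y b))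
    have e4 : (Q b).card ≤ (nb G A b ∪ (outn G o (x b) ∪ outn G o (y b))).card :=
      Finset.card_le_card Finset.sdiff_subset
    have e5 := hout (x b)
    have e6 := hout (y b)
    omega
  have hlow : (B3.card : ℝ) * ((1 / (12 * d)) ^ 2 / 2) - K * A.card * (1 / (12 * d)) ≤
      ∑ k ∈ B3, (pw p {x k, y k} - ∑ F ∈ (Q k).image (fun u => ({u} : Finset V)),
        pw p ({x k, y k} ∪ F)) - ∑ i, (if i ∈ A then (K : ℝ) else 0) * p i := by
    apply sub_le_sub
    · rw [← nsmul_eq_mul]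
      apply Finset.card_nsmul_le_sum
      intro b hb
      have hxyb := hxy b (hB3B hb)
      have e1 : pw p {x b, y b} = (1 / (12 * d)) ^ 2 := by
        simp only [pw, p, Finset.prod_const, Finset.card_pair hxyb]
      have e2 : ∑ F ∈ (Q b).image (fun u => ({u} : Finset V)), pw p ({x b, y b} ∪ F) ≤
          6 * d * (1 / (12 * d)) ^ 3 := by
        rw [Finset.sum_image (by intro u _ v _ huv; exact Finset.singleton_injective huv)]
        calc _ = ∑ u ∈ Q b, (1 / (12 * (d : ℝ))) ^ 3 := by
              apply Finset.sum_congr rfl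
              intro u hu
              have hu' := (Finset.mem_sdiff.1 hu).2
              simp only [pw, p, Finset.prod_const]
              congr 1
              rw [Finset.card_union_of_disjoint (by
                rw [Finset.disjoint_singleton_right]; exact hu'), Finset.card_pair hxyb]
              rfl
          _ = (Q b).card * (1 / (12 * (d : ℝ))) ^ 3 := by simp
          _ ≤ _ := by
              have : ((Q b).card : ℝ) ≤ 6 * d := by exact_mod_cast hQc b hb
              gcongr
      rw [e1]
      have e3 : 6 * (d : ℝ) * (1 / (12 * d)) ^ 3 = (1 / (12 * d)) ^ 2 / 2 := by
        field_simp; norm_num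
      linarith
    · apply le_of_eq
      simp only [p, ite_mul, zero_mul]
      rw [← Finset.sum_filter]
      simp; ring
  let A' := A ∩ S
  let B4 := B3.filter (fun b => ({x b, y b} : Finset V) ⊆ S ∧
    ∀ F ∈ (Q b).image (fun u => ({u} : Finset V)), ¬ F ⊆ S)
  have hcost : ∑ i ∈ S, (if i ∈ A then (K : ℝ) else 0) = K * A'.card := by
    rw [← Finset.sum_filter, Finset.filter_mem_eq_inter, Finset.inter_comm]
    simp [A', mul_comm]
  have hpos : (0 : ℝ) < (B3.card : ℝ) * ((1 / (12 * d)) ^ 2 / 2) - K * A.card * (1 / (12 * d)) := by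
    have e1 : (24 : ℝ) * d * K * A.card < B3.card := by exact_mod_cast hbig
    have e2 : (B3.card : ℝ) * ((1 / (12 * d)) ^ 2 / 2) - K * A.card * (1 / (12 * d)) =
        ((B3.card : ℝ) - 24 * d * K * A.card) * ((1 / (12 * d)) ^ 2 / 2) := by
      field_simp
      ring
    rw [e2]
    apply mul_pos (by linarith) (by positivity)
  have hfin : (K : ℝ) * A'.card < B4.card := by
    have := hlow.trans hS
    rw [hcost] at this
    have h2 : (0 : ℝ) < (B4.card : ℝ) - K * A'.card := lt_of_lt_of_le hpos this
    linarith
  have hfinN : K * A'.card < B4.card := by exact_mod_cast hfin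
  have hB4B : B4 ⊆ B := (Finset.filter_subset _ _).trans hB3B
  have hQS : ∀ b ∈ B4, ∀ u ∈ Q b, u ∉ S := by
    intro b hb u hu hus
    exact (Finset.mem_filter.1 hb).2.2 {u} (Finset.mem_image_of_mem _ hu) (by simpa using hus)
  have hnb : ∀ b ∈ B4, nb G A' b = {x b, y b} := by
    intro b hb
    have hbS := (Finset.mem_filter.1 hb).2.1
    apply Finset.Subset.antisymm
    · intro u hu
      by_contra hne
      have hu' := mem_nb.1 hu
      have hu2 := Finset.mem_inter.1 hu'.1
      refine hQS b hb u (Finset.mem_sdiff.2 ⟨Finset.mem_union_left _ ?_, hne⟩) hu2.2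
      exact mem_nb.2 ⟨hu2.1, hu'.2⟩
    · intro u hu
      have huS := hbS hu
      have : u ∈ nb G A b := by
        rcases Finset.mem_insert.1 hu with rfl | hu
        · exact hx b (hB4B hb)
        · rw [Finset.mem_singleton.1 hu]; exact hy b (hB4B hb)
      have h2 := mem_nb.1 this
      exact mem_nb.2 ⟨Finset.mem_inter.2 ⟨h2.1, huS⟩, h2.2⟩
  apply h.hno
  refine cherryFinish h.hK G A' B4 o ?_ ?_ ?_ ?_ (Finset.card_pos.1 (by omega)) hfinN.le
  · intro u hu v hv
    exact hB2i u (hB32 (Finset.filter_subset _ _ hu)) v (hB32 (Finset.filter_subset _ _ hv))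
  · intro b hb
    rw [hnb b hb, Finset.card_pair (hxy b (hB4B hb))]
  · intro b hb a ha u hu hau hle
    rw [hnb b hb] at ha
    have huS := (Finset.mem_inter.1 hu).2
    have hadj' := hadj b (hB4B hb)
    refine hQS b hb u (Finset.mem_sdiff.2 ⟨Finset.mem_union_right _ ?_, ?_⟩) huS
    · rcases Finset.mem_insert.1 ha with rfl | ha
      · exact Finset.mem_union_left _ (mem_outn.2 ⟨hau, hle⟩)
      · rw [Finset.mem_singleton] at ha
        subst ha
        exact Finset.mem_union_right _ (mem_outn.2 ⟨hau, hle⟩)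
    · intro hu2
      simp only [Finset.mem_insert, Finset.mem_singleton] at ha hu2
      rcases ha with rfl | rfl <;> rcases hu2 with rfl | rfl
      · exact hau.ne rfl
      · exact hadj' hau
      · exact hadj' hau.symm
      · exact hau.ne rfl
  · intro b hb b' hb' he
    rw [hnb b hb, hnb b' hb'] at he
    apply hB3i (Finset.filter_subset _ _ hb) (Finset.filter_subset _ _ hb')
    simp only [pr]
    have h1 : x b ∈ ({x b', y b'} : Finset V) := by rw [← he]; simp
    have h2 : y b ∈ ({x b', y b'} : Finset V) := by rw [← he]; simp
    have h3 := hxy b (hB4B hb)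
    simp only [Finset.mem_insert, Finset.mem_singleton] at h1 h2
    rw [Sym2.eq_iff]
    rcases h1 with h1 | h1 <;> rcases h2 with h2 | h2
    · exact absurd (h1.trans h2.symm) h3
    · exact Or.inl ⟨h1, h2⟩
    · exact Or.inr ⟨h1, h2⟩
    · exact absurd (h1.trans h2.symm) h3

end Imb

section Core
open scoped Classical

/-- ordered cherries at `b` -/
noncomputable def chr {V : Type} (G : SimpleGraph V) (A : Finset V) (b : V) : Finset (V × V) :=
  (nb G A b ×ˢ nb G A b).filter (fun x => x.1 ≠ x.2 ∧ ¬ G.Adj x.1 x.2)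

lemma mem_chr {V : Type} {G : SimpleGraph V} {A : Finset V} {b a a' : V} :
    (a, a') ∈ chr G A b ↔ (a ∈ nb G A b ∧ a' ∈ nb G A b) ∧ a ≠ a' ∧ ¬ G.Adj a a' := by
  simp [chr]

noncomputable def outB {V : Type} [Fintype V] (G : SimpleGraph V) (o : V → ℕ) (B : Finset V)
    (b : V) : Finset V := (outn G o b).filter (fun b' => b' ∈ B)

noncomputable def dom1 {V : Type} [Fintype V] (G : SimpleGraph V) (o : V → ℕ) (A : Finset V)
    (b a a' : V) : Finset V := (nb G A b ∪ (outn G o a ∪ outn G o a')) \ {a, a'}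

noncomputable def dom2 {V : Type} [Fintype V] (G : SimpleGraph V) (o : V → ℕ) (A B : Finset V)
    (b a a' : V) : Finset (Σ _ : V, V × V) :=
  (outB G o B b).sigma (fun b' => (nb G A b' \ {a, a'}).offDiag)

noncomputable def dom3 {V : Type} [Fintype V] (G : SimpleGraph V) (o : V → ℕ) (A B : Finset V)
    (b a a' : V) : Finset (Σ _ : V, V) :=
  ((outB G o B b).filter (fun b' => a ∈ nb G A b' ∨ a' ∈ nb G A b')).sigma
    (fun b' => nb G A b' \ {a, a'})

noncomputable def dom4 {V : Type} (G : SimpleGraph V) (A B : Finset V)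
    (b a a' : V) : Finset V :=
  B.filter (fun b' => b' ≠ b ∧ a ∈ nb G A b' ∧ a' ∈ nb G A b')

noncomputable def Obs {V : Type} [Fintype V] (G : SimpleGraph V) (o : V → ℕ) (A B : Finset V)
    (b a a' : V) : Finset (Finset (V ⊕ V)) :=
  (dom1 G o A b a a').image (fun x => {Sum.inl x}) ∪
  ((dom2 G o A B b a a').image (fun t => {Sum.inr t.1, Sum.inl t.2.1, Sum.inl t.2.2}) ∪
  ((dom3 G o A B b a a').image (fun t => {Sum.inr t.1, Sum.inl t.2}) ∪
  (dom4 G A B b a a').image (fun b' => {Sum.inr b'})))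

noncomputable def wt (p q : ℝ) {V : Type} : V ⊕ V → ℝ := Sum.elim (fun _ => p) (fun _ => q)

lemma sum_union_le {α : Type} [DecidableEq α] (S T : Finset α) (g : α → ℝ) (hg : ∀ i, 0 ≤ g i) :
    ∑ i ∈ S ∪ T, g i ≤ ∑ i ∈ S, g i + ∑ i ∈ T, g i := by
  have := Finset.sum_union_inter (s₁ := S) (s₂ := T) (f := g)
  have h2 : 0 ≤ ∑ i ∈ S ∩ T, g i := Finset.sum_nonneg (fun i _ => hg i)
  linarith

lemma sum_image_const {α β : Type} [DecidableEq β] (S : Finset α) (f : α → β) (g : β → ℝ) (c : ℝ)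
    (hc : 0 ≤ c) (h : ∀ a ∈ S, g (f a) = c) : ∑ i ∈ S.image f, g i ≤ S.card * c := by
  calc ∑ i ∈ S.image f, g i = ∑ i ∈ S.image f, c := by
        apply Finset.sum_congr rfl
        intro i hi
        obtain ⟨a, ha, rfl⟩ := Finset.mem_image.1 hi
        exact h a ha
    _ = (S.image f).card * c := by simp
    _ ≤ _ := by
        have : ((S.image f).card : ℝ) ≤ S.card := by exact_mod_cast Finset.card_image_le
        gcongr

lemma pw_R {V : Type} (p q : ℝ) (b a a' : V) (h : a ≠ a') :
    pw (wt p q) ({Sum.inr b, Sum.inl a, Sum.inl a'} : Finset (V ⊕ V)) = p ^ 2 * q := by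
  simp [pw, wt, h]; ring

lemma obs_sum {V : Type} [Fintype V] (G : SimpleGraph V) (o : V → ℕ) (A B : Finset V)
    (b a a' : V) (h : a ≠ a') (p q : ℝ) (hp : 0 ≤ p) (hq : 0 ≤ q) :
    ∑ F ∈ Obs G o A B b a a', pw (wt p q) ({Sum.inr b, Sum.inl a, Sum.inl a'} ∪ F) ≤
      (dom1 G o A b a a').card * (p ^ 3 * q) + (dom2 G o A B b a a').card * (p ^ 4 * q ^ 2) +
      (dom3 G o A B b a a').card * (p ^ 3 * q ^ 2) + (dom4 G A B b a a').card * (p ^ 2 * q ^ 2) := by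
  have h0 : ∀ i : V ⊕ V, 0 ≤ wt p q i := by
    rintro (i | i) <;> simpa [wt]
  have hnn : ∀ F, 0 ≤ pw (wt p q) ({Sum.inr b, Sum.inl a, Sum.inl a'} ∪ F) :=
    fun F => pw_nonneg h0 _
  have hne : ∀ b' ∈ outB G o B b, b ≠ b' := by
    intro b' hb'
    exact (mem_outn.1 (Finset.mem_filter.1 hb').1).1.ne
  unfold Obs
  refine (sum_union_le _ _ _ hnn).trans ?_
  refine (add_le_add_right (sum_union_le _ _ _ hnn) _).trans ?_
  refine (add_le_add_right (add_le_add_right (sum_union_le _ _ _ hnn) _) _).trans ?_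
  rw [add_assoc, add_assoc]
  refine add_le_add ?_ (add_le_add ?_ (add_le_add ?_ ?_))
  · apply sum_image_const _ _ _ _ (by positivity)
    intro x hx
    have hx := (Finset.mem_sdiff.1 hx).2
    simp only [Finset.mem_insert, Finset.mem_singleton, not_or] at hx
    have h1 := Ne.symm hx.1
    have h2 := Ne.symm hx.2
    simp [pw, wt, h, h1, h2]; ring
  · apply sum_image_const _ _ _ _ (by positivity)
    rintro ⟨b', c, c'⟩ hx
    simp only [dom2, Finset.mem_sigma, Finset.mem_offDiag, Finset.mem_sdiff, Finset.mem_insert,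
      Finset.mem_singleton, not_or] at hx
    obtain ⟨h1, ⟨-, h2, h3⟩, ⟨-, h4, h5⟩, h6⟩ := hx
    have h1 := hne b' h1
    have h2 := Ne.symm h2
    have h3 := Ne.symm h3
    have h4 := Ne.symm h4
    have h5 := Ne.symm h5
    rw [Finset.insert_union, Finset.insert_union, Finset.singleton_union]
    simp [pw, wt, h, h1, h2, h3, h4, h5, h6]; ring
  · apply sum_image_const _ _ _ _ (by positivity)
    rintro ⟨b', c⟩ hx
    simp only [dom3, Finset.mem_sigma, Finset.mem_filter, Finset.mem_sdiff, Finset.mem_insert,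
      Finset.mem_singleton, not_or] at hx
    obtain ⟨⟨h1, -⟩, -, h2, h3⟩ := hx
    have h1 := hne b' h1
    have h2 := Ne.symm h2
    have h3 := Ne.symm h3
    rw [Finset.insert_union, Finset.insert_union, Finset.singleton_union]
    simp [pw, wt, h, h1, h2, h3]; ring
  · apply sum_image_const _ _ _ _ (by positivity)
    intro b' hx
    have h1 := Ne.symm (Finset.mem_filter.1 hx).2.1
    simp [pw, wt, h, h1]; ring

end Core

set_option linter.unusedSectionVars false

section Core2
open scoped Classical

lemma dc1 {V : Type} (G : SimpleGraph V) (A X U : Finset V) :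
    ∑ a ∈ X, ((U.filter (fun b' => a ∈ nb G A b')).card : ℝ) = ∑ b' ∈ U, ((X ∩ nb G A b').card : ℝ) := by
  have h : ∀ b', (X ∩ nb G A b').card = (X.filter (fun a => a ∈ nb G A b')).card := by
    intro b'; rw [Finset.filter_mem_eq_inter]
  simp only [h, Finset.card_filter, Nat.cast_sum]
  rw [Finset.sum_comm]

lemma dc2 {V : Type} (G : SimpleGraph V) (A X U : Finset V) :
    ∑ x ∈ X ×ˢ X, ((U.filter (fun b' => x.1 ∈ nb G A b' ∧ x.2 ∈ nb G A b')).card : ℝ) =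
      ∑ b' ∈ U, ((X ∩ nb G A b').card : ℝ) ^ 2 := by
  have h : ∀ b', ((X ∩ nb G A b').card : ℝ) ^ 2 =
      (((X ×ˢ X).filter (fun x => x.1 ∈ nb G A b' ∧ x.2 ∈ nb G A b')).card : ℝ) := by
    intro b'
    rw [sq, ← Nat.cast_mul, ← Finset.card_product]
    congr 2
    ext ⟨x, y⟩
    simp only [Finset.mem_product, Finset.mem_inter, Finset.mem_filter]
    tauto
  simp only [h, Finset.card_filter, Nat.cast_sum]
  rw [Finset.sum_comm]

variable {V : Type} [Fintype V] {G : SimpleGraph V} {o : V → ℕ} {A B : Finset V}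
  {D DA κ Y0 : ℝ} {d : ℕ}

lemma n1_le (hout : ∀ v, (outn G o v).card ≤ d) (hD : ∀ b ∈ B, ((nb G A b).card : ℝ) ≤ D)
    {b : V} (hb : b ∈ B) (a a' : V) : ((dom1 G o A b a a').card : ℝ) ≤ D + 2 * d := by
  have e2 := Finset.card_union_le (nb G A b) (outn G o a ∪ outn G o a')
  have e3 := Finset.card_union_le (outn G o a) (outn G o a')
  have e4 : (dom1 G o A b a a').card ≤ (nb G A b ∪ (outn G o a ∪ outn G o a')).card :=
    Finset.card_le_card Finset.sdiff_subset
  have e5 := hout a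
  have e6 := hout a'
  have e7 : (dom1 G o A b a a').card ≤ (nb G A b).card + 2 * d := by omega
  have e8 : ((dom1 G o A b a a').card : ℝ) ≤ (nb G A b).card + 2 * d := by exact_mod_cast e7
  linarith [hD b hb]

lemma outB_card (hout : ∀ v, (outn G o v).card ≤ d) (b : V) : (outB G o B b).card ≤ d :=
  (Finset.card_le_card (Finset.filter_subset _ _)).trans (hout b)

lemma n2_le (hout : ∀ v, (outn G o v).card ≤ d)
    (hD : ∀ b ∈ B, ((nb G A b).card : ℝ) ≤ D)
    (b a a' : V) : ((dom2 G o A B b a a').card : ℝ) ≤ d * D ^ 2 := by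
  unfold dom2
  rw [Finset.card_sigma, Nat.cast_sum]
  calc _ ≤ ∑ b' ∈ outB G o B b, D ^ 2 := by
        apply Finset.sum_le_sum
        intro b' hb'
        have h1 := hD b' (Finset.mem_filter.1 hb').2
        have h2 : ((nb G A b' \ {a, a'}).offDiag).card ≤ (nb G A b').card ^ 2 := by
          rw [Finset.offDiag_card]
          have := Finset.card_le_card (Finset.sdiff_subset : nb G A b' \ {a, a'} ⊆ nb G A b')
          calc _ ≤ (nb G A b' \ {a, a'}).card * (nb G A b' \ {a, a'}).card := Nat.sub_le _ _
            _ ≤ (nb G A b').card * (nb G A b').card := Nat.mul_le_mul this this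
            _ = _ := (sq _).symm
        calc _ ≤ ((nb G A b').card : ℝ) ^ 2 := by exact_mod_cast h2
          _ ≤ _ := by gcongr
    _ = (outB G o B b).card * D ^ 2 := by simp
    _ ≤ _ := by
        have : ((outB G o B b).card : ℝ) ≤ d := by exact_mod_cast outB_card hout b
        gcongr

lemma n3_le (hD : ∀ b ∈ B, ((nb G A b).card : ℝ) ≤ D)
    (b a a' : V) : ((dom3 G o A B b a a').card : ℝ) ≤
      D * ((outB G o B b).filter (fun b' => a ∈ nb G A b')).card +
      D * ((outB G o B b).filter (fun b' => a' ∈ nb G A b')).card := by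
  unfold dom3
  rw [Finset.card_sigma, Nat.cast_sum, Finset.filter_or]
  have key : ∀ U : Finset V, U ⊆ B → ∑ b' ∈ U, ((nb G A b' \ {a, a'}).card : ℝ) ≤ D * U.card := by
    intro U hU
    calc _ ≤ ∑ b' ∈ U, D := by
          apply Finset.sum_le_sum
          intro b' hb'
          refine le_trans ?_ (hD b' (hU hb'))
          exact_mod_cast Finset.card_le_card Finset.sdiff_subset
      _ = _ := by simp [mul_comm]
  have hsub : outB G o B b ⊆ B := fun b' hb' => (Finset.mem_filter.1 hb').2
  refine (sum_union_le _ _ _ (fun i => Nat.cast_nonneg _)).trans ?_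
  exact add_le_add (key _ ((Finset.filter_subset _ _).trans hsub))
    (key _ ((Finset.filter_subset _ _).trans hsub))

lemma sum_codeg_out (hκ : 0 ≤ κ) (hD0 : 0 ≤ D) (hout : ∀ v, (outn G o v).card ≤ d)
    (hD : ∀ b ∈ B, ((nb G A b).card : ℝ) ≤ D) {b : V}
    (hY : ((B.filter (fun b' => b' ≠ b ∧ κ < ((nb G A b ∩ nb G A b').card : ℝ))).card : ℝ) ≤ Y0) :
    ∑ b' ∈ outB G o B b, ((nb G A b ∩ nb G A b').card : ℝ) ≤ d * κ + Y0 * D := by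
  calc _ ≤ ∑ b' ∈ outB G o B b, (κ + if κ < ((nb G A b ∩ nb G A b').card : ℝ) then D else 0) := by
        apply Finset.sum_le_sum
        intro b' hb'
        have h1 := hD b' (Finset.mem_filter.1 hb').2
        have h2 : ((nb G A b ∩ nb G A b').card : ℝ) ≤ (nb G A b').card := by
          exact_mod_cast Finset.card_le_card Finset.inter_subset_right
        split_ifs with h
        · linarith
        · push Not at h; linarith
    _ = (outB G o B b).card * κ +
        ((outB G o B b).filter (fun b' => κ < ((nb G A b ∩ nb G A b').card : ℝ))).card * D := by
        rw [Finset.sum_add_distrib, ← Finset.sum_filter]; simp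
    _ ≤ _ := by
        have h1 : ((outB G o B b).card : ℝ) ≤ d := by exact_mod_cast outB_card hout b
        have h2 : (((outB G o B b).filter
            (fun b' => κ < ((nb G A b ∩ nb G A b').card : ℝ))).card : ℝ) ≤ Y0 := by
          refine le_trans ?_ hY
          norm_cast
          apply Finset.card_le_card
          intro b' hb'
          rw [Finset.mem_filter] at hb' ⊢
          have h3 := Finset.mem_filter.1 hb'.1
          exact ⟨h3.2, (mem_outn.1 h3.1).1.ne', hb'.2⟩
        gcongr

lemma sum_codeg_sq (hκ : 0 ≤ κ) (hD0 : 0 ≤ D)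
    (hD : ∀ b ∈ B, ((nb G A b).card : ℝ) ≤ D) (hDA : ∀ a ∈ A, ((nb G B a).card : ℝ) ≤ DA)
    (hDA0 : 0 ≤ DA) {b : V} (hb : b ∈ B)
    (hY : ((B.filter (fun b' => b' ≠ b ∧ κ < ((nb G A b ∩ nb G A b').card : ℝ))).card : ℝ) ≤ Y0) :
    ∑ b' ∈ B.filter (fun b' => b' ≠ b), ((nb G A b ∩ nb G A b').card : ℝ) ^ 2 ≤
      κ * D * DA + Y0 * D ^ 2 := by
  have hsum : ∑ b' ∈ B, ((nb G A b ∩ nb G A b').card : ℝ) ≤ D * DA := by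
    rw [← dc1]
    calc _ ≤ ∑ a ∈ nb G A b, DA := by
          apply Finset.sum_le_sum
          intro a ha
          refine le_trans ?_ (hDA a (nb_subset ha))
          norm_cast
          apply Finset.card_le_card
          intro b' hb'
          rw [Finset.mem_filter] at hb'
          exact mem_nb.2 ⟨hb'.1, (mem_nb.1 hb'.2).2.symm⟩
      _ = (nb G A b).card * DA := by simp
      _ ≤ _ := by have := hD b hb; gcongr
  calc _ ≤ ∑ b' ∈ B.filter (fun b' => b' ≠ b), (κ * ((nb G A b ∩ nb G A b').card : ℝ) +
          if κ < ((nb G A b ∩ nb G A b').card : ℝ) then D ^ 2 else 0) := by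
        apply Finset.sum_le_sum
        intro b' hb'
        have h1 := hD b' (Finset.mem_filter.1 hb').1
        have h2 : ((nb G A b ∩ nb G A b').card : ℝ) ≤ (nb G A b').card := by
          exact_mod_cast Finset.card_le_card Finset.inter_subset_right
        have h3 : (0 : ℝ) ≤ ((nb G A b ∩ nb G A b').card : ℝ) := Nat.cast_nonneg _
        split_ifs with h
        · nlinarith
        · push Not at h; nlinarith
    _ = κ * ∑ b' ∈ B.filter (fun b' => b' ≠ b), ((nb G A b ∩ nb G A b').card : ℝ) +
        (B.filter (fun b' => b' ≠ b ∧ κ < ((nb G A b ∩ nb G A b').card : ℝ))).card * D ^ 2 := by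
        rw [Finset.sum_add_distrib, ← Finset.sum_filter, Finset.mul_sum, Finset.filter_filter]
        simp
    _ ≤ κ * (D * DA) + Y0 * D ^ 2 := by
        have : ∑ b' ∈ B.filter (fun b' => b' ≠ b), ((nb G A b ∩ nb G A b').card : ℝ) ≤ D * DA :=
          le_trans (Finset.sum_le_sum_of_subset_of_nonneg (Finset.filter_subset _ _)
            (fun _ _ _ => Nat.cast_nonneg _)) hsum
        gcongr
    _ = _ := by ring

lemma per_b (hκ : 0 ≤ κ) (hD0 : 0 ≤ D) (hout : ∀ v, (outn G o v).card ≤ d)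
    (hD : ∀ b ∈ B, ((nb G A b).card : ℝ) ≤ D) (hDA : ∀ a ∈ A, ((nb G B a).card : ℝ) ≤ DA)
    (hDA0 : 0 ≤ DA) (hY0 : 0 ≤ Y0) {b : V} (hb : b ∈ B)
    (hY : ((B.filter (fun b' => b' ≠ b ∧ κ < ((nb G A b ∩ nb G A b').card : ℝ))).card : ℝ) ≤ Y0)
    {p q : ℝ} (hp : 0 ≤ p) (hq : 0 ≤ q) :
    ∑ x ∈ chr G A b, ∑ F ∈ Obs G o A B b x.1 x.2,
        pw (wt p q) ({Sum.inr b, Sum.inl x.1, Sum.inl x.2} ∪ F) ≤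
      D ^ 2 * ((D + 2 * d) * (p ^ 3 * q) + d * D ^ 2 * (p ^ 4 * q ^ 2)) +
      2 * D ^ 2 * (d * κ + Y0 * D) * (p ^ 3 * q ^ 2) +
      (κ * D * DA + Y0 * D ^ 2) * (p ^ 2 * q ^ 2) := by
  have hX := hD b hb
  have h1 := sum_codeg_out hκ hD0 hout hD hY
  have h2 := sum_codeg_sq hκ hD0 hD hDA hDA0 hb hY
  have hn3 := fun a a' => n3_le (o := o) hD b a a'
  have hsub : chr G A b ⊆ nb G A b ×ˢ nb G A b := Finset.filter_subset _ _
  generalize nb G A b = X at hX h1 h2 hsub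
  generalize outB G o B b = U at h1 hn3
  have hX0 : (0 : ℝ) ≤ X.card := Nat.cast_nonneg _
  have E2 : ∑ x ∈ X ×ˢ X, (D * ((U.filter (fun b' => x.1 ∈ nb G A b')).card : ℝ) +
          D * ((U.filter (fun b' => x.2 ∈ nb G A b')).card : ℝ)) =
      2 * (X.card * D * ∑ b' ∈ U, ((X ∩ nb G A b').card : ℝ)) := by
    rw [Finset.sum_add_distrib, Finset.sum_product, Finset.sum_product, ← dc1]
    simp only [Finset.sum_const, ← Finset.mul_sum, nsmul_eq_mul]
    ring
  calc _ ≤ ∑ x ∈ chr G A b, (((D + 2 * d) * (p ^ 3 * q) + d * D ^ 2 * (p ^ 4 * q ^ 2)) +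
        (D * (U.filter (fun b' => x.1 ∈ nb G A b')).card +
          D * (U.filter (fun b' => x.2 ∈ nb G A b')).card) * (p ^ 3 * q ^ 2) +
        ((B.filter (fun b' => b' ≠ b)).filter
          (fun b' => x.1 ∈ nb G A b' ∧ x.2 ∈ nb G A b')).card * (p ^ 2 * q ^ 2)) := by
        apply Finset.sum_le_sum
        rintro ⟨a, a'⟩ hx
        refine (obs_sum G o A B b a a' (mem_chr.1 hx).2.1 p q hp hq).trans ?_
        have h1 := n1_le hout hD hb a a'
        have h2 := n2_le hout hD b a a'
        have h3 := hn3 a a'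
        have h4 : dom4 G A B b a a' = (B.filter (fun b' => b' ≠ b)).filter
          (fun b' => a ∈ nb G A b' ∧ a' ∈ nb G A b') := by
          rw [dom4, Finset.filter_filter]
        rw [h4]
        have e1 := mul_le_mul_of_nonneg_right h1 (show 0 ≤ p ^ 3 * q by positivity)
        have e2 := mul_le_mul_of_nonneg_right h2 (show 0 ≤ p ^ 4 * q ^ 2 by positivity)
        have e3 := mul_le_mul_of_nonneg_right h3 (show 0 ≤ p ^ 3 * q ^ 2 by positivity)
        dsimp only
        linarith
    _ ≤ ∑ x ∈ X ×ˢ X, (((D + 2 * d) * (p ^ 3 * q) + d * D ^ 2 * (p ^ 4 * q ^ 2)) +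
        (D * (U.filter (fun b' => x.1 ∈ nb G A b')).card +
          D * (U.filter (fun b' => x.2 ∈ nb G A b')).card) * (p ^ 3 * q ^ 2) +
        ((B.filter (fun b' => b' ≠ b)).filter
          (fun b' => x.1 ∈ nb G A b' ∧ x.2 ∈ nb G A b')).card * (p ^ 2 * q ^ 2)) := by
        apply Finset.sum_le_sum_of_subset_of_nonneg hsub
        intro x _ _
        positivity
    _ = (X.card : ℝ) ^ 2 * ((D + 2 * d) * (p ^ 3 * q) + d * D ^ 2 * (p ^ 4 * q ^ 2)) +
        2 * (X.card * D * ∑ b' ∈ U, ((X ∩ nb G A b').card : ℝ)) * (p ^ 3 * q ^ 2) +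
        (∑ b' ∈ B.filter (fun b' => b' ≠ b), ((X ∩ nb G A b').card : ℝ) ^ 2) *
          (p ^ 2 * q ^ 2) := by
        rw [Finset.sum_add_distrib, Finset.sum_add_distrib, ← Finset.sum_mul, ← Finset.sum_mul,
          dc2, E2, Finset.sum_const, Finset.card_product, nsmul_eq_mul, Nat.cast_mul, ← sq (X.card : ℝ)]
    _ ≤ _ := by
        have hS0 : 0 ≤ ∑ b' ∈ U, ((X ∩ nb G A b').card : ℝ) :=
          Finset.sum_nonneg (fun _ _ => Nat.cast_nonneg _)
        have h3 : (X.card : ℝ) * D * ∑ b' ∈ U, ((X ∩ nb G A b').card : ℝ) ≤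
          D * D * (d * κ + Y0 * D) :=
          mul_le_mul (mul_le_mul_of_nonneg_right hX hD0) h1 hS0 (by positivity)
        have e0 : (X.card : ℝ) ^ 2 ≤ D ^ 2 := by gcongr
        have e1 := mul_le_mul_of_nonneg_right e0
          (show 0 ≤ (D + 2 * d) * (p ^ 3 * q) + d * D ^ 2 * (p ^ 4 * q ^ 2) by positivity)
        have e2 := mul_le_mul_of_nonneg_right h3 (show 0 ≤ p ^ 3 * q ^ 2 by positivity)
        have e3 := mul_le_mul_of_nonneg_right h2 (show 0 ≤ p ^ 2 * q ^ 2 by positivity)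
        have h4 : 2 * D ^ 2 * (d * κ + Y0 * D) * (p ^ 3 * q ^ 2) =
          2 * (D * D * (d * κ + Y0 * D) * (p ^ 3 * q ^ 2)) := by ring
        rw [h4]
        linarith

end Core2

section Core3
open scoped Classical

lemma cherryCore {V W : Type} [Fintype V] [Fintype W] {H : SimpleGraph W} {G : SimpleGraph V}
    {s N T K d : ℕ} (h : Env H G s N T K d) (A B : Finset V) (D DA κ Y0 p q γ : ℝ)
    (hκ : 0 ≤ κ) (hD0 : 0 ≤ D) (hDA0 : 0 ≤ DA) (hY0 : 0 ≤ Y0) (hp : 0 ≤ p) (hq : 0 ≤ q)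
    (hp1 : p ≤ 1) (hq1 : q ≤ 1)
    (hD : ∀ b ∈ B, ((nb G A b).card : ℝ) ≤ D) (hDA : ∀ a ∈ A, ((nb G B a).card : ℝ) ≤ DA)
    (hY : ∀ b ∈ B,
      ((B.filter (fun b' => b' ≠ b ∧ κ < ((nb G A b ∩ nb G A b').card : ℝ))).card : ℝ) ≤ Y0)
    (hCh : γ ≤ ∑ b ∈ B, ((chr G A b).card : ℝ))
    (hnum : B.card * (D ^ 2 * ((D + 2 * d) * (p ^ 3 * q) + d * D ^ 2 * (p ^ 4 * q ^ 2)) +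
      2 * D ^ 2 * (d * κ + Y0 * D) * (p ^ 3 * q ^ 2) +
      (κ * D * DA + Y0 * D ^ 2) * (p ^ 2 * q ^ 2)) + 2 * K * A.card * p < γ * (p ^ 2 * q)) :
    False := by
  obtain ⟨o, ho⟩ := h.hsp.order Finset.univ
  have hout : ∀ v, (outn G o v).card ≤ d := fun v => ho v (Finset.mem_univ v)
  let Ch : Finset (Σ _ : V, V × V) := B.sigma (fun b => chr G A b)
  obtain ⟨S, hS⟩ := samp2 (wt p q) (by rintro (i | i) <;> simpa [wt])
    (by rintro (i | i) <;> simpa [wt]) Ch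
    (fun k => {Sum.inr k.1, Sum.inl k.2.1, Sum.inl k.2.2})
    (fun k => Obs G o A B k.1 k.2.1 k.2.2)
    (Sum.elim (fun i => if i ∈ A then 2 * (K : ℝ) else 0) (fun _ => 0))
  let A' := A.filter (fun a => Sum.inl a ∈ S)
  let Gd := Ch.filter (fun k => ({Sum.inr k.1, Sum.inl k.2.1, Sum.inl k.2.2} : Finset (V ⊕ V)) ⊆ S ∧
    ∀ F ∈ Obs G o A B k.1 k.2.1 k.2.2, ¬ F ⊆ S)
  have hcost : ∑ i ∈ S, (Sum.elim (fun i => if i ∈ A then 2 * (K : ℝ) else 0) (fun _ => 0) i : ℝ) =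
      2 * K * A'.card := by
    have e1 : ∑ i ∈ S, (Sum.elim (fun i => if i ∈ A then 2 * (K : ℝ) else 0) (fun _ => 0) i : ℝ) =
        ∑ i : V ⊕ V, if i ∈ S then
          (Sum.elim (fun i => if i ∈ A then 2 * (K : ℝ) else 0) (fun _ => 0) i : ℝ) else 0 := by
      rw [← Finset.sum_filter]; congr 1; ext; simp
    rw [e1, Fintype.sum_sum_type]
    simp only [Sum.elim_inl, Sum.elim_inr, ite_self, Finset.sum_const_zero, add_zero]
    have e2 : A' = Finset.univ.filter (fun i => Sum.inl i ∈ S ∧ i ∈ A) := by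
      ext i; simp [A', and_comm]
    rw [e2]
    simp only [← ite_and]
    rw [← Finset.sum_filter]
    simp [mul_comm]
  have hcost2 : ∑ i : V ⊕ V,
      (Sum.elim (fun i => if i ∈ A then 2 * (K : ℝ) else 0) (fun _ => 0) i : ℝ) * wt p q i =
      2 * K * A.card * p := by
    rw [Fintype.sum_sum_type]
    simp only [Sum.elim_inl, Sum.elim_inr, zero_mul, Finset.sum_const_zero, add_zero, wt, ite_mul]
    rw [← Finset.sum_filter]
    simp; ring
  rw [hcost, hcost2] at hS
  have hlow : γ * (p ^ 2 * q) - B.card * (D ^ 2 * ((D + 2 * d) * (p ^ 3 * q) +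
      d * D ^ 2 * (p ^ 4 * q ^ 2)) +
      2 * D ^ 2 * (d * κ + Y0 * D) * (p ^ 3 * q ^ 2) +
      (κ * D * DA + Y0 * D ^ 2) * (p ^ 2 * q ^ 2)) ≤
      ∑ k ∈ Ch, (pw (wt p q) {Sum.inr k.1, Sum.inl k.2.1, Sum.inl k.2.2} -
        ∑ F ∈ Obs G o A B k.1 k.2.1 k.2.2,
          pw (wt p q) ({Sum.inr k.1, Sum.inl k.2.1, Sum.inl k.2.2} ∪ F)) := by
    rw [Finset.sum_sub_distrib]
    apply sub_le_sub
    · rw [Finset.sum_sigma]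
      calc γ * (p ^ 2 * q) ≤ (∑ b ∈ B, ((chr G A b).card : ℝ)) * (p ^ 2 * q) := by gcongr
        _ = _ := by
          rw [Finset.sum_mul]
          apply Finset.sum_congr rfl
          intro b hb
          rw [← nsmul_eq_mul, ← Finset.sum_const]
          apply Finset.sum_congr rfl
          rintro ⟨a, a'⟩ hx
          rw [pw_R p q b a a' (mem_chr.1 hx).2.1]
    · rw [Finset.sum_sigma, ← nsmul_eq_mul]
      apply Finset.sum_le_card_nsmul
      intro b hb
      exact per_b hκ hD0 hout hD hDA hDA0 hY0 hb (hY b hb) hp hq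
  have hGd : 2 * (K : ℝ) * A'.card < Gd.card := by
    have h1 : (0 : ℝ) < (Gd.card : ℝ) - 2 * K * A'.card := by
      refine lt_of_lt_of_le ?_ hS
      linarith
    linarith
  have hGdN : 2 * (K * A'.card) < Gd.card := by
    rw [← mul_assoc]; exact_mod_cast hGd
  -- facts about good cherries
  have gB : ∀ k ∈ Gd, k.1 ∈ B := fun k hk => (Finset.mem_sigma.1 (Finset.mem_filter.1 hk).1).1
  have gC : ∀ k ∈ Gd, (k.2.1 ∈ nb G A k.1 ∧ k.2.2 ∈ nb G A k.1) ∧ k.2.1 ≠ k.2.2 ∧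
      ¬ G.Adj k.2.1 k.2.2 :=
    fun k hk => mem_chr.1 (Finset.mem_sigma.1 (Finset.mem_filter.1 hk).1).2
  have gS : ∀ k ∈ Gd, Sum.inr k.1 ∈ S ∧ Sum.inl k.2.1 ∈ S ∧ Sum.inl k.2.2 ∈ S := by
    intro k hk
    have := (Finset.mem_filter.1 hk).2.1
    exact ⟨this (by simp), this (by simp), this (by simp)⟩
  have g1 : ∀ k ∈ Gd, ∀ x ∈ dom1 G o A k.1 k.2.1 k.2.2, Sum.inl x ∉ S := by
    intro k hk x hx hxS
    refine (Finset.mem_filter.1 hk).2.2 {Sum.inl x} ?_ (by simpa using hxS)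
    exact Finset.mem_union_left _ (Finset.mem_image_of_mem _ hx)
  have g2 : ∀ k ∈ Gd, ∀ b' ∈ outB G o B k.1, Sum.inr b' ∈ S → ∀ c ∈ nb G A b', ∀ c' ∈ nb G A b',
      c ≠ c' → Sum.inl c ∈ S → Sum.inl c' ∈ S → c ≠ k.2.1 → c ≠ k.2.2 → c' ≠ k.2.1 → c' ≠ k.2.2 →
      False := by
    intro k hk b' hb' hbS c hc c' hc' hne hcS hcS' n1 n2 n3 n4
    refine (Finset.mem_filter.1 hk).2.2 {Sum.inr b', Sum.inl c, Sum.inl c'} ?_ ?_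
    · apply Finset.mem_union_right
      apply Finset.mem_union_left
      refine Finset.mem_image.2 ⟨⟨b', c, c'⟩, ?_, rfl⟩
      simp only [dom2, Finset.mem_sigma, Finset.mem_offDiag, Finset.mem_sdiff, Finset.mem_insert,
        Finset.mem_singleton, not_or]
      exact ⟨hb', ⟨hc, n1, n2⟩, ⟨hc', n3, n4⟩, hne⟩
    · intro z hz
      simp only [Finset.mem_insert, Finset.mem_singleton] at hz
      rcases hz with rfl | rfl | rfl <;> assumption
  have g3 : ∀ k ∈ Gd, ∀ b' ∈ outB G o B k.1, Sum.inr b' ∈ S →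
      (k.2.1 ∈ nb G A b' ∨ k.2.2 ∈ nb G A b') → ∀ c ∈ nb G A b', 
      Sum.inl c ∈ S → c ≠ k.2.1 → c ≠ k.2.2 → False := by
    intro k hk b' hb' hbS hor c hc hcS n1 n2
    refine (Finset.mem_filter.1 hk).2.2 {Sum.inr b', Sum.inl c} ?_ ?_
    · apply Finset.mem_union_right
      apply Finset.mem_union_right
      apply Finset.mem_union_left
      refine Finset.mem_image.2 ⟨⟨b', c⟩, ?_, rfl⟩
      simp only [dom3, Finset.mem_sigma, Finset.mem_filter, Finset.mem_sdiff, Finset.mem_insert,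
        Finset.mem_singleton, not_or]
      exact ⟨⟨hb', hor⟩, hc, n1, n2⟩
    · intro z hz
      simp only [Finset.mem_insert, Finset.mem_singleton] at hz
      rcases hz with rfl | rfl <;> assumption
  have g4 : ∀ k ∈ Gd, ∀ b' ∈ B, b' ≠ k.1 → Sum.inr b' ∈ S → k.2.1 ∈ nb G A b' →
      k.2.2 ∈ nb G A b' → False := by
    intro k hk b' hb' hne hbS h1 h2
    refine (Finset.mem_filter.1 hk).2.2 {Sum.inr b'} ?_ (by simpa using hbS)
    apply Finset.mem_union_right
    apply Finset.mem_union_right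
    apply Finset.mem_union_right
    exact Finset.mem_image.2 ⟨b', Finset.mem_filter.2 ⟨hb', hne, h1, h2⟩, rfl⟩
  have hnb : ∀ k ∈ Gd, nb G A' k.1 = {k.2.1, k.2.2} := by
    intro k hk
    have hc := gC k hk
    have hs := gS k hk
    apply Finset.Subset.antisymm
    · intro u hu
      by_contra hne
      have hu' := mem_nb.1 hu
      have hu2 := Finset.mem_filter.1 hu'.1
      refine g1 k hk u (Finset.mem_sdiff.2 ⟨Finset.mem_union_left _ ?_, hne⟩) hu2.2
      exact mem_nb.2 ⟨hu2.1, hu'.2⟩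
    · intro u hu
      have key : ∀ u, u ∈ nb G A k.1 → Sum.inl u ∈ S → u ∈ nb G A' k.1 := by
        intro u h1 h2
        have h3 := mem_nb.1 h1
        exact mem_nb.2 ⟨Finset.mem_filter.2 ⟨h3.1, h2⟩, h3.2⟩
      rcases Finset.mem_insert.1 hu with h1 | h1
      · rw [h1]; exact key _ hc.1.1 hs.2.1
      · rw [Finset.mem_singleton.1 h1]; exact key _ hc.1.2 hs.2.2
  let B4 := Gd.image (fun k => k.1)
  have hB4c : Gd.card ≤ 2 * B4.card := by
    apply Finset.card_le_mul_card_image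
    intro b hb
    obtain ⟨k, hk, rfl⟩ := Finset.mem_image.1 hb
    refine le_trans (Finset.card_le_card (t := {k, ⟨k.1, k.2.2, k.2.1⟩}) ?_) Finset.card_le_two
    intro k' hk'
    obtain ⟨hk'1, hk'2⟩ := Finset.mem_filter.1 hk'
    have e1 := hnb k hk
    have e2 := hnb k' hk'1
    rw [hk'2, e1] at e2
    have e3 := (gC k' hk'1).2.1
    obtain ⟨b1, a1, a1'⟩ := k
    obtain ⟨b2, a2, a2'⟩ := k'
    dsimp only at e2 e3 hk'2 ⊢
    subst hk'2
    have m1 : a2 ∈ ({a1, a1'} : Finset V) := by rw [e2]; simp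
    have m2 : a2' ∈ ({a1, a1'} : Finset V) := by rw [e2]; simp
    simp only [Finset.mem_insert, Finset.mem_singleton] at m1 m2
    rcases m1 with rfl | rfl <;> rcases m2 with rfl | rfl
    · exact absurd rfl e3
    · simp
    · simp
    · exact absurd rfl e3
  apply h.hno
  refine cherryFinish h.hK G A' B4 o ?_ ?_ ?_ ?_ ?_ (by omega)
  · have key : ∀ k ∈ Gd, ∀ k' ∈ Gd, G.Adj k.1 k'.1 → o k'.1 ≤ o k.1 → False := by
      intro k hk k' hk' hadj hle
      have hb' : k'.1 ∈ outB G o B k.1 :=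
        Finset.mem_filter.2 ⟨mem_outn.2 ⟨hadj, hle⟩, gB k' hk'⟩
      have c' := gC k' hk'
      have s' := gS k' hk'
      have q2 := g2 k hk k'.1 hb' s'.1 _ c'.1.1 _ c'.1.2 c'.2.1 s'.2.1 s'.2.2
      have q3 := g3 k hk k'.1 hb' s'.1
      have q3a := fun hor => q3 hor _ c'.1.1 s'.2.1
      have q3b := fun hor => q3 hor _ c'.1.2 s'.2.2
      have q4 := g4 k hk k'.1 (gB k' hk') hadj.ne' s'.1
      have m1 := c'.1.1
      have m2 := c'.1.2
      have ne := c'.2.1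
      by_cases x1 : k'.2.1 = k.2.1
      · rw [x1] at m1
        by_cases y2 : k'.2.2 = k.2.2
        · rw [y2] at m2; exact q4 m1 m2
        · exact q3b (Or.inl m1) (fun hh => ne (x1.trans hh.symm)) y2
      · by_cases x2 : k'.2.1 = k.2.2
        · rw [x2] at m1
          by_cases y1 : k'.2.2 = k.2.1
          · rw [y1] at m2; exact q4 m2 m1
          · exact q3b (Or.inr m1) y1 (fun hh => ne (x2.trans hh.symm))
        · by_cases y1 : k'.2.2 = k.2.1
          · rw [y1] at m2; exact q3a (Or.inl m2) x1 x2
          · by_cases y2 : k'.2.2 = k.2.2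
            · rw [y2] at m2; exact q3a (Or.inr m2) x1 x2
            · exact q2 x1 x2 y1 y2
    intro u hu v hv huv
    obtain ⟨k, hk, rfl⟩ := Finset.mem_image.1 hu
    obtain ⟨k', hk', rfl⟩ := Finset.mem_image.1 hv
    rcases le_total (o k'.1) (o k.1) with hle | hle
    · exact key k hk k' hk' huv hle
    · exact key k' hk' k hk huv.symm hle
  · intro b hb
    obtain ⟨k, hk, rfl⟩ := Finset.mem_image.1 hb
    rw [hnb k hk, Finset.card_pair (gC k hk).2.1]
  · intro b hb a ha u hu hau hle
    obtain ⟨k, hk, rfl⟩ := Finset.mem_image.1 hb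
    rw [hnb k hk] at ha
    have huS := (Finset.mem_filter.1 hu).2
    have hadj' := (gC k hk).2.2
    simp only [Finset.mem_insert, Finset.mem_singleton] at ha
    refine g1 k hk u (Finset.mem_sdiff.2 ⟨Finset.mem_union_right _ ?_, ?_⟩) huS
    · rcases ha with h1 | h1
      · rw [← h1]; exact Finset.mem_union_left _ (mem_outn.2 ⟨hau, hle⟩)
      · rw [← h1]; exact Finset.mem_union_right _ (mem_outn.2 ⟨hau, hle⟩)
    · intro hu2
      simp only [Finset.mem_insert, Finset.mem_singleton] at hu2
      rcases ha with h1 | h1 <;> rcases hu2 with h2 | h2 <;> rw [h1, h2] at hau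
      · exact hau.ne rfl
      · exact hadj' hau
      · exact hadj' hau.symm
      · exact hau.ne rfl
  · intro b hb b' hb' he
    obtain ⟨k, hk, rfl⟩ := Finset.mem_image.1 hb
    obtain ⟨k', hk', rfl⟩ := Finset.mem_image.1 hb'
    by_contra hne
    have hsub : A' ⊆ A := Finset.filter_subset _ _
    refine g4 k hk k'.1 (gB k' hk') (Ne.symm hne) (gS k' hk').1 ?_ ?_
    · apply nb_mono hsub; rw [← he, hnb k hk]; simp
    · apply nb_mono hsub; rw [← he, hnb k hk]; simp
  · apply Finset.card_pos.1; omega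

end Core3

section Dense
open scoped Classical

lemma dense_spot {V W : Type} [Fintype V] [Fintype W] {H : SimpleGraph W} {G : SimpleGraph V}
    {s N T K d : ℕ} (h : Env H G s N T K d) (X Y : Finset V) (κ : ℝ) (hκ : 0 ≤ κ)
    (hY : ∀ y ∈ Y, κ ≤ ((nb G X y).card : ℝ)) :
    ((Y.card : ℝ) * κ) ^ 4 ≤ (X.card : ℝ) ^ 3 *
      ((s : ℝ) ^ (N + 5) * (Y.card : ℝ) ^ 4 + (X.card : ℝ) ^ 3 * (T : ℝ) ^ 4) := by
  let P : Finset (Fin 4 → V) := Fintype.piFinset (fun _ => Y)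
  let Xt : (Fin 4 → V) → Finset V := fun t => X.filter (fun x => ∀ i, G.Adj x (t i))
  let bad : Finset (V × V) := (X ×ˢ X).filter (fun p => (Wc G p.1 p.2).card < T)
  have hPc : P.card = Y.card ^ 4 := by simp [P]
  have h1 : ∀ t, (Xt t).card ≤ s ^ (N + 5) +
      X.card * (bad.filter (fun p => ∀ i, G.Adj p.1 (t i) ∧ G.Adj p.2 (t i))).card := by
    intro t
    by_cases hc : s ^ (N + 5) ≤ (Xt t).card
    · obtain ⟨a, b, ha, hb, -, -, hab⟩ := h.light _ hc
      simp only [Xt, Finset.mem_filter] at ha hb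
      have : 1 ≤ (bad.filter (fun p => ∀ i, G.Adj p.1 (t i) ∧ G.Adj p.2 (t i))).card := by
        apply Finset.card_pos.2
        refine ⟨(a, b), ?_⟩
        simp only [bad, Finset.mem_filter, Finset.mem_product]
        exact ⟨⟨⟨ha.1, hb.1⟩, hab⟩, fun i => ⟨ha.2 i, hb.2 i⟩⟩
      have h2 : (Xt t).card ≤ X.card := Finset.card_le_card (Finset.filter_subset _ _)
      have h3 := Nat.le_mul_of_pos_right X.card this
      omega
    · omega
  have h2 : ∑ t ∈ P, (Xt t).card = ∑ x ∈ X, (nb G Y x).card ^ 4 := by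
    have : ∀ x, (nb G Y x).card ^ 4 = (P.filter (fun t => ∀ i, G.Adj x (t i))).card := by
      intro x
      have : P.filter (fun t => ∀ i, G.Adj x (t i)) = Fintype.piFinset (fun _ => nb G Y x) := by
        ext t
        simp only [P, Finset.mem_filter, Fintype.mem_piFinset, mem_nb]
        exact ⟨fun h i => ⟨h.1 i, h.2 i⟩, fun h => ⟨fun i => (h i).1, fun i => (h i).2⟩⟩
      rw [this]; simp
    simp_rw [this, Xt, Finset.card_filter]
    exact Finset.sum_comm
  have h3 : ∑ t ∈ P, (bad.filter (fun p => ∀ i, G.Adj p.1 (t i) ∧ G.Adj p.2 (t i))).card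
      ≤ X.card ^ 2 * T ^ 4 := by
    simp_rw [Finset.card_filter]
    rw [Finset.sum_comm]
    calc _ ≤ ∑ p ∈ bad, T ^ 4 := by
          apply Finset.sum_le_sum
          intro p hp
          rw [← Finset.card_filter]
          calc _ ≤ (Fintype.piFinset (fun _ : Fin 4 => Wc G p.1 p.2)).card := by
                apply Finset.card_le_card
                intro t ht
                simp only [Finset.mem_filter, Fintype.mem_piFinset, Wc, Finset.mem_inter, mem_nb,
                  Finset.mem_univ, true_and] at ht ⊢
                exact ht.2
            _ = (Wc G p.1 p.2).card ^ 4 := by simp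
            _ ≤ T ^ 4 := by
                apply Nat.pow_le_pow_left
                simp only [bad, Finset.mem_filter] at hp
                exact hp.2.le
      _ = bad.card * T ^ 4 := by simp
      _ ≤ X.card ^ 2 * T ^ 4 := by
          apply Nat.mul_le_mul_right
          calc bad.card ≤ (X ×ˢ X).card := Finset.card_le_card (Finset.filter_subset _ _)
            _ = X.card ^ 2 := by rw [Finset.card_product]; ring
  have h4 : ∑ x ∈ X, (nb G Y x).card ^ 4 ≤ s ^ (N + 5) * Y.card ^ 4 + X.card ^ 3 * T ^ 4 := by
    rw [← h2]
    calc _ ≤ ∑ t ∈ P, (s ^ (N + 5) +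
      X.card * (bad.filter (fun p => ∀ i, G.Adj p.1 (t i) ∧ G.Adj p.2 (t i))).card) :=
          Finset.sum_le_sum (fun t _ => h1 t)
      _ = s ^ (N + 5) * Y.card ^ 4 + X.card * ∑ t ∈ P, (bad.filter (fun p => ∀ i, G.Adj p.1 (t i) ∧ G.Adj p.2 (t i))).card := by
          rw [Finset.sum_add_distrib, Finset.mul_sum]; simp [hPc]; ring
      _ ≤ s ^ (N + 5) * Y.card ^ 4 + X.card * (X.card ^ 2 * T ^ 4) := by gcongr
      _ = _ := by ring
  have h5 : (Y.card : ℝ) * κ ≤ ∑ x ∈ X, ((nb G Y x).card : ℝ) := by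
    have e : ∑ x ∈ X, (nb G Y x).card = ∑ y ∈ Y, (nb G X y).card := ec_comm G Y X
    calc (Y.card : ℝ) * κ = ∑ y ∈ Y, κ := by simp
      _ ≤ ∑ y ∈ Y, ((nb G X y).card : ℝ) := Finset.sum_le_sum hY
      _ = _ := by exact_mod_cast e.symm
  have h7 := pow_sum_div_card_le_sum_pow (s := X) (f := fun x => ((nb G Y x).card : ℝ))
    (fun x _ => by positivity) 3
  rcases X.eq_empty_or_nonempty with rfl | hX
  · have : ((Y.card : ℝ) * κ) = 0 := le_antisymm (by simpa using h5) (by positivity)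
    rw [this]; simp
  have hXp : (0 : ℝ) < (X.card : ℝ) ^ 3 := by
    have := Finset.card_pos.2 hX
    positivity
  rw [div_le_iff₀ hXp] at h7
  have h4' : ∑ x ∈ X, ((nb G Y x).card : ℝ) ^ 4 ≤ (s : ℝ) ^ (N + 5) * (Y.card : ℝ) ^ 4 + (X.card : ℝ) ^ 3 * (T : ℝ) ^ 4 := by
    exact_mod_cast h4
  calc ((Y.card : ℝ) * κ) ^ 4 ≤ (∑ x ∈ X, ((nb G Y x).card : ℝ)) ^ 4 := by gcongr
    _ ≤ (∑ x ∈ X, ((nb G Y x).card : ℝ) ^ 4) * (X.card : ℝ) ^ 3 := h7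
    _ ≤ _ := by rw [mul_comm]; gcongr

/-- cherry count at one vertex -/
lemma chr_card {V : Type} [Fintype V] {G : SimpleGraph V} {s : ℕ} (hb : NoBip G s) (hs : 3 ≤ s)
    (A : Finset V) (b : V) :
    ((nb G A b).card : ℝ) ^ 2 / (4 * s) - 4 * s * (nb G A b).card ≤ ((chr G A b).card : ℝ) := by
  set Wn := nb G A b with hW
  have hs' : (3 : ℝ) ≤ s := by exact_mod_cast hs
  by_cases hc : 2 * s ≤ Wn.card
  · have h1 := badv_card hb Wn hc
    have h2 : (chr G A b).card = ∑ a ∈ Wn, (Wn.filter (fun x => a ≠ x ∧ ¬ G.Adj a x)).card := by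
      rw [chr, Finset.card_filter, Finset.sum_product]
      simp_rw [Finset.card_filter]
      rfl
    have h3 : ∀ a ∈ Wn \ badv G s Wn, (Wn.card : ℝ) / (2 * s) - 1 ≤
        ((Wn.filter (fun x => a ≠ x ∧ ¬ G.Adj a x)).card : ℝ) := by
      intro a ha
      simp only [Finset.mem_sdiff, badv, Finset.mem_filter, Finset.mem_univ, true_and, not_lt] at ha
      have h4 : (Wn \ nb G Wn a).card ≤ (Wn.filter (fun x => a ≠ x ∧ ¬ G.Adj a x)).card + 1 := by
        calc _ ≤ (insert a (Wn.filter (fun x => a ≠ x ∧ ¬ G.Adj a x))).card := by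
              apply Finset.card_le_card
              intro x hx
              simp only [Finset.mem_sdiff, mem_nb, not_and, Finset.mem_insert, Finset.mem_filter] at hx ⊢
              by_cases hxa : x = a
              · exact Or.inl hxa
              · exact Or.inr ⟨hx.1, fun h => hxa h.symm, hx.2 hx.1⟩
          _ ≤ _ := Finset.card_insert_le _ _
      have h5 : (Wn.card : ℝ) ≤ 2 * s * (Wn \ nb G Wn a).card := by exact_mod_cast ha.2
      have h6 : ((Wn \ nb G Wn a).card : ℝ) ≤ ((Wn.filter (fun x => a ≠ x ∧ ¬ G.Adj a x)).card : ℝ) + 1 := by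
        exact_mod_cast h4
      rw [sub_le_iff_le_add, div_le_iff₀ (by positivity)]
      nlinarith
    have h7 : ((Wn \ badv G s Wn).card : ℝ) * ((Wn.card : ℝ) / (2 * s) - 1) ≤ ((chr G A b).card : ℝ) := by
      rw [h2]; push_cast
      calc _ = ∑ a ∈ Wn \ badv G s Wn, ((Wn.card : ℝ) / (2 * s) - 1) := by
              rw [Finset.sum_const, nsmul_eq_mul]
        _ ≤ _ := Finset.sum_le_sum h3
        _ ≤ _ := Finset.sum_le_sum_of_subset_of_nonneg Finset.sdiff_subset (fun _ _ _ => by positivity)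
    have h8 : (Wn.card : ℝ) - s ≤ ((Wn \ badv G s Wn).card : ℝ) := by
      have := Finset.le_card_sdiff (badv G s Wn) Wn
      have : Wn.card ≤ (Wn \ badv G s Wn).card + s := by omega
      have : (Wn.card : ℝ) ≤ (Wn \ badv G s Wn).card + s := by exact_mod_cast this
      linarith
    have hc' : 2 * (s : ℝ) ≤ Wn.card := by exact_mod_cast hc
    have h9 : 0 ≤ (Wn.card : ℝ) / (2 * s) - 1 := by
      rw [sub_nonneg, le_div_iff₀ (by positivity)]; linarith
    refine le_trans ?_ (le_trans (mul_le_mul_of_nonneg_right h8 h9) h7)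
    have e : (Wn.card : ℝ) ^ 2 / (4 * s) = (Wn.card * (Wn.card / (2 * s))) / 2 := by
      field_simp; ring
    have e2 : (s : ℝ) * (Wn.card / (2 * s)) = Wn.card / 2 := by field_simp
    have e3 : 0 ≤ (Wn.card : ℝ) * (Wn.card / (2 * s)) := by positivity
    rw [e]
    nlinarith
  · have hc' : (Wn.card : ℝ) ≤ 2 * s := by
      have : Wn.card ≤ 2 * s := by omega
      exact_mod_cast this
    have : (Wn.card : ℝ) ^ 2 / (4 * s) ≤ 4 * s * Wn.card := by
      rw [div_le_iff₀ (by positivity)]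
      have : (0:ℝ) ≤ Wn.card := by positivity
      have h2 : (Wn.card : ℝ) * Wn.card ≤ Wn.card * (2 * s) := by gcongr
      nlinarith [mul_nonneg this (by positivity : (0:ℝ) ≤ s), mul_nonneg (mul_nonneg this (by positivity : (0:ℝ) ≤ s)) (by linarith : (0:ℝ) ≤ s - 3)]
    have : (0:ℝ) ≤ (chr G A b).card := by positivity
    linarith

/-- total cherry count -/
lemma chr_sum {V : Type} [Fintype V] {G : SimpleGraph V} {s : ℕ} (hb : NoBip G s) (hs : 3 ≤ s)
    (A B : Finset V) (hE : 32 * s ^ 2 * B.card ≤ ec G A B) (hB : 0 < B.card) :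
    (ec G A B : ℝ) ^ 2 / (8 * s * B.card) ≤ ∑ b ∈ B, ((chr G A b).card : ℝ) := by
  have hs' : (3 : ℝ) ≤ s := by exact_mod_cast hs
  have hB' : (0 : ℝ) < B.card := by exact_mod_cast hB
  have hE' : 32 * (s : ℝ) ^ 2 * B.card ≤ ec G A B := by exact_mod_cast hE
  have h1 : ∑ b ∈ B, (((nb G A b).card : ℝ) ^ 2 / (4 * s) - 4 * s * (nb G A b).card) ≤
      ∑ b ∈ B, ((chr G A b).card : ℝ) := Finset.sum_le_sum (fun b _ => chr_card hb hs A b)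
  refine le_trans ?_ h1
  have e : (ec G A B : ℝ) = ∑ b ∈ B, ((nb G A b).card : ℝ) := by simp [ec]
  have h2 : (ec G A B : ℝ) ^ 2 ≤ B.card * ∑ b ∈ B, ((nb G A b).card : ℝ) ^ 2 := by
    rw [e]; exact sq_sum_le_card_mul_sum_sq
  rw [Finset.sum_sub_distrib, ← Finset.mul_sum, ← Finset.sum_div, ← e]
  have h3 : (ec G A B : ℝ) ^ 2 / (4 * s * B.card) ≤ (∑ b ∈ B, ((nb G A b).card : ℝ) ^ 2) / (4 * s) := by
    rw [div_le_div_iff₀ (by positivity) (by positivity)]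
    nlinarith
  have h4 : 4 * s * (ec G A B : ℝ) ≤ (ec G A B : ℝ) ^ 2 / (8 * s * B.card) := by
    rw [le_div_iff₀ (by positivity)]
    have : (0:ℝ) ≤ ec G A B := by positivity
    nlinarith
  have h5 : (ec G A B : ℝ) ^ 2 / (4 * s * B.card) = 2 * ((ec G A B : ℝ) ^ 2 / (8 * s * B.card)) := by
    field_simp; ring
  linarith

end Dense

lemma num_core (a b D DA d m K : ℝ) (ha : 0 ≤ a) (hb : 0 < b) (hD : 0 < D) (hDA : 0 < DA)
    (hd : 0 < d) (hm : 16 ≤ m) (hK0 : 0 ≤ K) (hK : 2 * K ≤ m) (h1 : d ≤ m * D) (h2 : d ≤ m * DA)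
    (h3 : a * DA ≤ m ^ 3 * (b * D)) (u p q κ Y0 : ℝ) (hu : u = 1 / m) (hp : p = u ^ 25 / D)
    (hq : q = m ^ 38 / DA) (hκ : κ = D * u ^ 50) (hY0 : Y0 = d * u ^ 50) :
    b * (D ^ 2 * ((D + 2 * d) * (p ^ 3 * q) + d * D ^ 2 * (p ^ 4 * q ^ 2))
      + 2 * D ^ 2 * (d * κ + Y0 * D) * (p ^ 3 * q ^ 2)
      + (κ * D * DA + Y0 * D ^ 2) * (p ^ 2 * q ^ 2)) + 2 * K * a * p
      < (b * D ^ 2 * u ^ 8) * (p ^ 2 * q) := by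
  have hm0 : 0 < m := by linarith
  have hu0 : 0 < u := by rw [hu]; positivity
  have hmu : m * u = 1 := by rw [hu]; field_simp
  have hp0 : 0 < p := by rw [hp]; positivity
  have hq0 : 0 < q := by rw [hq]; positivity
  set F := b * D ^ 2 * (p ^ 2 * q) with hF
  have hF0 : 0 < F := by positivity
  have hpD : p * D = u ^ 25 := by rw [hp]; field_simp
  have hqDA : q * DA = m ^ 38 := by rw [hq]; field_simp
  have hdp : d * p ≤ m * u ^ 25 := by
    calc d * p ≤ (m * D) * p := by gcongr
      _ = m * (p * D) := by ring
      _ = _ := by rw [hpD]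
  have hdq : d * q ≤ m ^ 39 := by
    calc d * q ≤ (m * DA) * q := by gcongr
      _ = m * (q * DA) := by ring
      _ = _ := by rw [hqDA]; ring
  have hmk : ∀ k : ℕ, m ^ k * u ^ k = 1 := by intro k; rw [← mul_pow, hmu, one_pow]
  have t1 : b * (D ^ 2 * ((D + 2 * d) * (p ^ 3 * q))) ≤ F * (3 * u ^ 24) := by
    have : (D + 2 * d) * p ≤ 3 * u ^ 24 := by
      have e : m * u ^ 25 = u ^ 24 := by
        calc m * u ^ 25 = (m * u) * u ^ 24 := by ring
          _ = _ := by rw [hmu, one_mul]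
      have e2 : u ^ 25 ≤ u ^ 24 := by
        rw [← e]; nlinarith [pow_pos hu0 25]
      nlinarith
    calc _ = F * ((D + 2 * d) * p) := by rw [hF]; ring
      _ ≤ _ := by gcongr
  have t2 : b * (D ^ 2 * (d * D ^ 2 * (p ^ 4 * q ^ 2))) ≤ F * u ^ 11 := by
    calc _ = F * ((p * D) ^ 2 * (d * q)) := by rw [hF]; ring
      _ ≤ F * ((p * D) ^ 2 * m ^ 39) := by gcongr
      _ = F * ((m ^ 39 * u ^ 39) * u ^ 11) := by rw [hpD]; ring
      _ = _ := by rw [hmk, one_mul]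
  have t3 : b * (2 * D ^ 2 * (d * κ + Y0 * D) * (p ^ 3 * q ^ 2)) ≤ F * (4 * u ^ 36) := by
    calc _ = F * (4 * (p * D) * (d * q) * u ^ 50) := by rw [hF, hκ, hY0]; ring
      _ ≤ F * (4 * (p * D) * (m ^ 39) * u ^ 50) := by gcongr
      _ = F * (4 * ((m ^ 39 * u ^ 39) * u ^ 36)) := by rw [hpD]; ring
      _ = _ := by rw [hmk, one_mul]
  have t4 : b * ((κ * D * DA + Y0 * D ^ 2) * (p ^ 2 * q ^ 2)) ≤ F * (u ^ 12 + u ^ 11) := by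
    calc _ = F * ((q * DA) * u ^ 50 + (d * q) * u ^ 50) := by rw [hF, hκ, hY0]; ring
      _ ≤ F * ((q * DA) * u ^ 50 + m ^ 39 * u ^ 50) := by gcongr
      _ = F * ((m ^ 38 * u ^ 38) * u ^ 12 + (m ^ 39 * u ^ 39) * u ^ 11) := by rw [hqDA]; ring
      _ = _ := by rw [hmk, hmk, one_mul, one_mul]
  have t5 : 2 * K * a * p ≤ F * u ^ 9 := by
    have e : 2 * K * a * p * m ^ 13 ≤ (F * u ^ 9) * m ^ 13 := by
      have eF : (F * u ^ 9) * m ^ 13 = b * D * p * DA * q * ((m ^ 9 * u ^ 9) * m ^ 4) * (p * D) / DA := by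
        rw [hF]; field_simp
      have eF2 : (F * u ^ 9) * m ^ 13 = b * D * p * (m ^ 17 * (m ^25 * u ^ 25)) / DA := by
        rw [eF, hmk, hpD]
        calc _ = b * D * p * (q * DA) * m ^ 4 * u ^ 25 / DA := by ring
          _ = _ := by rw [hqDA]; ring
      rw [eF2, hmk, le_div_iff₀ hDA]
      calc 2 * K * a * p * m ^ 13 * DA = 2 * K * (a * DA) * (p * m ^ 13) := by ring
        _ ≤ m * (m ^ 3 * (b * D)) * (p * m ^ 13) := by gcongr
        _ = _ := by ring
    exact le_of_mul_le_mul_right e (by positivity)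
  have fin : 3 * u ^ 24 + u ^ 11 + 4 * u ^ 36 + (u ^ 12 + u ^ 11) + u ^ 9 < u ^ 8 := by
    have hu1 : u ≤ 1 / 16 := by rw [hu]; exact one_div_le_one_div_of_le (by norm_num) hm
    have hk : ∀ k : ℕ, u ^ (9 + k) ≤ u ^ 9 := by
      intro k
      exact pow_le_pow_of_le_one hu0.le (by linarith) (by omega)
    have a1 := hk 15
    have a2 := hk 2
    have a3 := hk 27
    have a4 := hk 3
    norm_num at a1 a2 a3 a4
    have a5 : u ^ 9 ≤ u ^ 8 * (1 / 16) := by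
      rw [pow_succ]; gcongr
    have := pow_pos hu0 8
    linarith
  have := mul_lt_mul_of_pos_left fin hF0
  calc _ = b * (D ^ 2 * ((D + 2 * d) * (p ^ 3 * q))) + b * (D ^ 2 * (d * D ^ 2 * (p ^ 4 * q ^ 2)))
        + b * (2 * D ^ 2 * (d * κ + Y0 * D) * (p ^ 3 * q ^ 2)) +
        b * ((κ * D * DA + Y0 * D ^ 2) * (p ^ 2 * q ^ 2)) + 2 * K * a * p := by ring
    _ ≤ F * (3 * u ^ 24 + u ^ 11 + 4 * u ^ 36 + (u ^ 12 + u ^ 11) + u ^ 9) := by linarith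
    _ < F * u ^ 8 := this
    _ = _ := by rw [hF]; ring

lemma num_dense (x y D d m κ X0 T : ℝ) (n T0 : ℕ) (hx0 : 0 ≤ x) (hxD : x ≤ D) (hm : 16 ≤ m) (hd : 0 < d)
    (hκ : κ = D * (1 / m) ^ 50) (hy : d * (1 / m) ^ 50 < y) (hX0' : 0 ≤ X0) (hX0 : X0 ≤ m ^ n)
    (hT0 : 0 ≤ T) (hT : T ≤ m ^ T0) (hC : m ^ (n + 409 + 4 * T0) ≤ d) (h1 : d ≤ m * D)
    (h2 : D ≤ m ^ 4 * d)
    (h : (y * κ) ^ 4 ≤ x ^ 3 * (X0 * y ^ 4 + x ^ 3 * T ^ 4)) : False := by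
  have hm0 : 0 < m := by linarith
  have hD : 0 < D := by
    by_contra hh
    nlinarith
  have hy0 : 0 < y := lt_of_le_of_lt (by positivity) hy
  have hy' : d < y * m ^ 50 := by
    have : d * (1 / m) ^ 50 * m ^ 50 < y * m ^ 50 := by gcongr
    have e : d * (1 / m) ^ 50 * m ^ 50 = d := by field_simp
    linarith
  have h3 : y ^ 4 * D ^ 4 ≤ m ^ 200 * (D ^ 3 * (m ^ n * y ^ 4 + D ^ 3 * (m ^ T0) ^ 4)) := by
    have e : (y * κ) ^ 4 * m ^ 200 = y ^ 4 * D ^ 4 := by rw [hκ]; field_simp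
    rw [← e, mul_comm]
    have : (y * κ) ^ 4 ≤ D ^ 3 * (m ^ n * y ^ 4 + D ^ 3 * (m ^ T0) ^ 4) := by
      refine h.trans ?_
      gcongr
    gcongr
  have h4 : y ^ 4 * D ≤ m ^ 200 * (m ^ n * y ^ 4 + D ^ 3 * (m ^ T0) ^ 4) := by
    have : D ^ 3 * (y ^ 4 * D) ≤ D ^ 3 * (m ^ 200 * (m ^ n * y ^ 4 + D ^ 3 * (m ^ T0) ^ 4)) := by
      calc _ = y ^ 4 * D ^ 4 := by ring
        _ ≤ _ := h3
        _ = _ := by ring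
    exact le_of_mul_le_mul_left this (by positivity)
  have h5 : m ^ 200 * (m ^ n * y ^ 4) * 4 ≤ y ^ 4 * D := by
    have : m ^ (n + 200) * 4 ≤ D := by
      have : m * (m ^ (n + 200) * 4) ≤ m * D := by
        calc m * (m ^ (n + 200) * 4) ≤ m * (m ^ (n + 200) * m) := by gcongr; linarith
          _ = m ^ (n + 202) := by ring
          _ ≤ m ^ (n + 409 + 4 * T0) := by
              apply pow_le_pow_right₀ (by linarith); omega
          _ ≤ _ := hC.trans h1
      exact le_of_mul_le_mul_left this hm0
    calc _ = y ^ 4 * (m ^ (n + 200) * 4) := by ring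
      _ ≤ _ := by gcongr
  have h6 : m ^ 200 * (D ^ 3 * (m ^ T0) ^ 4) * 4 ≤ y ^ 4 * D := by
    have a1 : D ^ 2 ≤ (m ^ 4 * d) ^ 2 := by gcongr
    have a2 : m ^ 200 * (D ^ 2 * (m ^ T0) ^ 4) * 4 * m ^ 200 ≤ y ^ 4 * m ^ 200 := by
      calc _ ≤ m ^ 200 * ((m ^ 4 * d) ^ 2 * (m ^ T0) ^ 4) * m * m ^ 200 := by
            gcongr; linarith
        _ = d ^ 2 * m ^ (409 + 4 * T0) := by ring
        _ ≤ d ^ 2 * m ^ (n + 409 + 4 * T0) := by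
            gcongr
            · linarith
            · omega
        _ ≤ d ^ 2 * d := by gcongr
        _ ≤ d ^ 2 * d * d := by
            have : 1 ≤ d := le_trans (one_le_pow₀ (by linarith)) hC
            nlinarith [pow_pos hd 3]
        _ = d ^ 4 := by ring
        _ ≤ (y * m ^ 50) ^ 4 := by gcongr
        _ = _ := by ring
    have a3 := le_of_mul_le_mul_right a2 (by positivity)
    calc _ = (m ^ 200 * (D ^ 2 * (m ^ T0) ^ 4) * 4) * D := by ring
      _ ≤ _ := by gcongr
  have : 0 < y ^ 4 * D := by positivity
  nlinarith

section Pair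
open scoped Classical

lemma pairFinal {V W : Type} [Fintype V] [Fintype W] {H : SimpleGraph W} {G : SimpleGraph V}
    {s N T K d : ℕ} (h : Env H G s N T K d) (M T0 : ℕ) (hMs : 16 * s ≤ M) (hMK : 2 * K ≤ M)
    (hT : T ≤ M ^ T0) (hd : M ^ (N + 5 + 409 + 4 * T0) ≤ d) (A B : Finset V) (D DA : ℝ)
    (hAB : A.card ≤ B.card) (hB : 0 < B.card)
    (hDb : ∀ b ∈ B, ((nb G A b).card : ℝ) ≤ D) (hDa : ∀ a ∈ A, ((nb G B a).card : ℝ) ≤ DA)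
    (hA3 : A.card * DA ≤ (M : ℝ) ^ 3 * ec G A B) (hB3 : B.card * D ≤ (M : ℝ) ^ 3 * ec G A B)
    (hdD : (d : ℝ) ≤ M * D) (hdDA : (d : ℝ) ≤ M * DA) : False := by
  have hs := h.hs
  have hM48 : 48 ≤ M := by omega
  have hm : (48 : ℝ) ≤ (M : ℝ) := by exact_mod_cast hM48
  set m : ℝ := (M : ℝ) with hmdef
  have hm0 : 0 < m := by linarith
  have hdR : m ^ (N + 5 + 409 + 4 * T0) ≤ (d : ℝ) := by rw [hmdef]; exact_mod_cast hd
  have hd1 : 1 ≤ (d : ℝ) := le_trans (one_le_pow₀ (by linarith)) hdR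
  have hd0 : 0 < (d : ℝ) := by linarith
  have hd41 : m ^ 41 ≤ d := le_trans (pow_le_pow_right₀ (by linarith) (by omega)) hdR
  have hD0 : 0 < D := by by_contra hh; nlinarith
  have hDA0 : 0 < DA := by by_contra hh; nlinarith
  have hBR : (0 : ℝ) < B.card := by exact_mod_cast hB
  have hKR : 2 * (K : ℝ) ≤ m := by rw [hmdef]; exact_mod_cast hMK
  have hsR : 16 * (s : ℝ) ≤ m := by rw [hmdef]; exact_mod_cast hMs
  have hs3 : (3 : ℝ) ≤ s := by exact_mod_cast hs
  have hE1 : (ec G A B : ℝ) ≤ B.card * D := by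
    have e : (ec G A B : ℝ) = ∑ b ∈ B, ((nb G A b).card : ℝ) := by simp [ec]
    rw [e]
    calc _ ≤ ∑ b ∈ B, D := Finset.sum_le_sum hDb
      _ = _ := by rw [Finset.sum_const, nsmul_eq_mul]
  have hE2 : (ec G A B : ℝ) ≤ 2 * d * B.card := by
    have := h.hsp.two A B
    have h2 : d * (A.card + B.card) ≤ 2 * d * B.card := by nlinarith
    exact_mod_cast this.trans h2
  have hDd : D ≤ m ^ 4 * d := by
    have : B.card * D ≤ B.card * (m ^ 4 * d) := by
      calc _ ≤ m ^ 3 * ec G A B := hB3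
        _ ≤ m ^ 3 * (2 * d * B.card) := by gcongr
        _ ≤ m ^ 3 * (m * d * B.card) := by gcongr; linarith
        _ = _ := by ring
    exact le_of_mul_le_mul_left this hBR
  have hEl : 32 * s ^ 2 * B.card ≤ ec G A B := by
    have : 32 * (s : ℝ) ^ 2 * B.card ≤ ec G A B := by
      have a1 : m ^ 4 * (32 * (s : ℝ) ^ 2 * B.card) ≤ m ^ 4 * ec G A B := by
        calc m ^ 4 * (32 * (s : ℝ) ^ 2 * B.card) ≤ m ^ 4 * (m ^ 2 * B.card) := by
              gcongr; nlinarith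
          _ = m ^ 6 * B.card := by ring
          _ ≤ m ^ 41 * B.card := by
              gcongr
              · linarith
              · norm_num
          _ ≤ (m * D) * B.card := by gcongr; linarith
          _ = m * (B.card * D) := by ring
          _ ≤ m * (m ^ 3 * ec G A B) := by gcongr
          _ = _ := by ring
      exact le_of_mul_le_mul_left a1 (by positivity)
    exact_mod_cast this
  have hγ : B.card * D ^ 2 * (1 / m) ^ 8 ≤ ∑ b ∈ B, ((chr G A b).card : ℝ) := by
    refine le_trans ?_ (chr_sum h.hb hs A B hEl hB)
    rw [le_div_iff₀ (by positivity)]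
    have a1 : (B.card * D) ^ 2 ≤ (m ^ 3 * ec G A B) ^ 2 := by gcongr
    have a2 : 8 * (s:ℝ) ≤ m := by linarith
    have a3 : B.card * D ^ 2 * (1 / m) ^ 8 * (8 * s * B.card) * m ^ 8 ≤ (ec G A B : ℝ) ^ 2 * m ^ 8 := by
      calc _ = (B.card * D) ^ 2 * (8 * s) := by field_simp
        _ ≤ (m ^ 3 * ec G A B) ^ 2 * m := by gcongr
        _ = (ec G A B : ℝ) ^ 2 * m ^ 7 := by ring
        _ ≤ (ec G A B : ℝ) ^ 2 * m ^ 8 := by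
          gcongr
          · linarith
          · norm_num
    exact le_of_mul_le_mul_right a3 (by positivity)
  have hA4 : A.card * DA ≤ m ^ 3 * (B.card * D) := hA3.trans (by gcongr)
  have hnum := num_core A.card B.card D DA d m K (by positivity) hBR hD0 hDA0 hd0 (by linarith)
    (by positivity) hKR hdD hdDA hA4 (1 / m) _ _ _ _ rfl rfl rfl rfl rfl
  have hu1 : (1 / m) ≤ 1 := by rw [div_le_one hm0]; linarith
  refine cherryCore h A B D DA (D * (1 / m) ^ 50) (d * (1 / m) ^ 50) ((1 / m) ^ 25 / D) (m ^ 38 / DA)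
    (B.card * D ^ 2 * (1 / m) ^ 8) (by positivity) (by positivity) (by positivity) (by positivity)
    (by positivity) (by positivity) ?_ ?_ hDb hDa ?_ hγ hnum
  · rw [div_le_one hD0]
    have : 1 ≤ D := by
      have : m * 1 ≤ m * D := by
        calc m * 1 ≤ m ^ 41 := by
              rw [mul_one]; exact le_self_pow₀ (by linarith) (by norm_num)
          _ ≤ _ := hd41.trans hdD
      exact le_of_mul_le_mul_left this hm0
    exact le_trans (pow_le_one₀ (by positivity) hu1) this
  · rw [div_le_one hDA0]
    have : m * m ^ 38 ≤ m * DA := by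
      calc m * m ^ 38 = m ^ 39 := by ring
        _ ≤ m ^ 41 := pow_le_pow_right₀ (by linarith) (by norm_num)
        _ ≤ _ := hd41.trans hdDA
    exact le_of_mul_le_mul_left this hm0
  · intro b hbB
    by_contra! hcon
    set Y := B.filter (fun b' => b' ≠ b ∧ D * (1 / m) ^ 50 < ((nb G A b ∩ nb G A b').card : ℝ)) with hY
    have hds := dense_spot h (nb G A b) Y (D * (1 / m) ^ 50) (by positivity) (by
      intro y hy
      rw [hY, Finset.mem_filter] at hy
      have e : nb G (nb G A b) y = nb G A b ∩ nb G A y := by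
        ext z; simp only [mem_nb, Finset.mem_inter]; tauto
      rw [e]; exact hy.2.2.le)
    refine num_dense _ _ D d m _ _ _ (N + 5) T0 (by positivity) (hDb b hbB) (by linarith) hd0 rfl hcon
      (by positivity) ?_ (by positivity) ?_ hdR hdD hDd hds
    · have : (s : ℝ) ≤ m := by linarith
      gcongr
    · rw [hmdef]; exact_mod_cast hT

end Pair

section Reg
open scoped Classical

lemma ec_fiber {V : Type} (G : SimpleGraph V) (S : Finset V) (c : V → ℕ) (L : ℕ)
    (hc : ∀ v ∈ S, c v < L) :
    ec G S S = ∑ j ∈ Finset.range L, ∑ i ∈ Finset.range L,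
      ec G (S.filter (fun v => c v = i)) (S.filter (fun v => c v = j)) := by
  have h1 : ∀ X : Finset V, ec G S X = ∑ i ∈ Finset.range L, ec G (S.filter (fun v => c v = i)) X := by
    intro X
    unfold ec
    rw [Finset.sum_comm]
    apply Finset.sum_congr rfl
    intro b _
    rw [Finset.card_eq_sum_card_fiberwise (f := c) (t := Finset.range L)]
    · apply Finset.sum_congr rfl
      intro i _
      congr 1
      ext z
      simp only [mem_nb, Finset.mem_filter]; tauto
    · intro v hv
      simp only [Finset.coe_range, Set.mem_Iio]
      exact hc v (nb_subset hv)
  have h2 : ∀ X : Finset V, ec G X S = ∑ j ∈ Finset.range L, ec G X (S.filter (fun v => c v = j)) := by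
    intro X
    rw [ec_comm, h1]
    apply Finset.sum_congr rfl
    intro i _
    rw [ec_comm]
  rw [h2]
  apply Finset.sum_congr rfl
  intro j _
  rw [h1]

lemma regular {V W : Type} [Fintype V] [Fintype W] {H : SimpleGraph W} {G : SimpleGraph V}
    {s N T K d : ℕ} (h : Env H G s N T K d) (M T0 L : ℕ) (hMs : 16 * s ≤ M) (hMK : 2 * K ≤ M)
    (hT : T ≤ M ^ T0) (hd : M ^ (N + 5 + 409 + 4 * T0) ≤ d) (hL : 4 * L ^ 2 ≤ M)
    (n : ℕ) (hn0 : 0 < n)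
    (V1 : Finset V) (hV1 : V1.card ≤ n) (hdeg : ∀ v ∈ V1, (nb G V1 v).card + 1 < M ^ L)
    (hE : d * n ≤ 4 * ec G V1 V1) : False := by
  have hs := h.hs
  have hM1 : 1 < M := by omega
  have hd0 : 0 < d := lt_of_lt_of_le (by positivity) hd
  set c : V → ℕ := fun v => Nat.log M ((nb G V1 v).card + 1) with hc
  have hcl : ∀ v ∈ V1, c v < L := by
    intro v hv
    exact Nat.log_lt_of_lt_pow (by omega) (hdeg v hv)
  have hfib := ec_fiber G V1 c L hcl
  obtain ⟨i, j, hij⟩ : ∃ i j, ec G V1 V1 ≤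
      L ^ 2 * ec G (V1.filter (fun v => c v = i)) (V1.filter (fun v => c v = j)) := by
    by_contra! hcon
    have hLpos : 0 < L := by
      rcases Nat.eq_zero_or_pos L with h0 | h0
      · rw [h0] at hfib
        simp at hfib
        rw [hfib] at hE
        have : 0 < d * n := by positivity
        omega
      · exact h0
    have : L ^ 2 * ec G V1 V1 < L ^ 2 * ec G V1 V1 := by
      calc L ^ 2 * ec G V1 V1 = ∑ j ∈ Finset.range L, ∑ i ∈ Finset.range L,
          L ^ 2 * ec G (V1.filter (fun v => c v = i)) (V1.filter (fun v => c v = j)) := by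
            rw [hfib]; simp_rw [Finset.mul_sum]
        _ < ∑ j ∈ Finset.range L, ∑ i ∈ Finset.range L, ec G V1 V1 := by
            apply Finset.sum_lt_sum_of_nonempty ⟨0, by simpa using hLpos⟩
            intro j _
            apply Finset.sum_lt_sum_of_nonempty ⟨0, by simpa using hLpos⟩
            intro i _
            exact hcon i j
        _ = _ := by simp; ring
    exact lt_irrefl _ this
  -- generic facts
  set A : ℕ → Finset V := fun i => V1.filter (fun v => c v = i) with hA
  have hsub : ∀ i, A i ⊆ V1 := fun i => Finset.filter_subset _ _
  have hME : d * n ≤ M * ec G (A i) (A j) := by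
    calc d * n ≤ 4 * ec G V1 V1 := hE
      _ ≤ 4 * (L ^ 2 * ec G (A i) (A j)) := by gcongr
      _ = (4 * L ^ 2) * ec G (A i) (A j) := by ring
      _ ≤ _ := by gcongr
  have hdegA : ∀ i, ∀ X ⊆ V1, ∀ v ∈ A i, ((nb G X v).card : ℝ) ≤ (M : ℝ) ^ (i + 1) := by
    intro i X hX v hv
    have h1 : (nb G X v).card ≤ (nb G V1 v).card := Finset.card_le_card (nb_mono hX v)
    have h2 : (nb G V1 v).card + 1 < M ^ (c v + 1) := Nat.lt_pow_succ_log_self hM1 _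
    have h3 : c v = i := (Finset.mem_filter.1 hv).2
    rw [h3] at h2
    have : (nb G X v).card ≤ M ^ (i + 1) := by omega
    exact_mod_cast this
  have hAc : ∀ i, (A i).card * M ^ (i + 1) ≤ 2 * M * (d * n) := by
    intro i
    have h1 : (A i).card * M ^ i ≤ ∑ v ∈ A i, ((nb G V1 v).card + 1) := by
      rw [← smul_eq_mul, ← Finset.sum_const]
      apply Finset.sum_le_sum
      intro v hv
      have h3 : c v = i := (Finset.mem_filter.1 hv).2
      rw [← h3]
      exact Nat.pow_log_le_self M (by omega)
    have h2 : ∑ v ∈ A i, ((nb G V1 v).card + 1) ≤ ∑ v ∈ V1, ((nb G V1 v).card + 1) :=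
      Finset.sum_le_sum_of_subset (hsub i)
    have h3 : ∑ v ∈ V1, ((nb G V1 v).card + 1) = ec G V1 V1 + V1.card := by
      rw [Finset.sum_add_distrib]; simp [ec]
    have h4 := h.hsp V1
    have h5 : d * V1.card ≤ d * n := by gcongr
    have h6 : V1.card ≤ d * n := by nlinarith
    have h7 : (A i).card * M ^ i ≤ 2 * (d * n) := by omega
    calc _ = M * ((A i).card * M ^ i) := by ring
      _ ≤ M * (2 * (d * n)) := by gcongr
      _ = _ := by ring
  have key : ∀ i j, (A i).card ≤ (A j).card → d * n ≤ M * ec G (A i) (A j) → False := by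
    intro i j hle hME
    have hEu : ec G (A i) (A j) ≤ (A j).card * M ^ (j + 1) := by
      have : ∀ b ∈ A j, (nb G (A i) b).card ≤ M ^ (j + 1) := by
        intro b hb; exact_mod_cast hdegA j (A i) (hsub i) b hb
      calc _ ≤ ∑ b ∈ A j, M ^ (j + 1) := Finset.sum_le_sum this
        _ = _ := by simp
    have hEu2 : ec G (A i) (A j) ≤ (A i).card * M ^ (i + 1) := by
      rw [ec_comm]
      have : ∀ b ∈ A i, (nb G (A j) b).card ≤ M ^ (i + 1) := by
        intro b hb; exact_mod_cast hdegA i (A j) (hsub j) b hb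
      calc _ ≤ ∑ b ∈ A i, M ^ (i + 1) := Finset.sum_le_sum this
        _ = _ := by simp
    have hAn : ∀ i, (A i).card ≤ n := fun i => (Finset.card_le_card (hsub i)).trans hV1
    have h3 : ∀ i', (A i').card * M ^ (i' + 1) ≤ M ^ 3 * ec G (A i) (A j) := by
      intro i'
      calc _ ≤ 2 * M * (d * n) := hAc i'
        _ ≤ 2 * M * (M * ec G (A i) (A j)) := by gcongr
        _ = 2 * (M ^ 2 * ec G (A i) (A j)) := by ring
        _ ≤ M * (M ^ 2 * ec G (A i) (A j)) := by gcongr; omega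
        _ = _ := by ring
    have h4 : ∀ i', ec G (A i) (A j) ≤ (A i').card * M ^ (i' + 1) → d ≤ M * M ^ (i' + 1) := by
      intro i' he
      have : d * n ≤ (M * M ^ (i' + 1)) * n := by
        calc d * n ≤ M * ((A i').card * M ^ (i' + 1)) := hME.trans (by gcongr)
          _ ≤ M * (n * M ^ (i' + 1)) := by gcongr; exact hAn i'
          _ = _ := by ring
      exact Nat.le_of_mul_le_mul_right this hn0
    have hBpos : 0 < (A j).card := by
      rcases Nat.eq_zero_or_pos (A j).card with h0 | h0
      · rw [h0, zero_mul] at hEu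
        have : ec G (A i) (A j) = 0 := by omega
        rw [this] at hME
        have : 0 < d * n := by positivity
        omega
      · exact h0
    refine pairFinal h M T0 hMs hMK hT hd (A i) (A j) ((M : ℝ) ^ (j + 1)) ((M : ℝ) ^ (i + 1)) hle hBpos
      (hdegA j _ (hsub i)) (hdegA i _ (hsub j)) ?_ ?_ ?_ ?_
    · exact_mod_cast h3 i
    · exact_mod_cast h3 j
    · exact_mod_cast h4 j hEu
    · exact_mod_cast h4 i hEu2
  rcases le_total (A i).card (A j).card with hle | hle
  · exact key i j hle hME
  · rw [ec_comm] at hME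
    exact key j i hle hME

lemma core {V W : Type} [Fintype V] [Fintype W] {H : SimpleGraph W} {G : SimpleGraph V}
    {s N T K d : ℕ} (h : Env H G s N T K d) (M T0 C : ℕ) (hMs : 16 * s ≤ M) (hMK : 2 * K ≤ M)
    (hT : T ≤ M ^ T0) (hC : C = N + 5 + 409 + 4 * T0) (hd : M ^ C ≤ d) (hd2 : d ≤ M ^ (2 * C))
    (hL : 4 * (18 * C + 1) ^ 2 ≤ M) (hn0 : 0 < Fintype.card V)
    (hE : d * Fintype.card V ≤ 2 * ec G Finset.univ Finset.univ) : False := by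
  set n := Fintype.card V with hn
  have hs := h.hs
  have hM48 : 48 ≤ M := by omega
  have hd0 : 0 < d := lt_of_lt_of_le (by positivity) hd
  have hMd : ∀ k, k ≤ C → M ^ k ≤ d := fun k hk =>
    le_trans (Nat.pow_le_pow_right (by omega) hk) hd
  let A : Finset V := Finset.univ.filter (fun v => d ^ 9 ≤ (nb G Finset.univ v).card)
  let V1 : Finset V := Finset.univ \ A
  let B : Finset V := Finset.univ.filter (fun v => s ^ (N + 5) ≤ (nb G A v).card)
  have hA : A.card * d ^ 8 ≤ n := by
    have h1 : A.card * d ^ 9 ≤ ec G Finset.univ Finset.univ := by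
      calc A.card * d ^ 9 = ∑ a ∈ A, d ^ 9 := by simp
        _ ≤ ∑ a ∈ A, (nb G Finset.univ a).card :=
            Finset.sum_le_sum (fun a ha => (Finset.mem_filter.1 ha).2)
        _ ≤ _ := Finset.sum_le_sum_of_subset (Finset.subset_univ _)
    have h2 : ec G Finset.univ Finset.univ ≤ d * n := h.hsp Finset.univ
    have h3 : d * (A.card * d ^ 8) ≤ d * n := by
      calc _ = A.card * d ^ 9 := by ring
        _ ≤ _ := h1.trans h2
    exact Nat.le_of_mul_le_mul_left h3 hd0
  have hTd : T ≤ d := hT.trans (hMd _ (by omega))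
  have hKd : K ≤ d := by
    have := hMd 1 (by omega)
    rw [pow_one] at this
    omega
  have hd100 : 100 ≤ d := by
    have := hMd 2 (by omega)
    nlinarith
  have hB : B.card ≤ d ^ 6 * A.card := by
    by_contra! hcon
    have := imbal h hd100 hTd hKd A B (fun b hb => (Finset.mem_filter.1 hb).2) hcon.le
    rw [this] at hcon
    simp at hcon
  have hAn : d * A.card ≤ n := by
    calc d * A.card = A.card * d ^ 1 := by ring
      _ ≤ A.card * d ^ 8 := by gcongr <;> omega
      _ ≤ n := hA
  have hBn : d * B.card ≤ n := by
    calc d * B.card ≤ d * (d ^ 6 * A.card) := by gcongr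
      _ = A.card * d ^ 7 := by ring
      _ ≤ A.card * d ^ 8 := by gcongr <;> omega
      _ ≤ n := hA
  have hAu : ec G A Finset.univ ≤ 2 * n + n * s ^ (N + 5) := by
    have h1 : ec G A Finset.univ ≤ ec G A B + n * s ^ (N + 5) := by
      unfold ec
      rw [← Finset.sum_filter_add_sum_filter_not Finset.univ (fun v => s ^ (N + 5) ≤ (nb G A v).card)]
      have : ∑ x ∈ Finset.univ.filter (fun v => ¬ s ^ (N + 5) ≤ (nb G A v).card), (nb G A x).card
          ≤ n * s ^ (N + 5) := by
        calc _ ≤ ∑ x ∈ Finset.univ.filter (fun v => ¬ s ^ (N + 5) ≤ (nb G A v).card), s ^ (N + 5) := by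
              apply Finset.sum_le_sum
              intro x hx
              have := (Finset.mem_filter.1 hx).2
              omega
          _ = (Finset.univ.filter (fun v => ¬ s ^ (N + 5) ≤ (nb G A v).card)).card * s ^ (N + 5) := by
              simp
          _ ≤ _ := by
              gcongr
              exact Finset.card_le_univ _
      exact Nat.add_le_add_left this _
    have h2 := h.hsp.two A B
    rw [Nat.mul_add] at h2
    omega
  have hsplit : ec G Finset.univ Finset.univ ≤ ec G V1 V1 + 2 * ec G A Finset.univ := by
    have e1 : ∀ X : Finset V, ec G Finset.univ X ≤ ec G V1 X + ec G A X := by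
      intro X
      unfold ec
      rw [← Finset.sum_add_distrib]
      apply Finset.sum_le_sum
      intro b _
      refine le_trans (Finset.card_le_card ?_) (Finset.card_union_le _ _)
      intro z hz
      simp only [Finset.mem_union, mem_nb, V1, Finset.mem_sdiff, Finset.mem_univ, true_and] at hz ⊢
      tauto
    have e2 := e1 Finset.univ
    have e3 := e1 V1
    have e4 : ec G A V1 ≤ ec G A Finset.univ := ec_mono G (Finset.Subset.refl _) (Finset.subset_univ _)
    rw [ec_comm G V1 Finset.univ] at e2
    omega
  have hX0 : s ^ (N + 5) ≤ M ^ (N + 5) := Nat.pow_le_pow_left (by omega) _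
  have hX1 : 16 + 8 * s ^ (N + 5) + 16 ≤ d := by
    have h1 := hMd (N + 6) (by omega)
    have h2 : 48 * M ^ (N + 5) ≤ M ^ (N + 6) := by
      rw [pow_succ M (N + 5), mul_comm]; gcongr
    have h3 : 1 ≤ M ^ (N + 5) := Nat.one_le_pow _ _ (by omega)
    omega
  refine regular h M T0 (18 * C + 1) hMs hMK hT (hC ▸ hd) hL n hn0 V1 (Finset.card_le_univ _) ?_ ?_
  · intro v hv
    have h1 : (nb G V1 v).card ≤ (nb G Finset.univ v).card :=
      Finset.card_le_card (nb_mono (Finset.subset_univ _) v)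
    have h2 : (nb G Finset.univ v).card < d ^ 9 := by
      simp only [V1, A, Finset.mem_sdiff, Finset.mem_univ, true_and, Finset.mem_filter, not_le] at hv
      exact hv
    have h3 : d ^ 9 ≤ M ^ (18 * C) := by
      calc d ^ 9 ≤ (M ^ (2 * C)) ^ 9 := by gcongr
        _ = _ := by rw [← pow_mul]; congr 1; ring
    have h4 : M ^ (18 * C) < M ^ (18 * C + 1) := Nat.pow_lt_pow_right (by omega) (by omega)
    omega
  · have h1 : (16 + 8 * s ^ (N + 5) + 16) * n ≤ d * n := by gcongr
    have h2 : (16 + 8 * s ^ (N + 5) + 16) * n = 32 * n + 8 * (n * s ^ (N + 5)) := by ring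
    omega

end Reg

section Final
open scoped Classical

lemma indCopy_of_emb {V U : Type} {G : SimpleGraph V} {S : SimpleGraph U} (f : S ↪g G) :
    HasInducedCopy G S := by
  refine ⟨Set.range f, ⟨?_⟩⟩
  refine (⟨Equiv.ofInjective f f.injective, ?_⟩ : S ≃g G.induce (Set.range f)).symm
  intro a b
  simp

lemma emb_of_indCopy {V U : Type} {G : SimpleGraph V} {S : SimpleGraph U} (h : HasInducedCopy G S) :
    Nonempty (S ↪g G) := by
  obtain ⟨s, ⟨e⟩⟩ := h
  exact ⟨(SimpleGraph.Embedding.induce s).comp e.symm.toEmbedding⟩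

lemma hasInd_comap {V V' W : Type} {G : SimpleGraph V} {H : SimpleGraph W} (f : V' ↪ V)
    (h : HasInducedSubdivision (G.comap f) H) : HasInducedSubdivision G H := by
  obtain ⟨U, S, hS, hc⟩ := h
  obtain ⟨g⟩ := emb_of_indCopy hc
  exact ⟨U, S, hS, indCopy_of_emb ((SimpleGraph.Embedding.comap f G).comp g)⟩

lemma nb_comap {V V' : Type} (G : SimpleGraph V) (f : V' ↪ V) (A : Finset V') (b : V') :
    nb G (A.map f) (f b) = (nb (G.comap f) A b).map f := by
  ext z
  simp only [mem_nb, Finset.mem_map, SimpleGraph.comap_adj]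
  constructor
  · rintro ⟨⟨a, ha, rfl⟩, h⟩; exact ⟨a, ⟨ha, h⟩, rfl⟩
  · rintro ⟨a, ⟨ha, h⟩, rfl⟩; exact ⟨⟨a, ha, rfl⟩, h⟩

lemma ec_comap {V V' : Type} (G : SimpleGraph V) (f : V' ↪ V) (A B : Finset V') :
    ec (G.comap f) A B = ec G (A.map f) (B.map f) := by
  unfold ec
  rw [Finset.sum_map]
  apply Finset.sum_congr rfl
  intro b _
  rw [nb_comap, Finset.card_map]

lemma NoBip.comap {V V' : Type} {G : SimpleGraph V} {s : ℕ} (h : NoBip G s) (f : V' ↪ V) :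
    NoBip (G.comap f) s := by
  intro X Y hX hY
  obtain ⟨x, hx, y, hy, hxy⟩ := h (X.map f) (Y.map f) (by simpa using hX) (by simpa using hY)
  obtain ⟨x', hx', rfl⟩ := Finset.mem_map.1 hx
  obtain ⟨y', hy', rfl⟩ := Finset.mem_map.1 hy
  exact ⟨x', hx', y', hy', hxy⟩

lemma Ram.comap {V V' : Type} {G : SimpleGraph V} {s N : ℕ} (h : Ram G s N) (f : V' ↪ V) :
    Ram (G.comap f) s N := by
  intro X hX
  obtain ⟨U, hU, hUc, hUi⟩ := h (X.map f) (by simpa using hX)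
  obtain ⟨U', hU', rfl⟩ := Finset.subset_map_iff.1 hU
  refine ⟨U', hU', by simpa using hUc, ?_⟩
  intro x hx y hy hxy
  exact hUi _ (Finset.mem_map_of_mem f hx) _ (Finset.mem_map_of_mem f hy) hxy

lemma ramsey {V : Type} (G : SimpleGraph V) : ∀ (n a b : ℕ), a + b = n → ∀ X : Finset V,
    (a + b).choose a ≤ X.card →
    (∃ U ⊆ X, U.card = a + 1 ∧ ∀ x ∈ U, ∀ y ∈ U, x ≠ y → G.Adj x y) ∨
    (∃ U ⊆ X, U.card = b + 1 ∧ ∀ x ∈ U, ∀ y ∈ U, ¬ G.Adj x y) := by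
  intro n
  induction n with
  | zero =>
    intro a b hab X hX
    obtain ⟨rfl, rfl⟩ : a = 0 ∧ b = 0 := by omega
    obtain ⟨x, hx⟩ := Finset.card_pos.1 (show 0 < X.card by simpa using hX)
    exact Or.inl ⟨{x}, by simpa using hx, by simp, by simp⟩
  | succ n ih =>
    intro a b hab X hX
    have hpos : 0 < X.card := lt_of_lt_of_le (Nat.choose_pos (by omega)) hX
    obtain ⟨v, hv⟩ := Finset.card_pos.1 hpos
    rcases Nat.eq_zero_or_pos a with rfl | ha
    · exact Or.inl ⟨{v}, by simpa using hv, by simp, by simp⟩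
    rcases Nat.eq_zero_or_pos b with rfl | hb
    · exact Or.inr ⟨{v}, by simpa using hv, by simp, by simp⟩
    obtain ⟨a, rfl⟩ : ∃ a', a = a' + 1 := ⟨a - 1, by omega⟩
    obtain ⟨b, rfl⟩ : ∃ b', b = b' + 1 := ⟨b - 1, by omega⟩
    have hsplit : ((nb G X v).card) + ((X.erase v) \ nb G X v).card = X.card - 1 := by
      rw [← Finset.card_erase_of_mem hv, add_comm]
      apply Finset.card_sdiff_add_card_eq_card
      intro z hz
      rw [mem_nb] at hz
      exact Finset.mem_erase.2 ⟨hz.2.ne', hz.1⟩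
    have hch : (a + 1 + (b + 1)).choose (a + 1) = (a + (b + 1)).choose a + (a + 1 + b).choose (a + 1) := by
      rw [show a + 1 + (b + 1) = (a + b + 1) + 1 by ring, Nat.choose_succ_succ]
      congr 2 <;> ring
    by_cases hc : (a + (b + 1)).choose a ≤ (nb G X v).card
    · rcases ih a (b + 1) (by omega) (nb G X v) hc with ⟨U, hU, hUc, hUa⟩ | ⟨U, hU, hUc, hUa⟩
      · left
        have hvU : v ∉ U := fun h => (mem_nb.1 (hU h)).2.ne rfl
        refine ⟨insert v U, ?_, by rw [Finset.card_insert_of_notMem hvU, hUc], ?_⟩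
        · exact Finset.insert_subset hv (hU.trans nb_subset)
        · intro x hx y hy hxy
          rcases Finset.mem_insert.1 hx with rfl | hx' <;> rcases Finset.mem_insert.1 hy with rfl | hy'
          · exact absurd rfl hxy
          · exact (mem_nb.1 (hU hy')).2
          · exact (mem_nb.1 (hU hx')).2.symm
          · exact hUa x hx' y hy' hxy
      · exact Or.inr ⟨U, hU.trans nb_subset, hUc, hUa⟩
    · have hc2 : (a + 1 + b).choose (a + 1) ≤ ((X.erase v) \ nb G X v).card := by omega
      have hsub : (X.erase v) \ nb G X v ⊆ X :=
        Finset.sdiff_subset.trans (Finset.erase_subset _ _)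
      rcases ih (a + 1) b (by omega) _ hc2 with ⟨U, hU, hUc, hUa⟩ | ⟨U, hU, hUc, hUa⟩
      · exact Or.inl ⟨U, hU.trans hsub, hUc, hUa⟩
      · right
        have hvU : v ∉ U := by
          intro h
          have := hU h
          simp at this
        have hna : ∀ y ∈ U, ¬ G.Adj v y := by
          intro y hy hvy
          have := hU hy
          rw [Finset.mem_sdiff] at this
          exact this.2 (mem_nb.2 ⟨hsub (hU hy), hvy⟩)
        refine ⟨insert v U, ?_, by rw [Finset.card_insert_of_notMem hvU, hUc], ?_⟩
        · exact Finset.insert_subset hv (hU.trans hsub)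
        · intro x hx y hy
          rcases Finset.mem_insert.1 hx with rfl | hx' <;> rcases Finset.mem_insert.1 hy with rfl | hy'
          · exact G.loopless.irrefl _
          · exact hna y hy'
          · exact fun h => hna x hx' h.symm
          · exact hUa x hx' y hy'

lemma ram_of_clique {V : Type} [Fintype V] (G : SimpleGraph V) (N s : ℕ)
    (hs : (G.cliqueNum + N) ^ N ≤ s) : Ram G s N := by
  intro X hX
  have h1 : (G.cliqueNum + N).choose G.cliqueNum ≤ X.card := by
    rw [Nat.choose_symm_add]
    exact (Nat.choose_le_pow _ _).trans (hs.trans hX)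
  rcases ramsey G _ _ _ rfl X h1 with ⟨U, hU, hUc, hUa⟩ | ⟨U, hU, hUc, hUa⟩
  · exfalso
    have hcl : G.IsClique (U : Set V) := by
      intro x hx y hy hxy
      exact hUa x hx y hy hxy
    have := hcl.card_le_cliqueNum
    omega
  · obtain ⟨U', hU', hc⟩ := Finset.exists_subset_card_eq (show N ≤ U.card by omega)
    exact ⟨U', hU'.trans hU, hc, fun x hx y hy => hUa x (hU' hx) y (hU' hy)⟩

lemma noBip_of {V : Type} (G : SimpleGraph V) (r t s : ℕ) (hR : Ram G s (r + t))
    (hno : ¬ HasInducedSubdivision G (completeBipartiteGraph (Fin r) (Fin t))) : NoBip G s := by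
  intro X Y hX hY
  by_contra! hcon
  apply hno
  obtain ⟨U, hU, hUc, hUi⟩ := hR X hX
  obtain ⟨Z, hZ, hZc, hZi⟩ := hR Y hY
  obtain ⟨U', hU', hc⟩ := Finset.exists_subset_card_eq (show r ≤ U.card by omega)
  obtain ⟨Z', hZ', hc'⟩ := Finset.exists_subset_card_eq (show t ≤ Z.card by omega)
  let e1 := (Finset.equivFinOfCardEq hc).symm
  let e2 := (Finset.equivFinOfCardEq hc').symm
  have hadj : ∀ i j, G.Adj (e1 i) (e2 j) := fun i j =>
    hcon _ (hU (hU' (e1 i).2)) _ (hZ (hZ' (e2 j).2))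
  have hU2 : ∀ i j, ¬ G.Adj (e1 i) (e1 j) := fun i j => hUi _ (hU' (e1 i).2) _ (hU' (e1 j).2)
  have hZ2 : ∀ i j, ¬ G.Adj (e2 i) (e2 j) := fun i j => hZi _ (hZ' (e2 i).2) _ (hZ' (e2 j).2)
  let f : Fin r ⊕ Fin t → V := Sum.elim (fun i => (e1 i : V)) (fun j => (e2 j : V))
  have hf : Function.Injective f := by
    rintro (i | i) (j | j) h
    · have : e1 i = e1 j := Subtype.ext h
      rw [e1.injective this]
    · exact absurd h (hadj i j).ne
    · exact absurd h (hadj j i).ne'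
    · have : e2 i = e2 j := Subtype.ext h
      rw [e2.injective this]
  refine ⟨_, _, IsSubdivision.refl _, indCopy_of_emb ⟨⟨f, hf⟩, ?_⟩⟩
  rintro (i | i) (j | j)
  · simpa [f, completeBipartiteGraph] using hU2 i j
  · simpa [f, completeBipartiteGraph] using hadj i j
  · simpa [f, completeBipartiteGraph] using (hadj j i).symm
  · simpa [f, completeBipartiteGraph] using hZ2 i j

lemma exists_sparse {V : Type} [Fintype V] (G : SimpleGraph V) : ∃ d, Sparse G d := by
  refine ⟨Fintype.card V, fun S => (ec_le_sq G S).trans ?_⟩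
  gcongr
  exact Finset.card_le_univ _

lemma sparse_bound {V W : Type} [Fintype V] [Fintype W] (H : SimpleGraph W) (G : SimpleGraph V)
    (N s K C Q : ℕ) (hN : Fintype.card W = N) (hb : NoBip G s) (hR : Ram G s N) (hs : 3 ≤ s)
    (hK : FK H K) (hno : ¬ HasInducedSubdivision G H)
    (hC : C = N + 5 + 409 + 4 * (N + N ^ 2 + 2))
    (hQ : Q = 16 * s + 2 * K + 4 * (18 * C + 1) ^ 2 + (N ^ 2 + 1)) :
    ∃ d, d < Q ^ C ∧ Sparse G d := by
  let d := Nat.find (exists_sparse G)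
  have hdS : Sparse G d := Nat.find_spec (exists_sparse G)
  refine ⟨d, ?_, hdS⟩
  by_contra! hcon
  have hQ48 : 48 ≤ Q := by omega
  have hd2 : 2 ≤ d := by
    have : Q ^ 1 ≤ Q ^ C := Nat.pow_le_pow_right (by omega) (by omega)
    rw [pow_one] at this
    omega
  have hmin : ¬ Sparse G (d - 1) := Nat.find_min (exists_sparse G) (by omega)
  unfold Sparse at hmin
  push Not at hmin
  obtain ⟨S0, hS0⟩ := hmin
  -- choice of M
  have hex : ∃ m, d < m ^ C := ⟨d + 1, lt_of_lt_of_le (Nat.lt_succ_self d)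
    (Nat.le_self_pow (by omega) _)⟩
  obtain ⟨m, hm1, hm2⟩ : ∃ m, d < m ^ C ∧ ∀ k < m, ¬ d < k ^ C :=
    ⟨Nat.find hex, Nat.find_spec hex, fun k hk => Nat.find_min hex hk⟩
  have hmQ : Q < m := by
    by_contra! hle
    have := Nat.pow_le_pow_left hle C
    omega
  obtain ⟨M, rfl⟩ : ∃ M, m = M + 1 := ⟨m - 1, by omega⟩
  have hMQ : Q ≤ M := by omega
  have hMd : M ^ C ≤ d := by
    have := hm2 M (by omega)
    omega
  have hdM : d ≤ M ^ (2 * C) := by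
    have : M + 1 ≤ M ^ 2 := by nlinarith
    calc d ≤ (M + 1) ^ C := hm1.le
      _ ≤ (M ^ 2) ^ C := Nat.pow_le_pow_left this C
      _ = _ := by rw [← pow_mul]
  let f : {x // x ∈ S0} ↪ V := Function.Embedding.subtype _
  have hu : (Finset.univ : Finset {x // x ∈ S0}).map f = S0 := by
    ext z; simp [f]
  have hcard : Fintype.card {x // x ∈ S0} = S0.card := by simp
  have henv : Env H (G.comap f) s N ((2 * s) ^ (N + N ^ 2) * (2 * s * (N ^ 2 + 1))) K d :=
    { hN := hN
      hb := hb.comap f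
      hR := hR.comap f
      hs := hs
      hT := le_refl _
      hK := hK
      hsp := by
        intro S
        rw [ec_comap]
        simpa using hdS (S.map f)
      hno := fun h => hno (hasInd_comap f h) }
  refine core henv M (N + N ^ 2 + 2) C (by omega) (by omega) ?_ hC hMd hdM (by omega) ?_ ?_
  · calc (2 * s) ^ (N + N ^ 2) * (2 * s * (N ^ 2 + 1)) ≤ M ^ (N + N ^ 2) * (M * M) := by
          gcongr <;> omega
      _ = _ := by ring
  · rw [hcard]
    rcases S0.eq_empty_or_nonempty with rfl | h0
    · simp [ec] at hS0
    · exact Finset.card_pos.2 h0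
  · rw [ec_comap, hu, hcard]
    have : d * S0.card ≤ 2 * ((d - 1) * S0.card) := by
      rw [← mul_assoc]
      gcongr
      omega
    omega

end Final

theorem stmt_1 (r t : ℕ) (hr : 0 < r) (ht : 0 < t) :
    ∃ f : Polynomial ℕ, ∀ (V : Type) [Fintype V], ∀ G : SimpleGraph V,
      ¬ HasInducedSubdivision G (completeBipartiteGraph (Fin r) (Fin t)) →
      G.chromaticNumber ≤ ((f.eval G.cliqueNum : ℕ) : ℕ∞) := by
  obtain ⟨K, hK⟩ := finishF (completeBipartiteGraph (Fin r) (Fin t))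
  obtain ⟨N, hN⟩ : ∃ N, N = r + t := ⟨_, rfl⟩
  obtain ⟨C, hC⟩ : ∃ C, C = N + 5 + 409 + 4 * (N + N ^ 2 + 2) := ⟨_, rfl⟩
  refine ⟨(16 * ((Polynomial.X + Polynomial.C N) ^ N + 3) + Polynomial.C (2 * K) +
    Polynomial.C (4 * (18 * C + 1) ^ 2) + Polynomial.C (N ^ 2 + 1)) ^ C, ?_⟩
  intro V _ G hno
  have hR : Ram G ((G.cliqueNum + N) ^ N + 3) N := ram_of_clique G N _ (by omega)
  have hb : NoBip G ((G.cliqueNum + N) ^ N + 3) := noBip_of G r t _ (hN ▸ hR) hno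
  obtain ⟨d, hd, hsp⟩ := sparse_bound (completeBipartiteGraph (Fin r) (Fin t)) G N
    ((G.cliqueNum + N) ^ N + 3) K C _ (by simp [hN]) hb hR (by omega) hK hno hC rfl
  obtain ⟨c, hc⟩ := hsp.color Finset.univ
  have hcol : G.Colorable (d + 1) :=
    ⟨SimpleGraph.Coloring.mk c (fun {u v} h => hc u (Finset.mem_univ _) v (Finset.mem_univ _) h)⟩
  refine hcol.chromaticNumber_le.trans ?_
  refine Nat.cast_le.2 (le_trans (Nat.succ_le_of_lt hd) (le_of_eq ?_))
  simp only [Polynomial.eval_pow, Polynomial.eval_add, Polynomial.eval_mul, Polynomial.eval_X,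
    Polynomial.eval_C, Polynomial.eval_ofNat]
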